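/- Let F_N : ℤ² → ℤ≥0 be the toppling function of the state 3 + Σ_{p∈P} δ_{[Np]} on Γ_N = (NΩ)∩ℤ², and define F̃_N : Ω → ℝ by F̃_N(x) = (1/N)·F_N([Nx]). Then the sequence F̃_N converges pointwise on Ω to the tropical polynomial F_{Ω,P}. -/

import Mathlib

open Filter
open scoped Pointwise Topology

/-! ## The abelian sandpile model on a finite subset `Γ` of `ℤ²` -/

/-- Lattice sites. -/
abbrev V : Type := ℤ × ℤ

/-- The four lattice neighbours of `v`. -/
def nbrs (v : V) : Finset V :=
  {(v.1 + 1, v.2), (v.1 - 1, v.2), (v.1, v.2 + 1), (v.1, v.2 - 1)}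

/-- A sandpile state on `Γ`: a nonnegative integer valued function, regarded as a
function on all of `ℤ²` vanishing outside `Γ`. -/
def IsState (Γ : Set V) (φ : V → ℤ) : Prop :=
  (∀ v, 0 ≤ φ v) ∧ ∀ v ∉ Γ, φ v = 0

open Classical in
/-- The toppling operator at `v ∈ Γ`: `T_v φ = φ - 4δ_v + ∑_{w ∈ n(v) ∩ Γ} δ_w`. -/
noncomputable def toppleAt (Γ : Set V) (v : V) (φ : V → ℤ) : V → ℤ :=
  fun w => φ w - (if w = v then 4 else 0) + (if w ∈ nbrs v ∧ w ∈ Γ then 1 else 0)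

/-- A state is stable if it is at most `3` everywhere on `Γ`. -/
def StableState (Γ : Set V) (φ : V → ℤ) : Prop := ∀ v ∈ Γ, φ v ≤ 3

/-- One legal toppling step: topple some `v ∈ Γ` with `φ v ≥ 4`. -/
def LegalStep (Γ : Set V) (φ ψ : V → ℤ) : Prop :=
  ∃ v ∈ Γ, 4 ≤ φ v ∧ ψ = toppleAt Γ v φ

/-- `ρ 0, ρ 1, …, ρ m` is a relaxation of `φ`: a sequence of legal topplings
ending in a stable state. -/
def IsRelaxation (Γ : Set V) (φ : V → ℤ) (m : ℕ) (ρ : ℕ → V → ℤ) : Prop :=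
  ρ 0 = φ ∧ (∀ i < m, LegalStep Γ (ρ i) (ρ (i + 1))) ∧ StableState Γ (ρ m)

/-- `ψ` is the result of some relaxation of `φ`. -/
def Relaxes (Γ : Set V) (φ ψ : V → ℤ) : Prop :=
  ∃ m ρ, IsRelaxation Γ φ m ρ ∧ ρ m = ψ

/-- The discrete Laplacian `ΔH(v) = -4H(v) + ∑_{w ∈ n(v)} H(w)`. -/
def lap (H : V → ℤ) (v : V) : ℤ := -4 * H v + ∑ w ∈ nbrs v, H w

/-- `H` belongs to the class `𝓗` for the state `φ` on `Γ`: it is nonnegative,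
vanishes outside `Γ`, and `φ + ΔH ≤ 3` on `Γ`. -/
def Odometer (Γ : Set V) (φ : V → ℤ) (H : V → ℤ) : Prop :=
  (∀ v, 0 ≤ H v) ∧ (∀ v ∉ Γ, H v = 0) ∧ ∀ v ∈ Γ, φ v + lap H v ≤ 3

/-! ## Geometry: lattice polygons, scaled lattice sets, deviation sets -/

/-- The embedding of the lattice `ℤ²` into the plane `ℝ²`. -/
def toR (v : ℤ × ℤ) : ℝ × ℝ := ((v.1 : ℝ), (v.2 : ℝ))

/-- `Ω` is a non-degenerate convex lattice polygon: the convex hull of a finite set of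
lattice points, with nonempty interior. -/
def IsLatticePolygon (Ω : Set (ℝ × ℝ)) : Prop :=
  (∃ S : Finset (ℤ × ℤ), Ω = convexHull ℝ (toR '' ↑S)) ∧ (interior Ω).Nonempty

/-- `Γ_N = (NΩ) ∩ ℤ²`. -/
def latGrid (Ω : Set (ℝ × ℝ)) (N : ℕ) : Set V := {v : V | toR v ∈ (N : ℝ) • Ω}

/-- Coordinate-wise floor `[Np] ∈ ℤ²` of the rescaled point `Np`, `p ∈ ℝ²`. -/
noncomputable def flr (N : ℕ) (p : ℝ × ℝ) : V := (⌊(N : ℝ) * p.1⌋, ⌊(N : ℝ) * p.2⌋)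

open Classical in
/-- The perturbed maximal state `3 + ∑_{p ∈ P} δ_{[Np]}` on `Γ_N` (as a function on `ℤ²`
vanishing outside `Γ_N`). -/
noncomputable def stateN (Ω : Set (ℝ × ℝ)) (P : Finset (ℝ × ℝ)) (N : ℕ) : V → ℤ :=
  fun v => if v ∈ latGrid Ω N then 3 + ∑ p ∈ P, (if v = flr N p then 1 else 0) else 0

/-- The scaled deviation set `C_N = (1/N)·{v ∈ Γ_N : ψ v < 3}` of a state `ψ` on `Γ_N`. -/
def devSet (Ω : Set (ℝ × ℝ)) (N : ℕ) (ψ : V → ℤ) : Set (ℝ × ℝ) :=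
  {x | ∃ v ∈ latGrid Ω N, ψ v < 3 ∧ x = ((v.1 : ℝ) / N, (v.2 : ℝ) / N)}

/-- `l ∈ ℤ²` is the primitive integer vector of the direction `d ∈ ℝ²`:
its coordinates are coprime and `d` is a positive multiple of `l`. -/
def PrimOut (d : ℝ × ℝ) (l : ℤ × ℤ) : Prop :=
  Int.gcd l.1 l.2 = 1 ∧ ∃ t : ℝ, 0 < t ∧ d = t • toR l

/-- `d ∈ ℝ²` has rational slope (it is a positive multiple of an integer vector). -/
def RatDir (d : ℝ × ℝ) : Prop := ∃ l, PrimOut d l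

open Classical in
/-- The primitive integer vector of a direction `d` with rational slope
(junk value `0` otherwise). -/
noncomputable def prim (d : ℝ × ℝ) : ℤ × ℤ :=
  if h : ∃ l, PrimOut d l then h.choose else 0

/-- An edge (straight closed segment) recorded by its two endpoints. -/
abbrev Seg : Type := (ℝ × ℝ) × (ℝ × ℝ)

/-- The closed segment of an edge. -/
def seg (e : Seg) : Set (ℝ × ℝ) := segment ℝ e.1 e.2

/-! ## The deviation densities and their weak-* limit -/

open Classical in
/-- The rescaled deviation density `φ'_N(x) = N(3 - ψ([Nx]))` for `[Nx] ∈ Γ_N`, else `0`. -/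
noncomputable def devDens (Ω : Set (ℝ × ℝ)) (N : ℕ) (ψ : V → ℤ) : ℝ × ℝ → ℝ :=
  fun x => if flr N x ∈ latGrid Ω N then (N : ℝ) * (3 - (ψ (flr N x) : ℝ)) else 0

/-- The Euclidean norm on `ℝ²`. -/
noncomputable def enorm2 (v : ℝ × ℝ) : ℝ := Real.sqrt (v.1 ^ 2 + v.2 ^ 2)

/-- The integral `∫_e ψ dH¹` of `ψ` over the segment `e` with respect to arclength. -/
noncomputable def segInt (e : Seg) (ψ : ℝ × ℝ → ℝ) : ℝ :=
  enorm2 (e.2 - e.1) * ∫ t in (0:ℝ)..1, ψ (e.1 + t • (e.2 - e.1))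

/-- A test function: smooth and supported in the interior of `Ω`. -/
def TestFun (Ω : Set (ℝ × ℝ)) (ψ : ℝ × ℝ → ℝ) : Prop :=
  ContDiff ℝ (⊤ : ℕ∞) ψ ∧ tsupport ψ ⊆ interior Ω

/-- The pairing `∑_{e ∈ E} ‖l_e‖ · m_e · ∫_e ψ dH¹` of a weighted graph with a test
function. -/
noncomputable def tropPairing (E : Finset Seg) (m : Seg → ℕ) (ψ : ℝ × ℝ → ℝ) : ℝ :=
  ∑ e ∈ E, enorm2 (toR (prim (e.2 - e.1))) * (m e : ℝ) * segInt e ψ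

/-- The deviation densities of the states `φ N` converge weakly-* to the weighted graph
`(E, m)`:  `lim_N ∫ φ'_N ψ = ∑_{e ∈ E} ‖l_e‖ m_e ∫_e ψ` for all test functions `ψ`. -/
def WeakLimit (Ω : Set (ℝ × ℝ)) (φ : ℕ → V → ℤ) (E : Finset Seg) (m : Seg → ℕ) : Prop :=
  ∀ ψ : ℝ × ℝ → ℝ, TestFun Ω ψ →
    Filter.Tendsto (fun N => ∫ x : ℝ × ℝ, devDens Ω N (φ N) x * ψ x)
      Filter.atTop (nhds (tropPairing E m ψ))

/-! ## Ω-tropical curves -/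

/-- A valid edge set: no degenerate edges and each edge recorded in one orientation only. -/
def EdgeSet (E : Finset Seg) : Prop := ∀ e ∈ E, e.1 ≠ e.2 ∧ (e.2, e.1) ∉ E

/-- Edges meet only at common endpoints. -/
def Planar (E : Finset Seg) : Prop :=
  ∀ e ∈ E, ∀ e' ∈ E, e ≠ e' →
    seg e ∩ seg e' ⊆ ({e.1, e.2} : Set (ℝ × ℝ)) ∩ {e'.1, e'.2}

/-- The support of the graph: the union of its closed edges. -/
def gsupp (E : Finset Seg) : Set (ℝ × ℝ) := ⋃ e ∈ E, seg e

/-- `v` is a vertex of the graph `E`. -/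
def IsVert (E : Finset Seg) (v : ℝ × ℝ) : Prop := ∃ e ∈ E, e.1 = v ∨ e.2 = v

/-- The primitive integer vector of the edge `e`, oriented out of its endpoint `v`. -/
noncomputable def outDir (v : ℝ × ℝ) (e : Seg) : ℤ × ℤ :=
  if e.1 = v then prim (e.2 - e.1) else prim (e.1 - e.2)

open Classical in
/-- The balancing sum `∑_{e ∈ E_v} m_e l_e` at `v`, over edges incident to `v`, with
`l_e` oriented out of `v`. -/
noncomputable def balSum (E : Finset Seg) (m : Seg → ℕ) (v : ℝ × ℝ) : ℤ × ℤ :=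
  ∑ e ∈ E.filter (fun e => e.1 = v ∨ e.2 = v), (m e : ℤ) • outDir v e

/-- The segment `[a, b]` is a side of the polygon `Ω`: its endpoints are distinct
vertices (extreme points) of `Ω` and it lies in the boundary of `Ω`. -/
def IsSide (Ω : Set (ℝ × ℝ)) (a b : ℝ × ℝ) : Prop :=
  a ≠ b ∧ a ∈ Set.extremePoints ℝ Ω ∧ b ∈ Set.extremePoints ℝ Ω ∧
    segment ℝ a b ⊆ frontier Ω

/-- A labeling of the sides of `Ω` by positive integers (independent of orientation). -/
def SideLabel (Ω : Set (ℝ × ℝ)) (d : Seg → ℤ) : Prop :=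
  ∀ a b : ℝ × ℝ, IsSide Ω a b → 0 < d (a, b) ∧ d (a, b) = d (b, a)

/-- The outer balancing equations: at every vertex `v` of `Ω` with incident sides
`s₁ = [v,a]`, `s₂ = [v,b]`, one has `∑_{e ∈ E_v} m_e l_e = d_{s₁} l_{s₁} + d_{s₂} l_{s₂}`. -/
def OuterBalEq (Ω : Set (ℝ × ℝ)) (E : Finset Seg) (m : Seg → ℕ) (d : Seg → ℤ) : Prop :=
  ∀ v ∈ Set.extremePoints ℝ Ω, ∀ a b : ℝ × ℝ, a ≠ b →
    IsSide Ω v a → IsSide Ω v b →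
      balSum E m v = d (v, a) • prim (a - v) + d (v, b) • prim (b - v)

/-- `(E, m)` is an `Ω`-tropical curve: a finite weighted planar graph contained in `Ω`
whose edges have rational slopes and positive integer weights, meeting `∂Ω` exactly in
the vertices of `Ω`, balanced at every vertex interior to `Ω`, and satisfying the outer
balancing condition at the vertices of `Ω` for a unique positive labeling of the sides. -/
def OmegaTropCurve (Ω : Set (ℝ × ℝ)) (E : Finset Seg) (m : Seg → ℕ) : Prop :=
  EdgeSet E ∧ Planar E ∧ (∀ e ∈ E, 0 < m e) ∧ (∀ e ∈ E, RatDir (e.2 - e.1)) ∧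
  gsupp E ⊆ Ω ∧
  gsupp E ∩ frontier Ω = Set.extremePoints ℝ Ω ∧
  (∀ v : ℝ × ℝ, IsVert E v → v ∈ interior Ω → balSum E m v = 0) ∧
  ∃ d : Seg → ℤ, SideLabel Ω d ∧ OuterBalEq Ω E m d ∧
    ∀ d' : Seg → ℤ, SideLabel Ω d' → OuterBalEq Ω E m d' →
      ∀ a b : ℝ × ℝ, IsSide Ω a b → d' (a, b) = d (a, b)

/-! ## Plane tropical curves -/

/-- Combinatorial data of a plane tropical curve: finitely many bounded edges (segments)
and unbounded edges (rays, given by a base point and a primitive integer direction),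
with positive integer weights. -/
structure PlaneTropData where
  segs : Finset Seg
  rays : Finset ((ℝ × ℝ) × (ℤ × ℤ))
  msegs : Seg → ℕ
  mrays : (ℝ × ℝ) × (ℤ × ℤ) → ℕ

/-- The closed ray from `r.1` in the direction `r.2`. -/
def raySet (r : (ℝ × ℝ) × (ℤ × ℤ)) : Set (ℝ × ℝ) :=
  {x | ∃ t : ℝ, 0 ≤ t ∧ x = r.1 + t • toR r.2}

/-- The support of a plane tropical curve. -/
def ptcSupp (C : PlaneTropData) : Set (ℝ × ℝ) :=
  (⋃ e ∈ C.segs, seg e) ∪ ⋃ r ∈ C.rays, raySet r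

/-- `v` is a vertex of the plane tropical curve. -/
def ptcVert (C : PlaneTropData) (v : ℝ × ℝ) : Prop :=
  (∃ e ∈ C.segs, e.1 = v ∨ e.2 = v) ∨ ∃ r ∈ C.rays, r.1 = v

open Classical in
/-- The balancing sum at `v`: incident bounded edges and rays emanating from `v`,
with multiplicities, all oriented out of `v`. -/
noncomputable def ptcBalSum (C : PlaneTropData) (v : ℝ × ℝ) : ℤ × ℤ :=
  balSum C.segs C.msegs v +
    ∑ r ∈ C.rays.filter (fun r => r.1 = v), (C.mrays r : ℤ) • r.2

/-- `C` is a plane tropical curve: a planar graph in `ℝ²` with finitely many edges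
(possibly unbounded) of rational slope and positive integer weight, satisfying the
balancing condition at every vertex. -/
def IsPlaneTropCurve (C : PlaneTropData) : Prop :=
  EdgeSet C.segs ∧
  (∀ e ∈ C.segs, 0 < C.msegs e ∧ RatDir (e.2 - e.1)) ∧
  (∀ r ∈ C.rays, 0 < C.mrays r ∧ Int.gcd r.2.1 r.2.2 = 1) ∧
  (∀ e ∈ C.segs, ∀ e' ∈ C.segs, e ≠ e' →
    seg e ∩ seg e' ⊆ ({e.1, e.2} : Set (ℝ × ℝ)) ∩ {e'.1, e'.2}) ∧
  (∀ e ∈ C.segs, ∀ r ∈ C.rays,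
    seg e ∩ raySet r ⊆ ({e.1, e.2} : Set (ℝ × ℝ)) ∩ {r.1}) ∧
  (∀ r ∈ C.rays, ∀ r' ∈ C.rays, r ≠ r' →
    raySet r ∩ raySet r' ⊆ ({r.1} : Set (ℝ × ℝ)) ∩ {r'.1}) ∧
  ∀ v : ℝ × ℝ, ptcVert C v → ptcBalSum C v = 0

/-- The plane tropical curve `C'` extends the `Ω`-tropical curve `(E, m)`, i.e.
`C = C' ∩ Ω` as weighted graphs: the support of `C'` meets `Ω` exactly in the support
of `E`, and every edge of `E` lies in an edge of `C'` of the same weight. -/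
def ExtendsCurve (Ω : Set (ℝ × ℝ)) (E : Finset Seg) (m : Seg → ℕ)
    (C : PlaneTropData) : Prop :=
  IsPlaneTropCurve C ∧ ptcSupp C ∩ Ω = gsupp E ∧
  ∀ e ∈ E, (∃ e' ∈ C.segs, seg e ⊆ seg e' ∧ C.msegs e' = m e) ∨
    (∃ r ∈ C.rays, seg e ⊆ raySet r ∧ C.mrays r = m e)

/-! ## Tropical polynomials and corner loci -/

/-- A tropical polynomial: `F(x) = min_{(k,l) ∈ A} (k x₁ + l x₂ + a_{k,l})` for a finite
nonempty `A ⊆ ℤ²` and reals `a_{k,l}`. -/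
def IsTropPoly (F : ℝ × ℝ → ℝ) : Prop :=
  ∃ (A : Finset (ℤ × ℤ)) (hA : A.Nonempty) (a : ℤ × ℤ → ℝ),
    ∀ x : ℝ × ℝ,
      F x = A.inf' hA fun kl => (kl.1 : ℝ) * x.1 + (kl.2 : ℝ) * x.2 + a kl

/-- `F` is affine in a neighbourhood of `x`. -/
def LocallyAffine (F : ℝ × ℝ → ℝ) (x : ℝ × ℝ) : Prop :=
  ∃ U ∈ nhds x, ∃ c₁ c₂ c₀ : ℝ, ∀ y ∈ U, F y = c₁ * y.1 + c₂ * y.2 + c₀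

/-- The corner locus of `F`: the points where `F` is not locally affine. -/
def cornerLocus (F : ℝ × ℝ → ℝ) : Set (ℝ × ℝ) := {x | ¬ LocallyAffine F x}

/-- Near the point `x`, lying in the relative interior of an edge with primitive
direction `l`, the function `F` is the minimum of two affine functions whose gradients
differ by `m` times the rotated vector `l^⊥ = (-l₂, l₁)`; this characterizes the
canonical weight `m` of the corner locus of `F` along this edge. -/
def EdgeWeightIs (F : ℝ × ℝ → ℝ) (x : ℝ × ℝ) (l : ℤ × ℤ) (m : ℕ) : Prop :=
  ∃ U ∈ nhds x, ∃ g₁ g₂ : ℝ × ℝ, ∃ c₁ c₂ : ℝ,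
    g₁ - g₂ = (m : ℝ) • toR (-l.2, l.1) ∧
    ∀ y ∈ U, F y = min (g₁.1 * y.1 + g₁.2 * y.2 + c₁) (g₂.1 * y.1 + g₂.2 * y.2 + c₂)

/-- The corner locus of `F`, with its canonical weights, is the plane tropical
curve `C`. -/
def RepresentsCornerLocus (F : ℝ × ℝ → ℝ) (C : PlaneTropData) : Prop :=
  ptcSupp C = cornerLocus F ∧
  (∀ e ∈ C.segs, ∀ x ∈ seg e, x ≠ e.1 → x ≠ e.2 →
    EdgeWeightIs F x (prim (e.2 - e.1)) (C.msegs e)) ∧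
  (∀ r ∈ C.rays, ∀ x ∈ raySet r, x ≠ r.1 →
    EdgeWeightIs F x r.2 (C.mrays r))

/-- `F` is the `Ω`-tropical polynomial of the `Ω`-tropical curve `(E, m)`: the
restriction to `Ω` of a tropical polynomial vanishing on `∂Ω` whose corner locus is a
plane tropical curve extending `(E, m)`.  (Values of `F` outside `Ω` are irrelevant.) -/
def IsOmegaPolyOf (Ω : Set (ℝ × ℝ)) (E : Finset Seg) (m : Seg → ℕ)
    (F : ℝ × ℝ → ℝ) : Prop :=
  ∃ (F' : ℝ × ℝ → ℝ) (C : PlaneTropData),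
    ExtendsCurve Ω E m C ∧ IsTropPoly F' ∧ (∀ x ∈ frontier Ω, F' x = 0) ∧
    RepresentsCornerLocus F' C ∧ ∀ x ∈ Ω, F x = F' x

theorem mem_nbrs_comm (v w : V) : w ∈ nbrs v ↔ v ∈ nbrs w := by
  obtain ⟨a, b⟩ := v
  obtain ⟨c, d⟩ := w
  simp only [nbrs, Finset.mem_insert, Finset.mem_singleton, Prod.mk.injEq]
  omega

theorem sum_nbrs {M : Type*} [AddCommMonoid M] (g : V → M) (v : V) :
    ∑ w ∈ nbrs v, g w = g (v.1 + 1, v.2) + (g (v.1 - 1, v.2) +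
      (g (v.1, v.2 + 1) + g (v.1, v.2 - 1))) := by
  unfold nbrs
  rw [Finset.sum_insert, Finset.sum_insert, Finset.sum_insert, Finset.sum_singleton]
  all_goals
    simp only [Finset.mem_insert, Finset.mem_singleton, Prod.mk.injEq]
    omega

theorem lap_eq (H : V → ℤ) (v : V) : lap H v = -4 * H v + (H (v.1 + 1, v.2) + (H (v.1 - 1, v.2) +
      (H (v.1, v.2 + 1) + H (v.1, v.2 - 1)))) := by
  unfold lap
  rw [sum_nbrs]

open Classical in
theorem lap_single (v w : V) : lap (fun x => if x = v then 1 else 0) w =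
    - (if w = v then 4 else 0) + (if w ∈ nbrs v then 1 else 0) := by
  unfold lap
  rw [Finset.sum_ite_eq']
  simp only [mem_nbrs_comm w v]
  split_ifs <;> simp

theorem lap_add (f g : V → ℤ) (v : V) : lap (fun x => f x + g x) v = lap f v + lap g v := by
  simp only [lap_eq]; ring

/-- abelian property: toppling counts of a relaxation are the least odometer -/
theorem relax_odometer {Γ : Set V} {φ ψ : V → ℤ} (h : Relaxes Γ φ ψ) :
    ∃ u : V → ℤ, Odometer Γ φ u ∧ (∀ v ∈ Γ, ψ v = φ v + lap u v) ∧
      ∀ H, Odometer Γ φ H → ∀ v, u v ≤ H v := by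
  classical
  obtain ⟨m, ρ, ⟨h0, hstep, hst⟩, rfl⟩ := h
  have key : ∀ i ≤ m, ∃ u : V → ℤ, (∀ v, 0 ≤ u v) ∧ (∀ v ∉ Γ, u v = 0) ∧
      (∀ v ∈ Γ, ρ i v = φ v + lap u v) ∧ ∀ H, Odometer Γ φ H → ∀ v, u v ≤ H v := by
    intro i
    induction i with
    | zero =>
      intro _
      refine ⟨fun _ => 0, fun _ => le_rfl, fun _ _ => rfl, fun v _ => ?_, fun H hH v => hH.1 v⟩
      simp [h0, lap]
    | succ i ih =>
      intro hi
      obtain ⟨u, hu0, hu1, hu2, hu3⟩ := ih (by omega)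
      obtain ⟨x, hxΓ, hx4, hx⟩ := hstep i (by omega)
      refine ⟨fun v => u v + (if v = x then 1 else 0), fun v => ?_, fun v hv => ?_, fun v hv => ?_,
        fun H hH v => ?_⟩
      · have := hu0 v
        show 0 ≤ u v + (if v = x then 1 else 0)
        split_ifs <;> omega
      · show u v + (if v = x then 1 else 0) = 0
        rw [hu1 v hv, if_neg]
        · rfl
        · rintro rfl; exact hv hxΓ
      · rw [lap_add, lap_single, hx, toppleAt, hu2 v hv]
        simp only [hv, and_true]
        ring
      · by_cases hvx : v = x
        · subst hvx
          simp only [if_true]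
          by_contra hcon
          have h1 := hu3 H hH v
          have heq : u v = H v := by omega
          have h2 := hH.2.2 v hxΓ
          rw [hu2 v hxΓ] at hx4
          have h3 : lap u v ≤ lap H v := by
            unfold lap
            rw [heq]
            have := Finset.sum_le_sum (fun w (_ : w ∈ nbrs v) => hu3 H hH w)
            linarith
          omega
        · simp only [if_neg hvx, add_zero]
          exact hu3 H hH v
  obtain ⟨u, hu0, hu1, hu2, hu3⟩ := key m le_rfl
  exact ⟨u, ⟨hu0, hu1, fun v hv => by rw [← hu2 v hv]; exact hst v hv⟩, hu2, hu3⟩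

open Classical in
/-- number of `p ∈ P` with `[Np] = v`. -/
noncomputable def cnt (P : Finset (ℝ × ℝ)) (N : ℕ) (v : V) : ℤ :=
  ∑ p ∈ P, (if v = flr N p then 1 else 0)

/-- all that we use about the odometer -/
structure Odo (Ω : Set (ℝ × ℝ)) (P : Finset (ℝ × ℝ)) (N : ℕ) (f : V → ℤ) : Prop where
  nonneg : ∀ v, 0 ≤ f v
  zero : ∀ v ∉ latGrid Ω N, f v = 0
  lap_le : ∀ v ∈ latGrid Ω N, lap f v ≤ - cnt P N v
  least : ∀ H, (∀ v, 0 ≤ H v) → (∀ v ∉ latGrid Ω N, H v = 0) →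
    (∀ v ∈ latGrid Ω N, lap H v ≤ - cnt P N v) → ∀ v, f v ≤ H v

theorem odometer_iff {Ω : Set (ℝ × ℝ)} {P : Finset (ℝ × ℝ)} {N : ℕ} {H : V → ℤ} :
    Odometer (latGrid Ω N) (stateN Ω P N) H ↔ (∀ v, 0 ≤ H v) ∧ (∀ v ∉ latGrid Ω N, H v = 0) ∧
    (∀ v ∈ latGrid Ω N, lap H v ≤ - cnt P N v) := by
  unfold Odometer
  refine and_congr Iff.rfl (and_congr Iff.rfl (forall₂_congr fun v hv => ?_))
  simp only [stateN, hv, if_true, cnt]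
  constructor <;> intro h <;> linarith

theorem odo_of {Ω : Set (ℝ × ℝ)} {P : Finset (ℝ × ℝ)} {N : ℕ} {φ f : V → ℤ}
    (hφ : Relaxes (latGrid Ω N) (stateN Ω P N) φ)
    (hf : ∀ (v : V),
      IsLeast {n : ℤ | ∃ H : V → ℤ, Odometer (latGrid Ω N) (stateN Ω P N) H ∧ H v = n} (f v)) :
    Odo Ω P N f ∧ ∀ v ∈ latGrid Ω N, φ v = 3 + cnt P N v + lap f v := by
  obtain ⟨u, hu1, hu2, hu3⟩ := relax_odometer hφ
  have : f = u := by
    funext v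
    apply le_antisymm
    · exact (hf v).2 ⟨u, hu1, rfl⟩
    · obtain ⟨H, hH, hHv⟩ := (hf v).1
      rw [← hHv]; exact hu3 H hH v
  subst this
  have h1 := odometer_iff.1 hu1
  refine ⟨⟨h1.1, h1.2.1, h1.2.2, fun H a b c => hu3 H (odometer_iff.2 ⟨a, b, c⟩)⟩, fun v hv => ?_⟩
  rw [hu2 v hv]
  simp only [stateN, hv, if_true, cnt]

theorem cnt_nonneg (P : Finset (ℝ × ℝ)) (N : ℕ) (v : V) : 0 ≤ cnt P N v :=
  Finset.sum_nonneg fun _ _ => by split_ifs <;> norm_num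

theorem lap_mono {f g : V → ℤ} {v : V} (h0 : f v = g v) (h : ∀ w ∈ nbrs v, f w ≤ g w) :
    lap f v ≤ lap g v := by
  unfold lap
  rw [h0]
  have := Finset.sum_le_sum h
  linarith

/-- comparison principle -/
theorem Odo.comparison {Ω : Set (ℝ × ℝ)} {P : Finset (ℝ × ℝ)} {N : ℕ} {f : V → ℤ}
    (hf : Odo Ω P N f) (A : Set V) (hA : A ⊆ latGrid Ω N) (G : V → ℤ) (hG0 : ∀ v ∈ A, 0 ≤ G v)
    (hG1 : ∀ v ∈ A, lap G v ≤ - cnt P N v)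
    (hG2 : ∀ v ∈ A, ∀ w ∈ nbrs v, w ∉ A → f w ≤ G w) : ∀ v ∈ A, f v ≤ G v := by
  classical
  set H : V → ℤ := fun v => if v ∈ A then min (f v) (G v) else f v with hH
  have hHf : ∀ v, H v ≤ f v := by
    intro v; simp only [hH]; split_ifs
    · exact min_le_left _ _
    · exact le_rfl
  have key := hf.least H (fun v => by
      simp only [hH]; split_ifs with h
      · exact le_min (hf.nonneg v) (hG0 v h)
      · exact hf.nonneg v) (fun v hv => by
      simp only [hH]; rw [if_neg (fun h => hv (hA h))]; exact hf.zero v hv) (fun v hv => by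
      by_cases hc : H v = f v
      · exact (lap_mono hc (fun w _ => hHf w)).trans (hf.lap_le v hv)
      · have hvA : v ∈ A := by
          by_contra h; apply hc; simp only [hH, if_neg h]
        have hvG : H v = G v := by
          simp only [hH, if_pos hvA] at hc ⊢
          rcases min_choice (f v) (G v) with h | h
          · exact absurd h hc
          · exact h
        refine (lap_mono hvG fun w hw => ?_).trans (hG1 v hvA)
        by_cases hwA : w ∈ A
        · simp only [hH, if_pos hwA]; exact min_le_right _ _
        · simp only [hH, if_neg hwA]; exact hG2 v hvA w hw hwA)
  intro v hv
  have := key v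
  simp only [hH, if_pos hv] at this
  exact this.trans (min_le_right _ _)

/-- shift lemma -/
theorem Odo.shift {Ω : Set (ℝ × ℝ)} {P : Finset (ℝ × ℝ)} {N : ℕ} {f : V → ℤ}
    (hf : Odo Ω P N f) (e : V) (K : ℤ) (hK0 : 0 ≤ K)
    (hKP : ∀ p ∈ P, f (flr N p) ≤ f (flr N p + e) + K)
    (hKb : ∀ v ∈ latGrid Ω N, v + e ∉ latGrid Ω N → f v ≤ K) (v : V) : f v ≤ f (v + e) + K := by
  by_contra hv
  push Not at hv
  set A : Set V := {v | f (v + e) + K < f v} with hA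
  have hAΓ : A ⊆ latGrid Ω N := by
    intro w hw
    by_contra hc
    have h1 := hf.zero w hc
    have h2 := hf.nonneg (w + e)
    simp only [hA, Set.mem_ofPred_eq] at hw
    omega
  have := hf.comparison A hAΓ (fun w => f (w + e) + K)
    (fun w _ => by have := hf.nonneg (w + e); show 0 ≤ f (w + e) + K; omega) (fun w hw => by
      have hw' : f (w + e) + K < f w := hw
      have hwe : w + e ∈ latGrid Ω N := by
        by_contra hc
        have h1 := hKb w (hAΓ hw) hc
        have h2 := hf.nonneg (w + e)
        omega
      have hc0 : cnt P N w = 0 := by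
        unfold cnt
        refine Finset.sum_eq_zero fun p hp => ?_
        rw [if_neg]
        rintro rfl
        have := hKP p hp
        omega
      rw [hc0]
      have h1 := hf.lap_le _ hwe
      have h2 := cnt_nonneg P N (w + e)
      have h3 : lap (fun w => f (w + e) + K) w = lap f (w + e) := by
        obtain ⟨a, b⟩ := w
        obtain ⟨c, d⟩ := e
        simp only [lap_eq, Prod.mk_add_mk]
        rw [show a + 1 + c = a + c + 1 by ring, show a - 1 + c = a + c - 1 by ring,
          show b + 1 + d = b + d + 1 by ring, show b - 1 + d = b + d - 1 by ring]
        ring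
      rw [h3]; omega) (fun w _ w' _ hw' => by
      simp only [hA, Set.mem_ofPred_eq, not_lt] at hw'
      exact hw') v hv
  omega

/-- rescaled lattice point -/
noncomputable def sc (N : ℕ) (v : V) : ℝ × ℝ := ((v.1 : ℝ) / N, (v.2 : ℝ) / N)

theorem mem_latGrid {Ω : Set (ℝ × ℝ)} {N : ℕ} (hN : 1 ≤ N) (v : V) :
    v ∈ latGrid Ω N ↔ sc N v ∈ Ω := by
  have hN' : (N : ℝ) ≠ 0 := by positivity
  show toR v ∈ (N : ℝ) • Ω ↔ _
  rw [Set.mem_smul_set_iff_inv_smul_mem₀ hN']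
  have : (N : ℝ)⁻¹ • toR v = sc N v := by
    simp [toR, sc, div_eq_inv_mul]
  rw [this]

theorem dist_prod_le {x y : ℝ × ℝ} {r : ℝ} :
    dist x y ≤ r ↔ |x.1 - y.1| ≤ r ∧ |x.2 - y.2| ≤ r := by
  rw [Prod.dist_eq, max_le_iff, Real.dist_eq, Real.dist_eq]

theorem dist_prod_lt {x y : ℝ × ℝ} {r : ℝ} :
    dist x y < r ↔ |x.1 - y.1| < r ∧ |x.2 - y.2| < r := by
  rw [Prod.dist_eq, max_lt_iff, Real.dist_eq, Real.dist_eq]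

theorem dist_sc_flr {N : ℕ} (hN : 1 ≤ N) (x : ℝ × ℝ) : dist (sc N (flr N x)) x ≤ 1 / N := by
  have hN' : (0 : ℝ) < N := by positivity
  have aux : ∀ t : ℝ, |(⌊(N : ℝ) * t⌋ : ℝ) / N - t| ≤ 1 / N := by
    intro t
    have h1 := Int.floor_le ((N : ℝ) * t)
    have h2 := Int.lt_floor_add_one ((N : ℝ) * t)
    rw [show (⌊(N : ℝ) * t⌋ : ℝ) / N - t = ((⌊(N : ℝ) * t⌋ : ℝ) - N * t) / N by field_simp,
      abs_div, abs_of_pos hN']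
    gcongr
    rw [abs_le]; constructor <;> linarith
  rw [dist_prod_le]
  exact ⟨aux _, aux _⟩

theorem flr_abs (N : ℕ) (x : ℝ × ℝ) : |((flr N x).1 : ℝ) - N * x.1| ≤ 1 ∧
    |((flr N x).2 : ℝ) - N * x.2| ≤ 1 := by
  constructor <;> simp only [flr] <;> rw [abs_le] <;> constructor <;>
  linarith [Int.floor_le ((N : ℝ) * x.1), Int.lt_floor_add_one ((N : ℝ) * x.1),
    Int.floor_le ((N : ℝ) * x.2), Int.lt_floor_add_one ((N : ℝ) * x.2)]

theorem lap_sum {ι : Type*} (s : Finset ι) (g : ι → V → ℤ) (v : V) :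
    lap (fun w => ∑ i ∈ s, g i w) v = ∑ i ∈ s, lap (g i) v := by
  simp only [lap_eq, Finset.sum_add_distrib, Finset.mul_sum]

theorem lap_lin (a k l b : ℤ) (v : V) : lap (fun w => a * (k * w.1 + l * w.2 + b)) v = 0 := by
  simp only [lap_eq]; ring

theorem lap_corner (R q : ℤ) (v : V) : lap (fun w => R - max 0 (w.1 - q)) v =
    - (if v.1 = q then 1 else 0) := by
  simp only [lap_eq]
  split_ifs <;> omega

theorem lap_min_left {a b : V → ℤ} {v : V} (h : a v ≤ b v) :
    lap (fun w => min (a w) (b w)) v ≤ lap a v :=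
  lap_mono (min_eq_left h) fun _ _ => min_le_left _ _

theorem lap_min_right {a b : V → ℤ} {v : V} (h : b v ≤ a v) :
    lap (fun w => min (a w) (b w)) v ≤ lap b v :=
  lap_mono (min_eq_right h) fun _ _ => min_le_right _ _

theorem nbr_abs {v w : V} (h : w ∈ nbrs v) : |w.1 - v.1| ≤ 1 ∧ |w.2 - v.2| ≤ 1 := by
  simp only [nbrs, Finset.mem_insert, Finset.mem_singleton] at h
  rcases h with rfl | rfl | rfl | rfl <;> simp

theorem upper_bound {Ω : Set (ℝ × ℝ)} {P : Finset (ℝ × ℝ)} (hb : Bornology.IsBounded Ω)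
    (hPΩ : ↑P ⊆ Ω) (k l : ℤ) (c : ℝ) (h0 : ∀ y ∈ Ω, 0 ≤ k * y.1 + l * y.2 + c)
    (hp : ∀ p ∈ P, 0 < k * p.1 + l * p.2 + c) :
    ∃ C : ℝ, 0 ≤ C ∧ ∀ N : ℕ, 1 ≤ N → ∀ f, Odo Ω P N f → ∀ v ∈ latGrid Ω N,
      (f v : ℝ) ≤ C * (k * v.1 + l * v.2 + N * c + 1) := by
  obtain ⟨D0, hD0⟩ := hb.exists_norm_le
  obtain ⟨D, hD⟩ := exists_nat_ge D0
  have hΩD : ∀ y ∈ Ω, |y.1| ≤ D ∧ |y.2| ≤ D := by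
    intro y hy
    have := (hD0 y hy).trans hD
    rw [Prod.norm_def, max_le_iff] at this
    exact this
  obtain ⟨M, hM⟩ : ∃ M : ℕ, ∀ p ∈ P, (2 * D + 3 : ℝ) ≤ M * (k * p.1 + l * p.2 + c) := by
    have : ∀ p ∈ P, ∀ᶠ M : ℕ in atTop, (2 * D + 3 : ℝ) ≤ M * (k * p.1 + l * p.2 + c) := by
      intro p hpP
      have := (tendsto_natCast_atTop_atTop (R := ℝ)).atTop_mul_const (hp p hpP)
      exact this.eventually_ge_atTop _
    exact ((Filter.eventually_all_finset P).2 this).exists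
  set K : ℤ := |k| + |l| with hK
  refine ⟨P.card * M * (K + 2), by positivity, ?_⟩
  intro N hN f hf
  have hN' : (1 : ℝ) ≤ N := by exact_mod_cast hN
  have hN0 : (0 : ℝ) < N := by linarith
  set R : ℤ := 2 * D * N + 3 with hR
  set b : ℤ := ⌈(N : ℝ) * c⌉ + K with hbdef
  have hb1 : (N : ℝ) * c + K ≤ b := by
    rw [hbdef]; push_cast; linarith [Int.le_ceil ((N : ℝ) * c)]
  have hb2 : (b : ℝ) ≤ N * c + 1 + K := by
    rw [hbdef]; push_cast; linarith [Int.ceil_lt_add_one ((N : ℝ) * c)]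
  set g : ℝ × ℝ → V → ℤ := fun p v => min (R - max 0 (v.1 - (flr N p).1))
    (M * (k * v.1 + l * v.2 + b)) with hg
  -- facts about points of the grid
  have hgrid : ∀ v ∈ latGrid Ω N, |v.1| ≤ D * N ∧ 0 ≤ (k * v.1 + l * v.2 + N * c : ℝ) := by
    intro v hv
    rw [mem_latGrid hN] at hv
    have h1 := (hΩD _ hv).1
    have h2 := h0 _ hv
    simp only [sc] at h1 h2
    constructor
    · rw [abs_div, abs_of_pos hN0, div_le_iff₀ hN0] at h1
      exact_mod_cast h1
    · have : (k * v.1 + l * v.2 + N * c : ℝ) = N * (k * (v.1 / N) + l * (v.2 / N) + c) := by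
        field_simp
      rw [this]; positivity
  have hKk : ∀ a b' : ℝ, |a| ≤ 1 → |b'| ≤ 1 → |k * a + l * b'| ≤ (K : ℝ) := by
    intro a b' ha hb'
    rw [hK]; push_cast
    calc |k * a + l * b'| ≤ |(k : ℝ) * a| + |(l : ℝ) * b'| := abs_add_le _ _
      _ ≤ |(k : ℝ)| * 1 + |(l : ℝ)| * 1 := by rw [abs_mul, abs_mul]; gcongr
      _ = _ := by ring
  have hflr : ∀ p ∈ P, -(D * N : ℤ) - 1 ≤ (flr N p).1 := by
    intro p hpP
    have h1 := (hΩD p (hPΩ hpP)).1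
    have h2 := (flr_abs N p).1
    rw [abs_le] at h1 h2
    have : -((D : ℝ) * N) - 1 ≤ ((flr N p).1 : ℝ) := by nlinarith
    exact_mod_cast this
  have hnn : ∀ p ∈ P, ∀ v ∈ latGrid Ω N, ∀ w : V, |w.1 - v.1| ≤ 1 → |w.2 - v.2| ≤ 1 →
      0 ≤ g p w := by
    intro p hpP v hv w h1 h2
    have h3 := hgrid v hv
    have h4 := hflr p hpP
    refine le_min ?_ ?_
    · rw [abs_le] at h1
      have := (abs_le.1 h3.1).2
      rw [hR, sub_nonneg]
      refine max_le (by positivity) ?_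
      nlinarith
    · have h5 := hKk ((w.1 - v.1 : ℤ) : ℝ) ((w.2 - v.2 : ℤ) : ℝ) (by exact_mod_cast h1)
        (by exact_mod_cast h2)
      push_cast at h5
      have : (0 : ℝ) ≤ k * w.1 + l * w.2 + b := by
        have := (abs_le.1 h5).1
        nlinarith
      have h6 : (0 : ℤ) ≤ k * w.1 + l * w.2 + b := by exact_mod_cast this
      positivity
  have key := hf.comparison (latGrid Ω N) le_rfl (fun v => ∑ p ∈ P, g p v)
    (fun v hv => Finset.sum_nonneg fun p hpP => hnn p hpP v hv v (by simp) (by simp))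
    (fun v hv => by
      rw [lap_sum, cnt, ← Finset.sum_neg_distrib]
      refine Finset.sum_le_sum fun p hpP => ?_
      split_ifs with hvp
      · refine (lap_min_left ?_).trans ?_
        · subst hvp
          have h1 := flr_abs N p
          have h2 := hKk _ _ h1.1 h1.2
          have h3 := hM p hpP
          have h4 := (abs_le.1 h2).1
          have h5 : (R : ℝ) ≤ M * (k * (flr N p).1 + l * (flr N p).2 + b) := by
            have : (N : ℝ) * (k * p.1 + l * p.2 + c) ≤
              (k * (flr N p).1 + l * (flr N p).2 + b) := by nlinarith
            calc (R : ℝ) = 2 * D * N + 3 := by rw [hR]; push_cast; ring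
              _ ≤ N * (2 * D + 3) := by nlinarith
              _ ≤ N * (M * (k * p.1 + l * p.2 + c)) := by gcongr
              _ = M * (N * (k * p.1 + l * p.2 + c)) := by ring
              _ ≤ _ := by gcongr
          have h6 : R ≤ M * (k * (flr N p).1 + l * (flr N p).2 + b) := by exact_mod_cast h5
          simp only [sub_self, max_self, sub_zero]
          exact h6
        · rw [lap_corner, if_pos (by rw [hvp])]
      · rw [neg_zero]
        rcases le_total (R - max 0 (v.1 - (flr N p).1)) (M * (k * v.1 + l * v.2 + b)) with h | h
        · refine (lap_min_left (a := fun v : V => R - max 0 (v.1 - (flr N p).1))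
            (b := fun v : V => (M : ℤ) * (k * v.1 + l * v.2 + b)) h).trans ?_
          rw [lap_corner]; split_ifs <;> norm_num
        · refine (lap_min_right (a := fun v : V => R - max 0 (v.1 - (flr N p).1))
            (b := fun v : V => (M : ℤ) * (k * v.1 + l * v.2 + b)) h).trans ?_
          rw [lap_lin])
    (fun v hv w hw hwn => by
      rw [hf.zero w hwn]
      have := nbr_abs hw
      exact Finset.sum_nonneg fun p hpP => hnn p hpP v hv w this.1 this.2)
  intro v hv
  have h1 := key v hv
  have h2 : ∑ p ∈ P, g p v ≤ ∑ p ∈ P, M * (k * v.1 + l * v.2 + b) :=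
    Finset.sum_le_sum fun p _ => min_le_right _ _
  rw [Finset.sum_const, nsmul_eq_mul] at h2
  have h3 : f v ≤ P.card * (M * (k * v.1 + l * v.2 + b)) := h1.trans h2
  have h4 : (f v : ℝ) ≤ P.card * (M * (k * v.1 + l * v.2 + b)) := by exact_mod_cast h3
  have h5 := (hgrid v hv).2
  have hK0 : (0 : ℝ) ≤ K := by rw [hK]; positivity
  calc (f v : ℝ) ≤ P.card * (M * (k * v.1 + l * v.2 + b)) := h4
    _ ≤ P.card * (M * ((K + 2) * (k * v.1 + l * v.2 + N * c + 1))) := by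
        gcongr
        nlinarith
    _ = _ := by ring

theorem IsLatticePolygon.convex {Ω : Set (ℝ × ℝ)} (h : IsLatticePolygon Ω) : Convex ℝ Ω := by
  obtain ⟨⟨S, rfl⟩, _⟩ := h
  exact convex_convexHull _ _

theorem IsLatticePolygon.isCompact {Ω : Set (ℝ × ℝ)} (h : IsLatticePolygon Ω) : IsCompact Ω := by
  obtain ⟨⟨S, rfl⟩, _⟩ := h
  exact Set.Finite.isCompact_convexHull (𝕜 := ℝ) ((Finset.finite_toSet S).image _)

theorem clm_prod (f : (ℝ × ℝ) →L[ℝ] ℝ) (y : ℝ × ℝ) : f y = f (1, 0) * y.1 + f (0, 1) * y.2 := by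
  conv_lhs => rw [show y = y.1 • ((1 : ℝ), (0 : ℝ)) + y.2 • ((0 : ℝ), (1 : ℝ)) by ext <;> simp]
  rw [map_add, map_smul, map_smul]
  simp [mul_comm]

theorem pos_interior {Ω : Set (ℝ × ℝ)} {k l c : ℝ} (hkl : k ≠ 0 ∨ l ≠ 0)
    (h : ∀ y ∈ Ω, 0 ≤ k * y.1 + l * y.2 + c) : ∀ y ∈ interior Ω, 0 < k * y.1 + l * y.2 + c := by
  intro y hy
  have hc : Continuous fun t : ℝ => (y.1 - t * k, y.2 - t * l) := by fun_prop
  have h1 : ∀ᶠ t in 𝓝 (0 : ℝ), (y.1 - t * k, y.2 - t * l) ∈ Ω := by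
    apply hc.continuousAt.eventually
    simpa using mem_interior_iff_mem_nhds.1 hy
  have h2 : ∀ᶠ t in 𝓝[>] (0 : ℝ), (y.1 - t * k, y.2 - t * l) ∈ Ω ∧ 0 < t :=
    (h1.filter_mono nhdsWithin_le_nhds).and self_mem_nhdsWithin
  obtain ⟨t, ht, ht0⟩ := h2.exists
  have h3 := h _ ht
  simp only at h3
  have h4 : 0 < k * k + l * l := by
    rcases hkl with h | h
    · have := mul_self_pos.2 h; nlinarith [mul_self_nonneg l]
    · have := mul_self_pos.2 h; nlinarith [mul_self_nonneg k]
  nlinarith [mul_pos ht0 h4]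

theorem support_int {Ω : Set (ℝ × ℝ)} (h : IsLatticePolygon Ω) {x₀ : ℝ × ℝ}
    (hx : x₀ ∈ frontier Ω) : ∃ (k l : ℤ) (c : ℝ), (∀ y ∈ Ω, 0 ≤ k * y.1 + l * y.2 + c) ∧
      k * x₀.1 + l * x₀.2 + c = 0 ∧ ∀ y ∈ interior Ω, 0 < k * y.1 + l * y.2 + c := by
  have hconv := h.convex
  have hcomp := h.isCompact
  obtain ⟨⟨S, hS⟩, ⟨y₀, hy₀⟩⟩ := h
  have hxΩ : x₀ ∈ Ω := hcomp.isClosed.frontier_subset hx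
  have hxi : x₀ ∉ interior Ω := fun hh => by
    rw [frontier] at hx; exact hx.2 hh
  obtain ⟨f, hf⟩ := geometric_hahn_banach_open_point hconv.interior isOpen_interior hxi
  have hfle : ∀ y ∈ Ω, f y ≤ f x₀ := by
    intro y hy
    have h1 : y ∈ closure (interior Ω) := by
      rw [hconv.closure_interior_eq_closure_of_nonempty_interior ⟨y₀, hy₀⟩]
      exact subset_closure hy
    have h2 : closure (interior Ω) ⊆ {y | f y ≤ f x₀} :=
      closure_minimal (fun z hz => (hf z hz).le) (isClosed_le f.continuous continuous_const)
    exact h2 h1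
  have hSΩ : ∀ s ∈ S, toR s ∈ Ω := fun s hs => by
    rw [hS]; exact subset_convexHull _ _ ⟨s, hs, rfl⟩
  set α := f (1, 0) with hα
  set β := f (0, 1) with hβ
  have hff : ∀ y, f y = α * y.1 + β * y.2 := clm_prod f
  have fin : ∀ (k l : ℤ), ((k : ℝ) ≠ 0 ∨ (l : ℝ) ≠ 0) →
      (∀ y ∈ Ω, 0 ≤ k * y.1 + l * y.2 + (-(k * x₀.1 + l * x₀.2))) →
      ∃ (k l : ℤ) (c : ℝ), (∀ y ∈ Ω, 0 ≤ k * y.1 + l * y.2 + c) ∧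
      k * x₀.1 + l * x₀.2 + c = 0 ∧ ∀ y ∈ interior Ω, 0 < k * y.1 + l * y.2 + c := by
    intro k l hkl h
    exact ⟨k, l, _, h, by ring, pos_interior hkl h⟩
  have hαβ : f y₀ < f x₀ := hf _ hy₀
  obtain ⟨s₀, hs₀, hs₀f⟩ : ∃ s ∈ S, f (toR s) = f x₀ := by
    by_contra hcon
    push Not at hcon
    have : Ω ⊆ {y | f y < f x₀} := by
      rw [hS]
      refine convexHull_min ?_ (convex_halfSpace_lt f.toLinearMap.isLinear _)
      rintro _ ⟨s, hs, rfl⟩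
      exact lt_of_le_of_ne (hfle _ (hSΩ s hs)) (hcon s hs)
    have h' : f x₀ < f x₀ := this hxΩ
    exact lt_irrefl _ h'
  by_cases hA : ∃ s ∈ S, s ≠ s₀ ∧ f (toR s) = f x₀
  · obtain ⟨s, hs, hne, hsf⟩ := hA
    set a : ℤ := s.1 - s₀.1 with ha
    set b : ℤ := s.2 - s₀.2 with hb
    have hab : α * a + β * b = 0 := by
      have := hsf.trans hs₀f.symm
      rw [hff, hff] at this
      simp only [toR] at this
      rw [ha, hb]; push_cast; linarith
    have hab0 : a ≠ 0 ∨ b ≠ 0 := by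
      by_contra hc
      push Not at hc
      apply hne
      ext <;> omega
    have hsq : (0 : ℝ) < a * a + b * b := by
      rcases hab0 with h | h
      · have h' : (a : ℝ) ≠ 0 := by exact_mod_cast h
        have := mul_self_pos.2 h'; nlinarith [mul_self_nonneg (b : ℝ)]
      · have h' : (b : ℝ) ≠ 0 := by exact_mod_cast h
        have := mul_self_pos.2 h'; nlinarith [mul_self_nonneg (a : ℝ)]
    set τ : ℝ := (-b * α + a * β) / (a * a + b * b) with hτ
    have hτm : τ * (a * a + b * b) = -b * α + a * β := div_mul_cancel₀ _ hsq.ne'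
    have h1 : α = τ * (-b) := by
      have : α * (a * a + b * b) = τ * (-b) * (a * a + b * b) := by
        have : τ * (-b) * (a * a + b * b) = -b * (-b * α + a * β) := by rw [← hτm]; ring
        rw [this]; linear_combination (a : ℝ) * hab
      exact mul_right_cancel₀ hsq.ne' this
    have h2 : β = τ * a := by
      have : β * (a * a + b * b) = τ * a * (a * a + b * b) := by
        have : τ * a * (a * a + b * b) = a * (-b * α + a * β) := by rw [← hτm]; ring
        rw [this]; linear_combination (b : ℝ) * hab
      exact mul_right_cancel₀ hsq.ne' this
    have hab0' : (a : ℝ) ≠ 0 ∨ (b : ℝ) ≠ 0 := by exact_mod_cast hab0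
    rcases lt_trichotomy τ 0 with ht | ht | ht
    · refine fin (-b) a (by rcases hab0' with h | h; exact Or.inr h; left; push_cast; exact neg_ne_zero.2 h) ?_
      intro y hy
      have := hfle y hy
      rw [hff, hff, h1, h2] at this
      push_cast
      by_contra hc
      push Not at hc
      nlinarith [mul_pos_of_neg_of_neg ht hc]
    · exfalso
      rw [hff, hff, h1, h2, ht] at hαβ
      simp at hαβ
    · refine fin b (-a) (by rcases hab0' with h | h; right; push_cast; exact neg_ne_zero.2 h; exact Or.inl h) ?_
      intro y hy
      have := hfle y hy
      rw [hff, hff, h1, h2] at this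
      push_cast
      by_contra hc
      push Not at hc
      nlinarith [mul_neg_of_pos_of_neg ht hc]
  · push Not at hA
    have hx0 : x₀ = toR s₀ := by
      have hc : Convex ℝ {y : ℝ × ℝ | f y < f x₀ ∨ y = toR s₀} := by
        intro y hy z hz a b ha hb hab
        rcases eq_or_lt_of_le ha with ha' | ha'
        · have : b = 1 := by linarith
          subst this; rw [← ha']; simpa using hz
        rcases eq_or_lt_of_le hb with hb' | hb'
        · have : a = 1 := by linarith
          subst this; rw [← hb']; simpa using hy
        have e1 : a = 1 - b := by linarith
        rcases hy with hy | rfl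
        · left
          have hz' : f z ≤ f x₀ := by rcases hz with hz | rfl; exact hz.le; exact hs₀f.le
          rw [map_add, map_smul, map_smul, smul_eq_mul, smul_eq_mul]
          have hy' : f y < f x₀ := hy
          have i1 := mul_lt_mul_of_pos_left hy' ha'
          have i2 := mul_le_mul_of_nonneg_left hz' hb
          have i3 : a * f x₀ + b * f x₀ = f x₀ := by rw [← add_mul, hab, one_mul]
          linarith
        · rcases hz with hz | rfl
          · left
            rw [map_add, map_smul, map_smul, smul_eq_mul, smul_eq_mul]
            have hy' : f z < f x₀ := hz
            have i1 := mul_lt_mul_of_pos_left hy' hb'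
            have i3 : a * f x₀ + b * f x₀ = f x₀ := by rw [← add_mul, hab, one_mul]
            rw [hs₀f]
            linarith
          · right
            rw [← add_smul, hab, one_smul]
      have : Ω ⊆ {y : ℝ × ℝ | f y < f x₀ ∨ y = toR s₀} := by
        rw [hS]
        refine convexHull_min ?_ hc
        rintro _ ⟨s, hs, rfl⟩
        by_cases hss : s = s₀
        · right; rw [hss]
        · left; exact lt_of_le_of_ne (hfle _ (hSΩ s hs)) (hA s hs hss)
      rcases this hxΩ with h | h
      · exact absurd h (lt_irrefl _)
      · exact h
    have hopen : ∀ᶠ q : ℝ × ℝ in 𝓝 (α, β), (0 < q.1 * (x₀.1 - y₀.1) + q.2 * (x₀.2 - y₀.2)) ∧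
        ∀ s ∈ S, s ≠ s₀ → 0 < q.1 * (x₀.1 - s.1) + q.2 * (x₀.2 - s.2) := by
      refine Filter.Eventually.and ?_ ((Filter.eventually_all_finset S).2 fun s hs => ?_)
      · have hc : Continuous fun q : ℝ × ℝ => q.1 * (x₀.1 - y₀.1) + q.2 * (x₀.2 - y₀.2) := by
          fun_prop
        refine hc.continuousAt.eventually (lt_mem_nhds ?_)
        rw [hff, hff] at hαβ
        simp only
        linarith
      · by_cases hss : s = s₀
        · exact Filter.Eventually.of_forall fun _ h => absurd hss h
        · have hc : Continuous fun q : ℝ × ℝ => q.1 * (x₀.1 - s.1) + q.2 * (x₀.2 - s.2) := by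
            fun_prop
          have hpos : (0 : ℝ) < α * (x₀.1 - s.1) + β * (x₀.2 - s.2) := by
            have := lt_of_le_of_ne (hfle _ (hSΩ s hs)) (hA s hs hss)
            rw [hff, hff] at this
            simp only [toR] at this
            linarith
          have := (hc.continuousAt (x := (α, β))).eventually (lt_mem_nhds (a := 0) hpos)
          exact this.mono fun q hq _ => hq
    have hd : DenseRange (Prod.map ((↑) : ℚ → ℝ) ((↑) : ℚ → ℝ)) :=
      Rat.denseRange_cast.prodMap Rat.denseRange_cast
    obtain ⟨⟨q1, q2⟩, hq⟩ := hd.exists_mem_open isOpen_interior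
      ⟨_, mem_interior_iff_mem_nhds.2 hopen⟩
    have hq' := interior_subset hq
    obtain ⟨hqy, hqS⟩ := hq'
    simp only [Prod.map_apply] at hqy hqS
    have hd1 : (0 : ℝ) < q1.den := by exact_mod_cast q1.den_pos
    have hd2 : (0 : ℝ) < q2.den := by exact_mod_cast q2.den_pos
    have e1 : (q1 : ℝ) * (q1.den * q2.den) = (q1.num * q2.den : ℤ) := by
      push_cast
      rw [Rat.cast_def q1]; field_simp
    have e2 : (q2 : ℝ) * (q1.den * q2.den) = (q2.num * q1.den : ℤ) := by
      push_cast
      rw [Rat.cast_def q2]; field_simp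
    set K : ℤ := q1.num * q2.den
    set L : ℤ := q2.num * q1.den
    have hdd := mul_pos hd1 hd2
    refine fin (-K) (-L) ?_ ?_
    · by_contra hc
      push Not at hc
      have hK : (K : ℝ) = 0 := by simpa using hc.1
      have hL : (L : ℝ) = 0 := by simpa using hc.2
      rw [hK] at e1
      rw [hL] at e2
      have z1 : (q1 : ℝ) = 0 := by rcases mul_eq_zero.1 e1 with h | h; exact h; exact absurd h hdd.ne'
      have z2 : (q2 : ℝ) = 0 := by rcases mul_eq_zero.1 e2 with h | h; exact h; exact absurd h hdd.ne'
      rw [z1, z2] at hqy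
      simp at hqy
    · have : Ω ⊆ {y | 0 ≤ ((-K : ℤ) : ℝ) * y.1 + ((-L : ℤ) : ℝ) * y.2 +
          (-(((-K : ℤ) : ℝ) * x₀.1 + ((-L : ℤ) : ℝ) * x₀.2))} := by
        rw [hS]
        refine convexHull_min ?_ ?_
        · rintro _ ⟨s, hs, rfl⟩
          simp only [Set.mem_ofPred_eq, toR]
          push_cast
          by_cases hss : s = s₀
          · rw [hx0, hss]; simp [toR]
          · have := mul_pos (hqS s hs hss) hdd
            rw [← e1, ← e2]
            nlinarith
        · intro y hy z hz a b ha hb hab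
          simp only [Set.mem_ofPred_eq, Prod.fst_add, Prod.snd_add, Prod.smul_fst, Prod.smul_snd,
            smul_eq_mul] at hy hz ⊢
          have h1 := mul_nonneg ha hy
          have h2 := mul_nonneg hb hz
          have e : a = 1 - b := by linarith
          subst e
          nlinarith
      intro y hy
      exact this hy

theorem boundary_bound {Ω : Set (ℝ × ℝ)} (hΩ : IsLatticePolygon Ω) {P : Finset (ℝ × ℝ)}
    (hPΩ : (↑P : Set (ℝ × ℝ)) ⊆ interior Ω) (ε : ℝ) (hε : 0 < ε) :
    ∃ δ : ℝ, 0 < δ ∧ ∃ N0 : ℕ, 1 ≤ N0 ∧ ∀ N, N0 ≤ N → ∀ f, Odo Ω P N f → ∀ v ∈ latGrid Ω N,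
      ∀ z ∈ frontier Ω, dist (sc N v) z < δ → (f v : ℝ) ≤ ε * N := by
  have hfc : IsCompact (frontier Ω) := hΩ.isCompact.of_isClosed_subset isClosed_frontier
    hΩ.isCompact.isClosed.frontier_subset
  have key : ∃ U : Set (ℝ × ℝ), IsOpen U ∧ frontier Ω ⊆ U ∧ ∃ N0 : ℕ, 1 ≤ N0 ∧ ∀ N, N0 ≤ N →
      ∀ f, Odo Ω P N f → ∀ v ∈ latGrid Ω N, sc N v ∈ U → (f v : ℝ) ≤ ε * N := by
    refine hfc.induction_on (p := fun s => ∃ U : Set (ℝ × ℝ), IsOpen U ∧ s ⊆ U ∧ ∃ N0 : ℕ,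
      1 ≤ N0 ∧ ∀ N, N0 ≤ N →
      ∀ f, Odo Ω P N f → ∀ v ∈ latGrid Ω N, sc N v ∈ U → (f v : ℝ) ≤ ε * N) ?_ ?_ ?_ ?_
    · exact ⟨∅, isOpen_empty, subset_rfl, 1, le_rfl, fun N _ f _ v _ h => absurd h (by simp)⟩
    · rintro s t hst ⟨U, hU, hs, h⟩
      exact ⟨U, hU, hst.trans hs, h⟩
    · rintro s t ⟨U, hU, hs, N1, h1, h⟩ ⟨W, hW, ht, N2, h2, h'⟩
      refine ⟨U ∪ W, hU.union hW, Set.union_subset_union hs ht, max N1 N2, le_max_of_le_left h1,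
        fun N hN f hf v hv hm => ?_⟩
      rcases hm with hm | hm
      · exact h N (le_trans (le_max_left _ _) hN) f hf v hv hm
      · exact h' N (le_trans (le_max_right _ _) hN) f hf v hv hm
    · intro x hx
      obtain ⟨k, l, c, h0, hx0, hi⟩ := support_int hΩ hx
      obtain ⟨C, hC0, hC⟩ := upper_bound (P := P) hΩ.isCompact.isBounded
        (hPΩ.trans interior_subset) k l c h0 (fun p hp => hi p (hPΩ hp))
      have hcont : Continuous fun y : ℝ × ℝ => C * (k * y.1 + l * y.2 + c) := by fun_prop
      have hopen : IsOpen {y : ℝ × ℝ | C * (k * y.1 + l * y.2 + c) < ε / 2} :=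
        isOpen_lt hcont continuous_const
      have hxm : x ∈ {y : ℝ × ℝ | C * (k * y.1 + l * y.2 + c) < ε / 2} := by
        simp only [Set.mem_ofPred_eq, hx0]; linarith
      refine ⟨_, mem_nhdsWithin_of_mem_nhds (hopen.mem_nhds hxm), _, hopen, subset_rfl, ?_⟩
      obtain ⟨n, hn⟩ := exists_nat_gt (2 * C / ε)
      refine ⟨n + 1, by omega, fun N hN f hf v hv hm => ?_⟩
      have hN1 : 1 ≤ N := by omega
      have hNpos : (0 : ℝ) < N := by exact_mod_cast hN1
      have hnN : (n : ℝ) ≤ N := by exact_mod_cast (by omega : n ≤ N)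
      have hb := hC N hN1 f hf v hv
      have hm' : C * (k * (sc N v).1 + l * (sc N v).2 + c) < ε / 2 := hm
      simp only [sc] at hm'
      have e1 : C * ((k : ℝ) * v.1 + l * v.2 + N * c + 1) =
          N * (C * (k * ((v.1 : ℝ) / N) + l * ((v.2 : ℝ) / N) + c)) + C := by
        field_simp
      rw [e1] at hb
      have h3 : 2 * C / ε < N := lt_of_lt_of_le hn hnN
      rw [div_lt_iff₀ hε] at h3
      have h4 := mul_lt_mul_of_pos_left hm' hNpos
      linarith
  obtain ⟨U, hU, hs, N0, hN0, h⟩ := key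
  obtain ⟨δ, hδ, hδU⟩ := hfc.exists_thickening_subset_open hU hs
  refine ⟨δ, hδ, N0, hN0, fun N hN f hf v hv z hz hd => h N hN f hf v hv (hδU ?_)⟩
  exact Metric.mem_thickening_iff.2 ⟨z, hz, hd⟩

theorem global_bound {Ω : Set (ℝ × ℝ)} (hΩ : IsLatticePolygon Ω) {P : Finset (ℝ × ℝ)}
    (hPΩ : (↑P : Set (ℝ × ℝ)) ⊆ interior Ω) : ∃ B : ℝ, 0 < B ∧ ∀ N, 1 ≤ N → ∀ f, Odo Ω P N f →
      ∀ v, (f v : ℝ) ≤ B * N := by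
  obtain ⟨C, hC0, hC⟩ := upper_bound (P := P) hΩ.isCompact.isBounded
        (hPΩ.trans interior_subset) 0 0 1 (by simp) (by simp)
  refine ⟨2 * C + 1, by linarith, fun N hN f hf v => ?_⟩
  have hN1 : (1 : ℝ) ≤ N := by exact_mod_cast hN
  by_cases hv : v ∈ latGrid Ω N
  · have := hC N hN f hf v hv
    simp only [Int.cast_zero, zero_mul, zero_add, mul_one] at this
    nlinarith
  · rw [hf.zero v hv]; simp; positivity

/-- a point of `Ω` and a point outside have a frontier point between them -/
theorem exists_frontier_near {Ω : Set (ℝ × ℝ)} {y z : ℝ × ℝ} (hy : y ∈ Ω) (hz : z ∉ Ω) :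
    ∃ w ∈ frontier Ω, dist y w ≤ dist y z := by
  have hs : IsPreconnected (segment ℝ y z) := (convex_segment y z).isPreconnected
  have : (segment ℝ y z ∩ frontier Ω).Nonempty := by
    by_contra hcon
    rw [Set.not_nonempty_iff_eq_empty] at hcon
    have hd : ∀ w ∈ segment ℝ y z, w ∉ frontier Ω := fun w hw hf => by
      have : w ∈ segment ℝ y z ∩ frontier Ω := ⟨hw, hf⟩
      rw [hcon] at this; exact this
    have hcase : ∀ w ∈ segment ℝ y z, w ∈ interior Ω ∪ (closure Ω)ᶜ := fun w hw => by
      by_cases h1 : w ∈ closure Ω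
      · left
        by_contra h2
        exact hd w hw ⟨h1, h2⟩
      · exact Or.inr h1
    obtain ⟨w, _, h1, h2⟩ := hs (interior Ω) (closure Ω)ᶜ isOpen_interior
      isClosed_closure.isOpen_compl hcase
      ⟨y, left_mem_segment _ _ _, (hcase y (left_mem_segment _ _ _)).resolve_right
        fun h => h (subset_closure hy)⟩
      ⟨z, right_mem_segment _ _ _, (hcase z (right_mem_segment _ _ _)).resolve_left
        fun h => hz (interior_subset h)⟩
    exact h2 (subset_closure (interior_subset h1))
  obtain ⟨w, hw, hwf⟩ := this
  refine ⟨w, hwf, ?_⟩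
  have := dist_add_dist_of_mem_segment hw
  linarith [dist_nonneg (x := w) (y := z)]

theorem second_diff {g g' g'' : ℝ → ℝ} (h1 : ∀ t, HasDerivAt g (g' t) t)
    (h2 : ∀ t, HasDerivAt g' (g'' t) t) {h : ℝ} (hh : 0 < h) :
    ∃ ξ ∈ Set.Icc (-h) h, g h + g (-h) - 2 * g 0 = h ^ 2 * g'' ξ := by
  have hneg : ∀ t, HasDerivAt (fun s => g (-s)) (-(g' (-t))) t := by
    intro t
    have := (h1 (-t)).comp t (hasDerivAt_neg t)
    simpa [Function.comp_def] using this
  have hF : ∀ t, HasDerivAt (fun s => g s + g (-s)) (g' t - g' (-t)) t := by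
    intro t
    have := (h1 t).add (hneg t)
    rw [sub_eq_add_neg]
    exact this
  have hG : ∀ t : ℝ, HasDerivAt (fun s : ℝ => s ^ 2) (2 * t) t := by
    intro t
    simpa using hasDerivAt_pow 2 t
  obtain ⟨c, hc, hce⟩ := exists_ratio_hasDerivAt_eq_ratio_slope (fun s => g s + g (-s))
    (fun t => g' t - g' (-t)) hh (fun x _ => (hF x).continuousAt.continuousWithinAt)
    (fun x _ => hF x) (fun s : ℝ => s ^ 2) (fun t => 2 * t)
    (fun x _ => (hG x).continuousAt.continuousWithinAt) (fun x _ => hG x)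
  have hc0 : 0 < c := hc.1
  obtain ⟨ξ, hξ, hξe⟩ := exists_hasDerivAt_eq_slope g' g'' (by linarith : -c < c)
    (fun x _ => (h2 x).continuousAt.continuousWithinAt) (fun x _ => h2 x)
  refine ⟨ξ, ⟨by linarith [hξ.1, hc.2], by linarith [hξ.2, hc.2]⟩, ?_⟩
  rw [eq_div_iff (by linarith)] at hξe
  simp only [neg_zero] at hce
  have : (2 * c) * (g h + g (-h) - 2 * g 0) = (2 * c) * (h ^ 2 * g'' ξ) := by
    nlinarith
  exact mul_left_cancel₀ (by positivity) this

/-- second directional derivative -/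
noncomputable def dd (ψ : ℝ × ℝ → ℝ) (e x : ℝ × ℝ) : ℝ :=
  fderiv ℝ (fun y => fderiv ℝ ψ y e) x e

theorem fderiv_smooth {ψ : ℝ × ℝ → ℝ} (h : ContDiff ℝ (⊤ : ℕ∞) ψ) (e : ℝ × ℝ) :
    ContDiff ℝ (⊤ : ℕ∞) (fun y => fderiv ℝ ψ y e) := by
  have : ContDiff ℝ (⊤ : ℕ∞) (fderiv ℝ ψ) := h.fderiv_right (by simp)
  exact this.clm_apply contDiff_const

theorem dd_smooth {ψ : ℝ × ℝ → ℝ} (h : ContDiff ℝ (⊤ : ℕ∞) ψ) (e : ℝ × ℝ) :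
    ContDiff ℝ (⊤ : ℕ∞) (dd ψ e) := fderiv_smooth (fderiv_smooth h e) e

theorem line_deriv {ψ : ℝ × ℝ → ℝ} (h : ContDiff ℝ (⊤ : ℕ∞) ψ) (e x : ℝ × ℝ) (t : ℝ) :
    HasDerivAt (fun s : ℝ => ψ (x + s • e)) (fderiv ℝ ψ (x + t • e) e) t := by
  have hd : HasFDerivAt ψ (fderiv ℝ ψ (x + t • e)) (x + t • e) :=
    ((h.differentiable (by simp)) _).hasFDerivAt
  have hl : HasDerivAt (fun s : ℝ => x + s • e) e t := by
    have := ((hasDerivAt_id t).smul_const e).const_add x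
    simpa using this
  exact hd.comp_hasDerivAt t hl

theorem second_diff_dir {ψ : ℝ × ℝ → ℝ} (h : ContDiff ℝ (⊤ : ℕ∞) ψ) (e x : ℝ × ℝ) {s : ℝ}
    (hs : 0 < s) : ∃ ξ ∈ Set.Icc (-s) s,
      ψ (x + s • e) + ψ (x - s • e) - 2 * ψ x = s ^ 2 * dd ψ e (x + ξ • e) := by
  obtain ⟨ξ, hξ, he⟩ := second_diff (g := fun s : ℝ => ψ (x + s • e))
    (g' := fun t => fderiv ℝ ψ (x + t • e) e) (g'' := fun t => dd ψ e (x + t • e))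
    (line_deriv h e x) (line_deriv (fderiv_smooth h e) e x) hs
  refine ⟨ξ, hξ, ?_⟩
  simpa [sub_eq_add_neg] using he

theorem dd_compact {ψ : ℝ × ℝ → ℝ} (h : HasCompactSupport ψ) (e : ℝ × ℝ) :
    HasCompactSupport (dd ψ e) := by
  have h1 : HasCompactSupport (fun y => fderiv ℝ ψ y e) := by
    exact (h.fderiv ℝ).comp_left (g := fun L : (ℝ × ℝ) →L[ℝ] ℝ => L e) (by simp)
  exact (h1.fderiv ℝ).comp_left (g := fun L : (ℝ × ℝ) →L[ℝ] ℝ => L e) (by simp)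

theorem dd_bdd {ψ : ℝ × ℝ → ℝ} (hψ : ContDiff ℝ (⊤ : ℕ∞) ψ) (h : HasCompactSupport ψ)
    (e : ℝ × ℝ) : ∃ C, 0 ≤ C ∧ ∀ x, |dd ψ e x| ≤ C := by
  obtain ⟨C, hC⟩ := (dd_compact h e).exists_bound_of_continuous (dd_smooth hψ e).continuous
  exact ⟨C, (norm_nonneg _).trans (hC 0), hC⟩

theorem second_diff_bdd {ψ : ℝ × ℝ → ℝ} (hψ : ContDiff ℝ (⊤ : ℕ∞) ψ) (h : HasCompactSupport ψ)
    (e : ℝ × ℝ) : ∃ C, 0 ≤ C ∧ ∀ x, ∀ s : ℝ, 0 < s →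
      |ψ (x + s • e) + ψ (x - s • e) - 2 * ψ x| ≤ C * s ^ 2 := by
  obtain ⟨C, hC0, hC⟩ := dd_bdd hψ h e
  refine ⟨C, hC0, fun x s hs => ?_⟩
  obtain ⟨ξ, _, he⟩ := second_diff_dir hψ e x hs
  rw [he, abs_mul, abs_of_nonneg (sq_nonneg s), mul_comm]
  exact mul_le_mul_of_nonneg_right (hC _) (sq_nonneg s)

theorem second_diff_tendsto {ψ : ℝ × ℝ → ℝ} (hψ : ContDiff ℝ (⊤ : ℕ∞) ψ) (e x : ℝ × ℝ)
    {s : ℕ → ℝ} (hs : ∀ᶠ n in atTop, 0 < s n) (hs0 : Tendsto s atTop (𝓝 0)) :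
    Tendsto (fun n => (ψ (x + s n • e) + ψ (x - s n • e) - 2 * ψ x) / s n ^ 2) atTop
      (𝓝 (dd ψ e x)) := by
  have h1 : ∀ n, ∃ ξ : ℝ, 0 < s n → |ξ| ≤ s n ∧
      ψ (x + s n • e) + ψ (x - s n • e) - 2 * ψ x = s n ^ 2 * dd ψ e (x + ξ • e) := by
    intro n
    by_cases hn : 0 < s n
    · obtain ⟨ξ, hξ, he⟩ := second_diff_dir hψ e x hn
      exact ⟨ξ, fun _ => ⟨abs_le.2 hξ, he⟩⟩
    · exact ⟨0, fun h => absurd h hn⟩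
  choose ξ hξ using h1
  have hξ0 : Tendsto ξ atTop (𝓝 0) := by
    apply squeeze_zero_norm' _ hs0
    filter_upwards [hs] with n hn using (hξ n hn).1
  have hcont : Continuous fun t : ℝ => dd ψ e (x + t • e) := by
    have := (dd_smooth hψ e).continuous
    fun_prop
  have := (hcont.tendsto 0).comp hξ0
  simp only [zero_smul, add_zero] at this
  refine this.congr' ?_
  filter_upwards [hs] with n hn
  rw [(hξ n hn).2, Function.comp_apply, mul_div_cancel_left₀]
  positivity

/-- real-valued Laplacian -/
noncomputable def lapR (g : V → ℝ) (v : V) : ℝ :=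
  -4 * g v + (g (v + (1, 0)) + (g (v - (1, 0)) + (g (v + (0, 1)) + g (v - (0, 1)))))

/-- squared gradient -/
noncomputable def gr (g : V → ℝ) (v : V) : ℝ :=
  (g (v + (1, 0)) - g v) ^ 2 + ((g (v - (1, 0)) - g v) ^ 2 + ((g (v + (0, 1)) - g v) ^ 2 +
    (g (v - (0, 1)) - g v) ^ 2))

theorem lapR_cast (f : V → ℤ) (v : V) : lapR (fun w => (f w : ℝ)) v = (lap f v : ℝ) := by
  rw [lap_eq, lapR]
  push_cast
  simp [Prod.add_def, Prod.sub_def]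

theorem gr_nonneg (g : V → ℝ) (v : V) : 0 ≤ gr g v := by unfold gr; positivity

theorem shift_sum (χ h : V → ℝ) (e : V) :
    ∑' v, χ v * h (v + e) = ∑' v, h v * χ (v - e) := by
  rw [← (Equiv.addRight e).tsum_eq (fun w => h w * χ (w - e))]
  simp [mul_comm]

theorem summ_fs {χ : V → ℝ} (hχ : χ.support.Finite) (h : V → ℝ) : Summable fun v => χ v * h v := by
  apply summable_of_hasFiniteSupport
  exact hχ.subset (by intro v hv; simp at hv ⊢; exact hv.1)

theorem supp_shift {χ : V → ℝ} (hχ : χ.support.Finite) (e : V) :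
    (fun v => χ (v - e)).support.Finite := by
  have : (fun v => χ (v - e)).support = (fun v => v - e) ⁻¹' χ.support := by
    ext; simp
  rw [this]
  exact hχ.preimage (sub_left_injective.injOn)

theorem summ_fs' {χ : V → ℝ} (hχ : χ.support.Finite) (h : V → ℝ) (e : V) :
    Summable fun v => h v * χ (v - e) := by
  simpa [mul_comm] using summ_fs (supp_shift hχ e) h

theorem summ_fs'' {χ : V → ℝ} (hχ : χ.support.Finite) (h : V → ℝ) (e : V) :
    Summable fun v => h v * χ (v + e) := by
  simpa using summ_fs' hχ h (-e)

theorem summ_fs0 {χ : V → ℝ} (hχ : χ.support.Finite) (h : V → ℝ) :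
    Summable fun v => h v * χ v := by
  simpa using summ_fs' hχ h 0

theorem sbp {χ : V → ℝ} (hχ : χ.support.Finite) (h : V → ℝ) :
    ∑' v, χ v * lapR h v = ∑' v, h v * lapR χ v := by
  have e1 : ∀ v, χ v * lapR h v = χ v * h v * (-4) + (χ v * h (v + (1, 0)) +
      (χ v * h (v + -(1, 0)) + (χ v * h (v + (0, 1)) + χ v * h (v + -(0, 1))))) := by
    intro v; simp only [lapR, ← sub_eq_add_neg]; ring
  have e2 : ∀ v, h v * lapR χ v = χ v * h v * (-4) + (h v * χ (v - (1, 0)) +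
      (h v * χ (v - -(1, 0)) + (h v * χ (v - (0, 1)) + h v * χ (v - -(0, 1))))) := by
    intro v; simp only [lapR, sub_neg_eq_add]; ring
  have s0 : Summable fun v => χ v * h v * (-4) := (summ_fs hχ h).mul_right _
  have s1 : ∀ e, Summable fun v => χ v * h (v + e) := fun e => summ_fs hχ fun v => h (v + e)
  have s2 := summ_fs' hχ h
  simp_rw [e1, e2]
  rw [s0.tsum_add ((s1 _).add ((s1 _).add ((s1 _).add (s1 _)))),
    (s1 _).tsum_add ((s1 _).add ((s1 _).add (s1 _))), (s1 _).tsum_add ((s1 _).add (s1 _)),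
    (s1 _).tsum_add (s1 _),
    s0.tsum_add ((s2 _).add ((s2 _).add ((s2 _).add (s2 _)))),
    (s2 _).tsum_add ((s2 _).add ((s2 _).add (s2 _))), (s2 _).tsum_add ((s2 _).add (s2 _)),
    (s2 _).tsum_add (s2 _)]
  simp only [shift_sum]

theorem energy_id {χ : V → ℝ} (hχ : χ.support.Finite) (f : V → ℝ) :
    ∑' v, χ v * gr f v = ∑' v, f v ^ 2 * lapR χ v - 2 * ∑' v, χ v * (f v * lapR f v) := by
  rw [← sbp hχ (fun v => f v ^ 2), ← tsum_mul_left, ← Summable.tsum_sub (summ_fs hχ _)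
    ((summ_fs hχ _).mul_left 2)]
  congr 1; ext v
  simp only [lapR, gr]; ring

open Classical in
/-- lattice points whose rescaling lies in the sup-ball -/
noncomputable def bx (N : ℕ) (y : ℝ × ℝ) (r : ℝ) : Finset V :=
  (Finset.Icc ⌊N * (y.1 - r)⌋ ⌈N * (y.1 + r)⌉ ×ˢ Finset.Icc ⌊N * (y.2 - r)⌋ ⌈N * (y.2 + r)⌉).filter
    fun v => dist (sc N v) y < r

theorem dist_sc {N : ℕ} {v : V} {y : ℝ × ℝ} {r : ℝ} :
    dist (sc N v) y < r ↔ |(v.1 : ℝ) / N - y.1| < r ∧ |(v.2 : ℝ) / N - y.2| < r := by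
  rw [Prod.dist_eq, max_lt_iff, Real.dist_eq, Real.dist_eq]; rfl

theorem mem_bx {N : ℕ} (hN : 1 ≤ N) {y : ℝ × ℝ} {r : ℝ} {v : V} :
    v ∈ bx N y r ↔ dist (sc N v) y < r := by
  classical
  unfold bx
  rw [Finset.mem_filter, Finset.mem_product, Finset.mem_Icc, Finset.mem_Icc]
  refine ⟨fun h => h.2, fun h => ⟨?_, h⟩⟩
  have hN0 : (0 : ℝ) < N := by exact_mod_cast hN
  have aux : ∀ (i : ℤ) (t : ℝ), |(i : ℝ) / N - t| < r → ⌊N * (t - r)⌋ ≤ i ∧ i ≤ ⌈N * (t + r)⌉ := by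
    intro i t h
    rw [abs_lt] at h
    have e : (i : ℝ) = N * ((i : ℝ) / N) := by field_simp
    constructor
    · have : (N : ℝ) * (t - r) ≤ i := by
        rw [e]; apply mul_le_mul_of_nonneg_left _ hN0.le; linarith
      exact_mod_cast (Int.floor_le _).trans this
    · have : (i : ℝ) ≤ N * (t + r) := by
        rw [e]; apply mul_le_mul_of_nonneg_left _ hN0.le; linarith
      exact_mod_cast this.trans (Int.le_ceil _)
  obtain ⟨h1, h2⟩ := dist_sc.1 h
  exact ⟨aux _ _ h1, aux _ _ h2⟩

theorem bx_mono {N : ℕ} (hN : 1 ≤ N) {y : ℝ × ℝ} {r s : ℝ} (h : r ≤ s) : bx N y r ⊆ bx N y s := by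
  intro v hv
  rw [mem_bx hN] at hv ⊢
  linarith

theorem card_bx_le {N : ℕ} (hN : 1 ≤ N) (y : ℝ × ℝ) {r : ℝ} (hr : 0 < r) :
    ((bx N y r).card : ℝ) ≤ (2 * r + 3) ^ 2 * N ^ 2 := by
  classical
  have hN0 : (1 : ℝ) ≤ N := by exact_mod_cast hN
  have aux : ∀ t : ℝ, ((Finset.Icc ⌊N * (t - r)⌋ ⌈N * (t + r)⌉).card : ℝ) ≤ (2 * r + 3) * N := by
    intro t
    rw [Int.card_Icc]
    have h1 := Int.lt_floor_add_one (N * (t - r))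
    have h2 := Int.ceil_lt_add_one (N * (t + r))
    have h3 : ((⌈N * (t + r)⌉ + 1 - ⌊N * (t - r)⌋ : ℤ) : ℝ) ≤ (2 * r + 3) * N := by
      push_cast; nlinarith
    have h4 : ((0 : ℤ) : ℝ) ≤ (2 * r + 3) * N := by push_cast; positivity
    have h5 : (((⌈N * (t + r)⌉ + 1 - ⌊N * (t - r)⌋).toNat : ℤ) : ℝ) ≤ (2 * r + 3) * N := by
      rw [Int.toNat_eq_max, Int.cast_max]; exact max_le h3 h4
    exact_mod_cast h5
  have : ((bx N y r).card : ℝ) ≤ _ := Nat.cast_le.2 (Finset.card_filter_le _ _)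
  refine this.trans ?_
  rw [Finset.card_product, Nat.cast_mul, ← mul_pow, sq]
  exact mul_le_mul (aux _) (aux _) (Nat.cast_nonneg _) (by positivity)

theorem card_bx_ge {N : ℕ} (hN : 1 ≤ N) (y : ℝ × ℝ) {r : ℝ} (hr : 0 < r) (hNr : 2 ≤ r * N) :
    (r / 2) ^ 2 * N ^ 2 ≤ ((bx N y r).card : ℝ) := by
  classical
  have hN0 : (0 : ℝ) < N := by exact_mod_cast hN
  have hsub : Finset.Icc ⌈N * (y.1 - r / 2)⌉ ⌊N * (y.1 + r / 2)⌋ ×ˢ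
      Finset.Icc ⌈N * (y.2 - r / 2)⌉ ⌊N * (y.2 + r / 2)⌋ ⊆ bx N y r := by
    intro v hv
    rw [Finset.mem_product, Finset.mem_Icc, Finset.mem_Icc] at hv
    rw [mem_bx hN, dist_sc]
    have aux : ∀ (i : ℤ) (t : ℝ), ⌈N * (t - r / 2)⌉ ≤ i → i ≤ ⌊N * (t + r / 2)⌋ →
        |(i : ℝ) / N - t| < r := by
      intro i t h1 h2
      rw [Int.ceil_le] at h1
      rw [Int.le_floor] at h2
      have h3 : t - r / 2 ≤ i / N := by rw [le_div_iff₀ hN0]; linarith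
      have h4 : i / N ≤ t + r / 2 := by rw [div_le_iff₀ hN0]; linarith
      rw [abs_lt]; constructor <;> linarith
    exact ⟨aux _ _ hv.1.1 hv.1.2, aux _ _ hv.2.1 hv.2.2⟩
  have aux : ∀ t : ℝ, (r / 2) * N ≤ ((Finset.Icc ⌈N * (t - r / 2)⌉ ⌊N * (t + r / 2)⌋).card : ℝ) := by
    intro t
    rw [Int.card_Icc]
    have h1 := Int.lt_floor_add_one (N * (t + r / 2))
    have h2 := Int.ceil_lt_add_one (N * (t - r / 2))
    have h3 : (r / 2) * N ≤ ((⌊N * (t + r / 2)⌋ + 1 - ⌈N * (t - r / 2)⌉ : ℤ) : ℝ) := by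
      push_cast; nlinarith
    have h5 : (r / 2) * N ≤ (((⌊N * (t + r / 2)⌋ + 1 - ⌈N * (t - r / 2)⌉).toNat : ℤ) : ℝ) :=
      h3.trans (by exact_mod_cast Int.self_le_toNat _)
    exact_mod_cast h5
  have h6 : _ ≤ ((bx N y r).card : ℝ) := Nat.cast_le.2 (Finset.card_le_card hsub)
  refine le_trans ?_ h6
  rw [Finset.card_product, Nat.cast_mul, ← mul_pow, sq]
  exact mul_le_mul (aux _) (aux _) (by positivity) (Nat.cast_nonneg _)

theorem sc_add1 (N : ℕ) (v : V) : sc N (v + (1, 0)) = sc N v + ((1 : ℝ) / N) • ((1 : ℝ), (0 : ℝ)) := by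
  ext <;> simp [sc]; ring
theorem sc_sub1 (N : ℕ) (v : V) : sc N (v - (1, 0)) = sc N v - ((1 : ℝ) / N) • ((1 : ℝ), (0 : ℝ)) := by
  ext <;> simp [sc]; ring
theorem sc_add2 (N : ℕ) (v : V) : sc N (v + (0, 1)) = sc N v + ((1 : ℝ) / N) • ((0 : ℝ), (1 : ℝ)) := by
  ext <;> simp [sc]; ring
theorem sc_sub2 (N : ℕ) (v : V) : sc N (v - (0, 1)) = sc N v - ((1 : ℝ) / N) • ((0 : ℝ), (1 : ℝ)) := by
  ext <;> simp [sc]; ring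

theorem dist_sc_add (N : ℕ) (v e : V) (he : |e.1| ≤ 1) (he' : |e.2| ≤ 1) :
    dist (sc N (v + e)) (sc N v) ≤ 1 / N := by
  have aux : ∀ a : ℤ, |a| ≤ 1 → |(a : ℝ) / N| ≤ 1 / N := by
    intro a h
    rw [abs_div, Nat.abs_cast]
    apply div_le_div_of_nonneg_right _ (Nat.cast_nonneg _)
    exact_mod_cast h
  rw [Prod.dist_eq, Real.dist_eq, Real.dist_eq]
  refine max_le ?_ ?_
  · have : (sc N (v + e)).1 - (sc N v).1 = (e.1 : ℝ) / N := by simp [sc]; ring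
    rw [this]; exact aux _ he
  · have : (sc N (v + e)).2 - (sc N v).2 = (e.2 : ℝ) / N := by simp [sc]; ring
    rw [this]; exact aux _ he'

theorem cutoff (y : ℝ × ℝ) {r1 r2 : ℝ} (h1 : 0 < r1) (h2 : r1 < r2) :
    ∃ C : ℝ, 0 ≤ C ∧ ∃ N0 : ℕ, 1 ≤ N0 ∧ ∀ N, N0 ≤ N → ∃ χ : V → ℝ, (∀ v, 0 ≤ χ v) ∧
      (∀ v, v ∈ bx N y r1 → χ v = 1) ∧ (∀ v, v ∉ bx N y r2 → χ v = 0) ∧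
      (∀ v, v ∉ bx N y r2 → lapR χ v = 0) ∧ ∀ v, |lapR χ v| ≤ C / N ^ 2 := by
  let b : ContDiffBump y := ⟨r1, (r1 + r2) / 2, h1, by linarith⟩
  have hb : ContDiff ℝ (⊤ : ℕ∞) (b : ℝ × ℝ → ℝ) := b.contDiff
  have hbc : HasCompactSupport (b : ℝ × ℝ → ℝ) := b.hasCompactSupport
  obtain ⟨C1, hC1, hc1⟩ := second_diff_bdd hb hbc (1, 0)
  obtain ⟨C2, hC2, hc2⟩ := second_diff_bdd hb hbc (0, 1)
  obtain ⟨n, hn⟩ := exists_nat_gt (2 / (r2 - r1))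
  refine ⟨C1 + C2, by positivity, n + 1, by omega, fun N hN => ?_⟩
  have hN1 : 1 ≤ N := by omega
  have hN0 : (0 : ℝ) < N := by exact_mod_cast hN1
  have hnN : (2 / (r2 - r1)) < N := hn.trans_le (by exact_mod_cast (by omega : n ≤ N))
  have hsmall : 1 / (N : ℝ) < (r2 - r1) / 2 := by
    rw [div_lt_iff₀ (by linarith)] at hnN
    rw [div_lt_iff₀ hN0]; linarith
  have hzero : ∀ v, v ∉ bx N y r2 → ∀ e : V, |e.1| ≤ 1 → |e.2| ≤ 1 → b (sc N (v + e)) = 0 := by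
    intro v hv e he he'
    rw [mem_bx hN1, not_lt] at hv
    apply b.zero_of_le_dist
    show (r1 + r2) / 2 ≤ _
    have := dist_triangle (sc N v) (sc N (v + e)) y
    have h3 := dist_sc_add N v e he he'
    rw [dist_comm] at h3
    linarith
  have hz0 : ∀ v, v ∉ bx N y r2 → b (sc N v) = 0 := fun v hv => by
    simpa using hzero v hv 0 (by simp) (by simp)
  refine ⟨fun v => b (sc N v), fun v => b.nonneg, ?_, hz0, ?_, ?_⟩
  · intro v hv
    rw [mem_bx hN1] at hv
    exact b.one_of_mem_closedBall (Metric.mem_closedBall.2 hv.le)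
  · intro v hv
    have a1 := hzero v hv (1, 0) (by simp) (by simp)
    have a2 := hzero v hv (-(1, 0)) (by simp) (by simp)
    have a3 := hzero v hv (0, 1) (by simp) (by simp)
    have a4 := hzero v hv (-(0, 1)) (by simp) (by simp)
    rw [← sub_eq_add_neg] at a2 a4
    simp only [lapR, a1, a2, a3, a4, hz0 v hv]; norm_num
  · intro v
    have i1 := hc1 (sc N v) (1 / N) (by positivity)
    have i2 := hc2 (sc N v) (1 / N) (by positivity)
    have e : lapR (fun v => b (sc N v)) v =
      (b (sc N v + ((1 : ℝ) / N) • ((1 : ℝ), (0 : ℝ))) + b (sc N v - ((1 : ℝ) / N) • ((1 : ℝ), (0 : ℝ)))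
        - 2 * b (sc N v)) +
      (b (sc N v + ((1 : ℝ) / N) • ((0 : ℝ), (1 : ℝ))) + b (sc N v - ((1 : ℝ) / N) • ((0 : ℝ), (1 : ℝ)))
        - 2 * b (sc N v)) := by
      simp only [lapR, sc_add1, sc_sub1, sc_add2, sc_sub2]; ring
    rw [e]
    refine (abs_add_le _ _).trans ((add_le_add i1 i2).trans (le_of_eq ?_))
    field_simp

theorem supp_fin {χ : V → ℝ} {T : Finset V} (h : ∀ v, v ∉ T → χ v = 0) : χ.support.Finite :=
  T.finite_toSet.subset fun v hv => by
    by_contra hc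
    exact hv (h v hc)

theorem caccioppoli (y : ℝ × ℝ) {r1 r2 : ℝ} (h1 : 0 < r1) (h2 : r1 < r2) :
    ∃ C : ℝ, 0 ≤ C ∧ ∃ N0 : ℕ, 1 ≤ N0 ∧ ∀ N, N0 ≤ N → ∀ g : V → ℝ,
      (∀ v ∈ bx N y r2, lapR g v = 0) →
      ∑ v ∈ bx N y r1, gr g v ≤ C / N ^ 2 * ∑ v ∈ bx N y r2, g v ^ 2 := by
  obtain ⟨C, hC, N0, hN0, h⟩ := cutoff y h1 h2
  refine ⟨C, hC, N0, hN0, fun N hN g hg => ?_⟩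
  obtain ⟨χ, c0, c1, c2, c3, c4⟩ := h N hN
  have hfs := supp_fin c2
  have hsub := bx_mono (hN0.trans hN) h2.le (y := y)
  have key := energy_id hfs g
  rw [tsum_eq_sum (s := bx N y r2) (fun v hv => by rw [c2 v hv, zero_mul]),
    tsum_eq_sum (s := bx N y r2) (fun v hv => by rw [c3 v hv, mul_zero]),
    tsum_eq_sum (s := bx N y r2) (fun v hv => by rw [c2 v hv, zero_mul])] at key
  rw [Finset.sum_congr rfl (fun v hv => by rw [hg v hv, mul_zero, mul_zero] :
    ∀ v ∈ bx N y r2, χ v * (g v * lapR g v) = 0), Finset.sum_const_zero, mul_zero, sub_zero] at key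
  calc ∑ v ∈ bx N y r1, gr g v = ∑ v ∈ bx N y r1, χ v * gr g v :=
        Finset.sum_congr rfl fun v hv => by rw [c1 v hv, one_mul]
    _ ≤ ∑ v ∈ bx N y r2, χ v * gr g v :=
        Finset.sum_le_sum_of_subset_of_nonneg hsub fun v _ _ => mul_nonneg (c0 v) (gr_nonneg g v)
    _ = ∑ v ∈ bx N y r2, g v ^ 2 * lapR χ v := key
    _ ≤ ∑ v ∈ bx N y r2, C / N ^ 2 * g v ^ 2 := Finset.sum_le_sum fun v _ => by
        rw [mul_comm]
        exact mul_le_mul_of_nonneg_right ((le_abs_self _).trans (c4 v)) (sq_nonneg _)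
    _ = _ := by rw [Finset.mul_sum]

theorem energy_bound (y : ℝ × ℝ) {r1 r2 : ℝ} (h1 : 0 < r1) (h2 : r1 < r2) :
    ∃ C : ℝ, 0 ≤ C ∧ ∃ N0 : ℕ, 1 ≤ N0 ∧ ∀ N, N0 ≤ N → ∀ g : V → ℝ, ∀ M : ℝ,
      (∀ v, 0 ≤ g v) → (∀ v, g v ≤ M) → (∀ v ∈ bx N y r2, lapR g v ≤ 0) →
      ∑ v ∈ bx N y r1, gr g v ≤ C * M ^ 2 := by
  obtain ⟨C, hC, N0, hN0, h⟩ := cutoff y h1 h2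
  refine ⟨3 * C * (2 * r2 + 3) ^ 2, by positivity, N0, hN0, fun N hN g M g0 gM hg => ?_⟩
  obtain ⟨χ, c0, c1, c2, c3, c4⟩ := h N hN
  have hN1 : 1 ≤ N := hN0.trans hN
  have hM : 0 ≤ M := (g0 0).trans (gM 0)
  have hfs := supp_fin c2
  have hsub := bx_mono hN1 h2.le (y := y)
  have key := energy_id hfs g
  have key2 := sbp hfs g
  rw [tsum_eq_sum (s := bx N y r2) (fun v hv => by rw [c2 v hv, zero_mul]),
    tsum_eq_sum (s := bx N y r2) (fun v hv => by rw [c3 v hv, mul_zero]),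
    tsum_eq_sum (s := bx N y r2) (fun v hv => by rw [c2 v hv, zero_mul])] at key
  rw [tsum_eq_sum (s := bx N y r2) (fun v hv => by rw [c2 v hv, zero_mul]),
    tsum_eq_sum (s := bx N y r2) (fun v hv => by rw [c3 v hv, mul_zero])] at key2
  have hcard := card_bx_le hN1 y (h1.trans h2)
  have hNpos : (0 : ℝ) < N := by exact_mod_cast hN1
  have i1 : ∑ v ∈ bx N y r2, g v ^ 2 * lapR χ v ≤ ∑ v ∈ bx N y r2, M ^ 2 * (C / N ^ 2) := by
    refine Finset.sum_le_sum fun v _ => ?_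
    have : g v ^ 2 ≤ M ^ 2 := pow_le_pow_left₀ (g0 v) (gM v) 2
    have h3 := c4 v
    calc g v ^ 2 * lapR χ v ≤ g v ^ 2 * |lapR χ v| :=
          mul_le_mul_of_nonneg_left (le_abs_self _) (sq_nonneg _)
      _ ≤ _ := mul_le_mul this h3 (abs_nonneg _) (sq_nonneg _)
  have i2 : M * ∑ v ∈ bx N y r2, χ v * lapR g v ≤ ∑ v ∈ bx N y r2, χ v * (g v * lapR g v) := by
    rw [Finset.mul_sum]
    refine Finset.sum_le_sum fun v hv => ?_
    have := mul_nonneg (c0 v) (mul_nonneg (sub_nonneg.2 (gM v)) (neg_nonneg.2 (hg v hv)))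
    nlinarith
  have i3 : ∑ v ∈ bx N y r2, -(M * (C / N ^ 2)) ≤ ∑ v ∈ bx N y r2, g v * lapR χ v := by
    refine Finset.sum_le_sum fun v _ => ?_
    have h3 := c4 v
    have : |g v * lapR χ v| ≤ M * (C / N ^ 2) := by
      rw [abs_mul, abs_of_nonneg (g0 v)]
      exact mul_le_mul (gM v) h3 (abs_nonneg _) hM
    linarith [neg_abs_le (g v * lapR χ v)]
  rw [Finset.sum_const, nsmul_eq_mul] at i1 i3
  have i4 : ∑ v ∈ bx N y r1, gr g v ≤ ∑ v ∈ bx N y r2, χ v * gr g v := by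
    have : ∑ v ∈ bx N y r1, gr g v = ∑ v ∈ bx N y r1, χ v * gr g v :=
      Finset.sum_congr rfl fun v hv => by rw [c1 v hv, one_mul]
    rw [this]
    exact Finset.sum_le_sum_of_subset_of_nonneg hsub fun v _ _ => mul_nonneg (c0 v) (gr_nonneg g v)
  rw [key2] at i2
  have i5 : ((bx N y r2).card : ℝ) * (C / N ^ 2) ≤ C * (2 * r2 + 3) ^ 2 := by
    calc _ ≤ ((2 * r2 + 3) ^ 2 * N ^ 2) * (C / N ^ 2) :=
          mul_le_mul_of_nonneg_right hcard (by positivity)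
      _ = _ := by field_simp
  have i6 := mul_le_mul_of_nonneg_left i5 (sq_nonneg M)
  have i7 := mul_le_mul_of_nonneg_left i3 hM
  nlinarith

theorem lin1 (g : ℤ → ℤ) (k : ℤ) (I : Set ℤ) (hI : I.OrdConnected)
    (h : ∀ i ∈ I, g (i + 1) - g i = k) : ∀ i ∈ I, ∀ j ∈ I, g j - g i = k * (j - i) := by
  have key : ∀ i ∈ I, ∀ j, i ≤ j → j ∈ I → g j - g i = k * (j - i) := by
    intro i hi j hij
    induction j, hij using Int.leInduction with
    | base => intro _; ring
    | succ n hn ih =>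
      intro hn1
      have hnI : n ∈ I := hI.out hi hn1 ⟨hn, by omega⟩
      have h1 := ih hnI
      have h2 := h n hnI
      linear_combination h1 + h2
  intro i hi j hj
  rcases le_total i j with hij | hij
  · exact key i hi j hij hj
  · have := key j hj i hij hi
    linear_combination -this

theorem abs_ordConnected (N : ℕ) (t r : ℝ) : {i : ℤ | |(i : ℝ) / N - t| < r}.OrdConnected := by
  constructor
  intro i hi j hj k hk
  have hi' : |(i : ℝ) / N - t| < r := hi
  have hj' : |(j : ℝ) / N - t| < r := hj
  show |(k : ℝ) / N - t| < r
  rw [abs_lt] at *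
  have h1 : (i : ℝ) / N ≤ k / N := by
    apply div_le_div_of_nonneg_right _ (Nat.cast_nonneg _); exact_mod_cast hk.1
  have h2 : (k : ℝ) / N ≤ j / N := by
    apply div_le_div_of_nonneg_right _ (Nat.cast_nonneg _); exact_mod_cast hk.2
  constructor <;> linarith

theorem lin_box {N : ℕ} (hN : 1 ≤ N) {y : ℝ × ℝ} {r : ℝ} (g : V → ℤ) (k l : ℤ)
    (h1 : ∀ v ∈ bx N y r, g (v + (1, 0)) - g v = k) (h2 : ∀ v ∈ bx N y r, g (v + (0, 1)) - g v = l) :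
    ∀ v ∈ bx N y r, ∀ w ∈ bx N y r, g v - g w = k * (v.1 - w.1) + l * (v.2 - w.2) := by
  intro v hv w hw
  obtain ⟨v1, v2⟩ := v
  obtain ⟨w1, w2⟩ := w
  rw [mem_bx hN, dist_sc] at hv hw
  simp only at hv hw ⊢
  have a1 := lin1 (fun i => g (i, v2)) k _ (abs_ordConnected N y.1 r) (fun i hi => by
    have := h1 (i, v2) (by rw [mem_bx hN, dist_sc]; exact ⟨hi, hv.2⟩)
    simpa using this) w1 hw.1 v1 hv.1
  have a2 := lin1 (fun i => g (w1, i)) l _ (abs_ordConnected N y.2 r) (fun i hi => by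
    have := h2 (w1, i) (by rw [mem_bx hN, dist_sc]; exact ⟨hw.1, hi⟩)
    simpa using this) w2 hw.2 v2 hv.2
  linarith

/-- difference operator -/
def Dz (e : V) (f : V → ℤ) (v : V) : ℤ := f (v + e) - f v

/-- unit steps -/
def Unit2 (e : V) : Prop := e = (1, 0) ∨ e = (0, 1)

theorem Dz_sq_le {e : V} (he : Unit2 e) (f : V → ℤ) (v : V) :
    (Dz e f v : ℝ) ^ 2 ≤ gr (fun w => (f w : ℝ)) v := by
  unfold Dz gr
  push_cast
  rcases he with rfl | rfl
  · nlinarith [sq_nonneg ((f (v - (1, 0)) : ℝ) - f v), sq_nonneg ((f (v + (0, 1)) : ℝ) - f v),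
      sq_nonneg ((f (v - (0, 1)) : ℝ) - f v)]
  · nlinarith [sq_nonneg ((f (v - (1, 0)) : ℝ) - f v), sq_nonneg ((f (v + (1, 0)) : ℝ) - f v),
      sq_nonneg ((f (v - (0, 1)) : ℝ) - f v)]

theorem lap_Dz (e : V) (f : V → ℤ) (v : V) : lap (Dz e f) v = lap f (v + e) - lap f v := by
  have h : ∀ a b c : V, a + b + c = a + c + b := fun a b c => add_right_comm a b c
  have e1 : ∀ (f : V → ℤ) (v : V), lap f v = -4 * f v + (f (v + (1, 0)) + (f (v + (-1, 0)) +
    (f (v + (0, 1)) + f (v + (0, -1))))) := by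
    intro f v; rw [lap_eq]; simp [Prod.add_def, sub_eq_add_neg]
  rw [e1, e1, e1]
  unfold Dz
  rw [h v (1, 0) e, h v (-1, 0) e, h v (0, 1) e, h v (0, -1) e]
  ring

theorem cacc_step (y : ℝ × ℝ) {r1 r2 : ℝ} (h1 : 0 < r1) (h2 : r1 < r2) :
    ∃ C : ℝ, 0 ≤ C ∧ ∃ N0 : ℕ, 1 ≤ N0 ∧ ∀ N, N0 ≤ N → ∀ g : V → ℤ,
      (∀ v ∈ bx N y r2, lap g v = 0) → ∀ e, Unit2 e →
      (∀ v ∈ bx N y r1, lap (Dz e g) v = 0) ∧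
      ∑ v ∈ bx N y r1, (Dz e g v : ℝ) ^ 2 ≤ C / N ^ 2 * ∑ v ∈ bx N y r2, (g v : ℝ) ^ 2 := by
  obtain ⟨C, hC, N0, hN0, h⟩ := caccioppoli y h1 h2
  obtain ⟨n, hn⟩ := exists_nat_gt (1 / (r2 - r1))
  refine ⟨C, hC, max N0 n, le_max_of_le_left hN0, fun N hN g hg e he => ?_⟩
  have hNN0 : N0 ≤ N := (le_max_left _ _).trans hN
  have hnN : n ≤ N := (le_max_right _ _).trans hN
  have hN1 := hN0.trans hNN0
  have hNpos : (0 : ℝ) < N := by exact_mod_cast hN1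
  constructor
  · intro v hv
    have hv2 := bx_mono hN1 h2.le hv
    have hve : v + e ∈ bx N y r2 := by
      rw [mem_bx hN1] at hv ⊢
      have h3 : dist (sc N (v + e)) (sc N v) ≤ 1 / N :=
        dist_sc_add N v e (by rcases he with rfl | rfl <;> simp) (by rcases he with rfl | rfl <;> simp)
      have h4 : 1 / (N : ℝ) < r2 - r1 := by
        have : 1 / (r2 - r1) < N := hn.trans_le (by exact_mod_cast hnN)
        rw [div_lt_iff₀ (by linarith)] at this
        rw [div_lt_iff₀ hNpos]; linarith
      have := dist_triangle (sc N (v + e)) (sc N v) y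
      linarith
    rw [lap_Dz, hg _ hv2, hg _ hve, sub_zero]
  · refine le_trans (Finset.sum_le_sum fun v _ => Dz_sq_le he g v) ?_
    apply h N hNN0
    intro v hv
    rw [lapR_cast, hg v hv, Int.cast_zero]

theorem sq_int_zero {T : Finset V} {g : V → ℤ} (h : ∑ v ∈ T, (g v : ℝ) ^ 2 < 1) :
    ∀ v ∈ T, g v = 0 := by
  intro v hv
  have h1 : (g v : ℝ) ^ 2 ≤ ∑ v ∈ T, (g v : ℝ) ^ 2 :=
    Finset.single_le_sum (f := fun v => (g v : ℝ) ^ 2) (fun _ _ => sq_nonneg _) hv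
  have h2 : (g v) ^ 2 < 1 := by exact_mod_cast h1.trans_lt h
  by_contra hc
  have : 1 ≤ (g v) ^ 2 := by
    have := sq_pos_of_ne_zero hc
    omega
  omega

theorem local_affine (y : ℝ × ℝ) {R B : ℝ} (hR : 0 < R) (hB : 0 < B) :
    ∃ K : ℝ, 0 ≤ K ∧ ∃ N0 : ℕ, 1 ≤ N0 ∧ ∀ N, N0 ≤ N → ∀ f : V → ℤ,
      (∀ v ∈ bx N y R, lap f v = 0) → (∀ v, |(f v : ℝ)| ≤ B * N) →
      ∃ k l : ℤ, |(k : ℝ)| ≤ K ∧ |(l : ℝ)| ≤ K ∧ ∀ v ∈ bx N y (R / 4), ∀ w ∈ bx N y (R / 4),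
        f v - f w = k * (v.1 - w.1) + l * (v.2 - w.2) := by
  obtain ⟨C1, hC1, N1, hN1, s1⟩ := cacc_step y (r1 := R * 3 / 4) (r2 := R) (by positivity) (by linarith)
  obtain ⟨C2, hC2, N2, hN2, s2⟩ := cacc_step y (r1 := R / 2) (r2 := R * 3 / 4) (by positivity) (by linarith)
  obtain ⟨C3, hC3, N3, hN3, s3⟩ := cacc_step y (r1 := R / 4) (r2 := R / 2) (by positivity) (by linarith)
  set D1 := C1 * (B ^ 2 * (2 * R + 3) ^ 2) with hD1
  have hD1' : 0 ≤ D1 := by positivity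
  set q := (R / 4 / 2) ^ 2 with hq
  have hqpos : 0 < q := by positivity
  obtain ⟨n, hn⟩ := exists_nat_gt (max (8 / R) (max (C3 * (C2 * D1)) (C2 * D1 / q)))
  refine ⟨D1 / q + 1, by positivity, max (max N1 N2) (max N3 (n + 1)), ?_, fun N hN f hf hfB => ?_⟩
  · exact le_max_of_le_left (le_max_of_le_left hN1)
  simp only [max_le_iff] at hN
  obtain ⟨⟨hNN1, hNN2⟩, hNN3, hNn⟩ := hN
  have hN1' : 1 ≤ N := hN1.trans hNN1
  have hNpos : (0 : ℝ) < N := by exact_mod_cast hN1'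
  have hN1r : (1 : ℝ) ≤ N := by exact_mod_cast hN1'
  have hnN : (n : ℝ) ≤ N := by exact_mod_cast (by omega : n ≤ N)
  rw [max_lt_iff, max_lt_iff] at hn
  have hn1 : 8 / R < N := hn.1.trans_le hnN
  have hn2 : C3 * (C2 * D1) < N := hn.2.1.trans_le hnN
  have hn3 : C2 * D1 / q < N := hn.2.2.trans_le hnN
  have hNsq : (N : ℝ) ≤ (N : ℝ) ^ 2 := by nlinarith
  have b0 : ∑ v ∈ bx N y R, (f v : ℝ) ^ 2 ≤ (B ^ 2 * (2 * R + 3) ^ 2) * N ^ 4 := by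
    have : ∑ v ∈ bx N y R, (f v : ℝ) ^ 2 ≤ ∑ v ∈ bx N y R, (B * N) ^ 2 :=
      Finset.sum_le_sum fun v _ => by
        rw [← sq_abs]; exact pow_le_pow_left₀ (abs_nonneg _) (hfB v) 2
    rw [Finset.sum_const, nsmul_eq_mul] at this
    refine this.trans ?_
    have h5 := mul_le_mul_of_nonneg_right (card_bx_le hN1' y hR) (sq_nonneg (B * N))
    refine h5.trans (le_of_eq (by ring))
  have b1 : ∀ e, Unit2 e → (∀ v ∈ bx N y (R * 3 / 4), lap (Dz e f) v = 0) ∧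
      ∑ v ∈ bx N y (R * 3 / 4), (Dz e f v : ℝ) ^ 2 ≤ D1 * N ^ 2 := by
    intro e he
    obtain ⟨t1, t2⟩ := s1 N hNN1 f hf e he
    refine ⟨t1, t2.trans ?_⟩
    have := mul_le_mul_of_nonneg_left b0 (by positivity : 0 ≤ C1 / (N : ℝ) ^ 2)
    refine this.trans (le_of_eq ?_)
    rw [hD1]; field_simp
  have b2 : ∀ e, Unit2 e → ∀ e', Unit2 e' → (∀ v ∈ bx N y (R / 2), lap (Dz e' (Dz e f)) v = 0) ∧
      ∑ v ∈ bx N y (R / 2), (Dz e' (Dz e f) v : ℝ) ^ 2 ≤ C2 * D1 := by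
    intro e he e' he'
    obtain ⟨u1, u2⟩ := b1 e he
    obtain ⟨t1, t2⟩ := s2 N hNN2 _ u1 e' he'
    refine ⟨t1, t2.trans ?_⟩
    have := mul_le_mul_of_nonneg_left u2 (by positivity : 0 ≤ C2 / (N : ℝ) ^ 2)
    refine this.trans (le_of_eq ?_)
    field_simp
  have b3 : ∀ e, Unit2 e → ∀ e', Unit2 e' → ∀ e'', Unit2 e'' → ∀ v ∈ bx N y (R / 4),
      Dz e'' (Dz e' (Dz e f)) v = 0 := by
    intro e he e' he' e'' he''
    obtain ⟨u1, u2⟩ := b2 e he e' he'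
    obtain ⟨t1, t2⟩ := s3 N hNN3 _ u1 e'' he''
    apply sq_int_zero
    refine t2.trans_lt ?_
    have := mul_le_mul_of_nonneg_left u2 (by positivity : 0 ≤ C3 / (N : ℝ) ^ 2)
    refine this.trans_lt ?_
    rw [div_mul_eq_mul_div, div_lt_one (by positivity)]
    linarith
  have hU1 : Unit2 (1, 0) := Or.inl rfl
  have hU2 : Unit2 (0, 1) := Or.inr rfl
  have hcard := card_bx_ge hN1' y (r := R / 4) (by positivity) (by
    rw [div_lt_iff₀ hR] at hn1; linarith)
  have hcpos : (0 : ℝ) < (bx N y (R / 4)).card := lt_of_lt_of_le (by positivity) hcard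
  obtain ⟨w0, hw0⟩ : (bx N y (R / 4)).Nonempty := by
    rw [← Finset.card_pos]; exact_mod_cast hcpos
  -- an integer function constant on the box with controlled square sum
  have const : ∀ g : V → ℤ, (∀ e, Unit2 e → ∀ v ∈ bx N y (R / 4), Dz e g v = 0) →
      ∀ v ∈ bx N y (R / 4), g v = g w0 := by
    intro g hg v hv
    have := lin_box hN1' g 0 0 (hg _ hU1) (hg _ hU2) v hv w0 hw0
    linarith
  have avg : ∀ g : V → ℤ, (∀ v ∈ bx N y (R / 4), g v = g w0) → ∀ S : ℝ,
      ∑ v ∈ bx N y (R / 4), (g v : ℝ) ^ 2 ≤ S → (g w0 : ℝ) ^ 2 * (q * N ^ 2) ≤ S := by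
    intro g hg S hS
    rw [Finset.sum_congr rfl (fun v hv => by rw [hg v hv]), Finset.sum_const, nsmul_eq_mul] at hS
    refine le_trans ?_ hS
    rw [mul_comm]
    exact mul_le_mul_of_nonneg_right hcard (sq_nonneg _)
  have d2 : ∀ e, Unit2 e → ∀ e', Unit2 e' → ∀ v ∈ bx N y (R / 4), Dz e' (Dz e f) v = 0 := by
    intro e he e' he' v hv
    have c := const _ (b3 e he e' he')
    rw [c v hv]
    have hs : ∑ v ∈ bx N y (R / 4), (Dz e' (Dz e f) v : ℝ) ^ 2 ≤ C2 * D1 :=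
      (Finset.sum_le_sum_of_subset_of_nonneg (bx_mono hN1' (by linarith)) fun _ _ _ => sq_nonneg _).trans
        (b2 e he e' he').2
    have a := avg _ c _ hs
    by_contra hc
    have h1 : (1 : ℝ) ≤ (Dz e' (Dz e f) w0 : ℝ) ^ 2 := by
      have := sq_pos_of_ne_zero hc
      exact_mod_cast this
    have h2 : q * N ^ 2 ≤ C2 * D1 := le_trans (by nlinarith [mul_pos hqpos (pow_pos hNpos 2)]) a
    rw [div_lt_iff₀ hqpos] at hn3
    nlinarith
  have d1 : ∀ e, Unit2 e → (∀ v ∈ bx N y (R / 4), Dz e f v = Dz e f w0) ∧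
      |(Dz e f w0 : ℝ)| ≤ D1 / q + 1 := by
    intro e he
    have c := const _ (d2 e he)
    refine ⟨c, ?_⟩
    have hs : ∑ v ∈ bx N y (R / 4), (Dz e f v : ℝ) ^ 2 ≤ D1 * N ^ 2 :=
      (Finset.sum_le_sum_of_subset_of_nonneg (bx_mono hN1' (by linarith)) fun _ _ _ => sq_nonneg _).trans
        (b1 e he).2
    have a := avg _ c _ hs
    have a' : (Dz e f w0 : ℝ) ^ 2 ≤ D1 / q := by
      rw [le_div_iff₀ hqpos]
      have hp := pow_pos hNpos 2
      have : (Dz e f w0 : ℝ) ^ 2 * q * (N : ℝ) ^ 2 ≤ D1 * N ^ 2 := by linarith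
      exact le_of_mul_le_mul_right this hp
    have : |(Dz e f w0 : ℝ)| ^ 2 ≤ D1 / q := by rwa [sq_abs]
    nlinarith [sq_nonneg (|(Dz e f w0 : ℝ)| - 1), abs_nonneg (Dz e f w0 : ℝ)]
  exact ⟨Dz (1, 0) f w0, Dz (0, 1) f w0, (d1 _ hU1).2, (d1 _ hU2).2,
    lin_box hN1' f _ _ (d1 _ hU1).1 (d1 _ hU2).1⟩

/-- everything we use about the sequence of odometers -/
structure Dat (Ω : Set (ℝ × ℝ)) (P : Finset (ℝ × ℝ)) (φ f : ℕ → V → ℤ) (E : Finset Seg) :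
    Prop where
  hΩ : IsLatticePolygon Ω
  hPΩ : (↑P : Set (ℝ × ℝ)) ⊆ interior Ω
  odo : ∀ N, Odo Ω P N (f N)
  phi : ∀ N, ∀ v ∈ latGrid Ω N, φ N v = 3 + cnt P N v + lap (f N) v
  dev : ∀ y ∈ interior Ω, y ∉ gsupp E → ∃ r : ℝ, 0 < r ∧ ∀ᶠ N in atTop, ∀ v ∈ latGrid Ω N,
    dist (sc N v) y < r → 3 ≤ φ N v

theorem dat_of {Ω : Set (ℝ × ℝ)} (hΩ : IsLatticePolygon Ω)
    {P : Finset (ℝ × ℝ)} (hPΩ : ↑P ⊆ interior Ω)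
    {φ : ℕ → V → ℤ} (hφ : ∀ N : ℕ, Relaxes (latGrid Ω N) (stateN Ω P N) (φ N))
    {Ctil : Set (ℝ × ℝ)} (hCcl : IsClosed Ctil)
    (hC : Filter.Tendsto (fun N => Metric.hausdorffEDist (devSet Ω N (φ N)) Ctil)
      Filter.atTop (nhds 0))
    {E : Finset Seg}
    (hSupp : gsupp E = closure (Ctil ∩ interior Ω))
    {FN : ℕ → V → ℤ}
    (hFN : ∀ (N : ℕ) (v : V),
      IsLeast {n : ℤ | ∃ H : V → ℤ, Odometer (latGrid Ω N) (stateN Ω P N) H ∧ H v = n}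
        (FN N v)) : Dat Ω P φ FN E := by
  refine ⟨hΩ, hPΩ, fun N => (odo_of (hφ N) (hFN N)).1, fun N => (odo_of (hφ N) (hFN N)).2, ?_⟩
  intro y hy hyE
  have hyC : y ∉ Ctil := fun h => hyE (by rw [hSupp]; exact subset_closure ⟨h, hy⟩)
  obtain ⟨r, hr, hball⟩ := Metric.isOpen_iff.1 hCcl.isOpen_compl y hyC
  have hev : ∀ᶠ N in atTop, Metric.hausdorffEDist (devSet Ω N (φ N)) Ctil < ENNReal.ofReal (r / 2) :=
    hC.eventually (gt_mem_nhds (by simpa using hr))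
  refine ⟨r / 2, by positivity, ?_⟩
  filter_upwards [hev] with N hN v hv hd
  by_contra hcon
  push Not at hcon
  have hm : sc N v ∈ devSet Ω N (φ N) := ⟨v, hv, hcon, rfl⟩
  obtain ⟨c, hc, hcd⟩ := Metric.exists_edist_lt_of_hausdorffEDist_lt hm hN
  rw [edist_lt_ofReal] at hcd
  refine hball ?_ hc
  rw [Metric.mem_ball]
  have := dist_triangle c (sc N v) y
  rw [dist_comm] at hcd
  linarith

/-- the good set -/
def Good (Ω : Set (ℝ × ℝ)) (P : Finset (ℝ × ℝ)) (E : Finset Seg) : Set (ℝ × ℝ) :=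
  {y | y ∈ interior Ω ∧ y ∉ gsupp E ∧ y ∉ P}

theorem isClosed_gsupp (E : Finset Seg) : IsClosed (gsupp E) := by
  unfold gsupp
  refine Set.Finite.isClosed_biUnion E.finite_toSet fun e _ => ?_
  have : IsCompact (segment ℝ e.1 e.2) := by
    rw [← convexHull_pair]
    exact Set.Finite.isCompact_convexHull ℝ (by simp)
  exact this.isClosed

theorem isOpen_good (Ω : Set (ℝ × ℝ)) (P : Finset (ℝ × ℝ)) (E : Finset Seg) :
    IsOpen (Good Ω P E) := by
  have : Good Ω P E = interior Ω ∩ ((gsupp E)ᶜ ∩ (↑P : Set (ℝ × ℝ))ᶜ) := by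
    ext y; simp [Good]; tauto
  rw [this]
  exact isOpen_interior.inter ((isClosed_gsupp E).isOpen_compl.inter
    P.finite_toSet.isClosed.isOpen_compl)

theorem eventually_inv_lt {r : ℝ} (hr : 0 < r) : ∀ᶠ N : ℕ in atTop, 1 ≤ N ∧ 1 / (N : ℝ) < r := by
  have h1 : Tendsto (fun N : ℕ => 1 / (N : ℝ)) atTop (𝓝 0) := tendsto_one_div_atTop_nhds_zero_nat
  filter_upwards [eventually_ge_atTop 1, h1.eventually (gt_mem_nhds hr)] with N h1 h2
  exact ⟨h1, h2⟩

namespace Dat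
variable {Ω : Set (ℝ × ℝ)} {P : Finset (ℝ × ℝ)} {φ f : ℕ → V → ℤ} {E : Finset Seg}

theorem bound (h : Dat Ω P φ f E) : ∃ B : ℝ, 0 < B ∧ ∀ N, 1 ≤ N → ∀ v, |(f N v : ℝ)| ≤ B * N := by
  obtain ⟨B, hB, hh⟩ := global_bound h.hΩ h.hPΩ
  refine ⟨B, hB, fun N hN v => ?_⟩
  rw [abs_of_nonneg (by exact_mod_cast (h.odo N).nonneg v)]
  exact hh N hN _ (h.odo N) v

theorem harmonic (h : Dat Ω P φ f E) {y : ℝ × ℝ} (hy : y ∈ Good Ω P E) :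
    ∃ r : ℝ, 0 < r ∧ ∀ᶠ N in atTop, ∀ v, dist (sc N v) y < r → lap (f N) v = 0 := by
  obtain ⟨hyi, hyE, hyP⟩ := hy
  obtain ⟨r1, hr1, h1⟩ := h.dev y hyi hyE
  obtain ⟨r2, hr2, h2⟩ := Metric.isOpen_iff.1 isOpen_interior y hyi
  obtain ⟨r3, hr3, h3⟩ := Metric.isOpen_iff.1 P.finite_toSet.isClosed.isOpen_compl y hyP
  refine ⟨min r1 (min r2 (r3 / 2)), by positivity, ?_⟩
  filter_upwards [h1, eventually_inv_lt (half_pos hr3)] with N hN hN1 v hv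
  rw [lt_min_iff, lt_min_iff] at hv
  have hvΩ : v ∈ latGrid Ω N := by
    rw [mem_latGrid hN1.1]
    exact interior_subset (h2 hv.2.1)
  have hc : cnt P N v = 0 := by
    unfold cnt
    refine Finset.sum_eq_zero fun p hp => ?_
    rw [if_neg]
    rintro rfl
    have h5 := dist_sc_flr hN1.1 p
    have : p ∈ Metric.ball y r3 := by
      rw [Metric.mem_ball]
      have := dist_triangle p (sc N (flr N p)) y
      rw [dist_comm] at h5
      linarith [hN1.2, hv.2.2]
    exact h3 this hp
  have h6 := hN v hvΩ hv.1
  rw [h.phi N v hvΩ, hc] at h6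
  have h7 := (h.odo N).lap_le v hvΩ
  rw [hc] at h7
  omega

theorem affine (h : Dat Ω P φ f E) {y : ℝ × ℝ} (hy : y ∈ Good Ω P E) :
    ∃ r K : ℝ, 0 < r ∧ ∀ᶠ N in atTop, ∃ k l : ℤ, |(k : ℝ)| ≤ K ∧ |(l : ℝ)| ≤ K ∧
      ∀ v w : V, dist (sc N v) y < r → dist (sc N w) y < r →
        f N v - f N w = k * (v.1 - w.1) + l * (v.2 - w.2) := by
  obtain ⟨R, hR, h1⟩ := h.harmonic hy
  obtain ⟨B, hB, h2⟩ := h.bound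
  obtain ⟨K, hK, N0, hN0, h3⟩ := local_affine y hR hB
  refine ⟨R / 4, K, by positivity, ?_⟩
  filter_upwards [h1, eventually_ge_atTop N0] with N hN hNN
  have hN1 := hN0.trans hNN
  obtain ⟨k, l, hk, hl, hkl⟩ := h3 N hNN (f N) (fun v hv => hN v ((mem_bx hN1).1 hv)) (h2 N hN1)
  exact ⟨k, l, hk, hl, fun v w hv hw => hkl v ((mem_bx hN1).2 hv) w ((mem_bx hN1).2 hw)⟩

end Dat

/-- the rescaled odometer -/
noncomputable def gN (f : ℕ → V → ℤ) (N : ℕ) (x : ℝ × ℝ) : ℝ := (f N (flr N x) : ℝ) / N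

theorem floor_div_tendsto {M : ℕ → ℕ} (hM : Tendsto M atTop atTop) (t : ℝ) :
    Tendsto (fun j => (⌊(M j : ℝ) * t⌋ : ℝ) / (M j : ℝ)) atTop (𝓝 t) := by
  have h1 : Tendsto (fun N : ℕ => (⌊(N : ℝ) * t⌋ : ℝ) / (N : ℝ)) atTop (𝓝 t) := by
    rw [tendsto_iff_dist_tendsto_zero]
    refine squeeze_zero' (Eventually.of_forall fun _ => dist_nonneg) ?_
      tendsto_one_div_atTop_nhds_zero_nat
    filter_upwards [eventually_ge_atTop 1] with N hN
    have := dist_sc_flr hN (t, t)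
    rw [dist_prod_le] at this
    rw [Real.dist_eq]
    exact this.1
  exact h1.comp hM

theorem exists_rat_near2 (y : ℝ) {r : ℝ} (hr : 0 < r) : ∃ q δ : ℚ, 0 < δ ∧ |(q : ℝ) - y| < r ∧
    |((q + δ : ℚ) : ℝ) - y| < r := by
  obtain ⟨q, h1, h2⟩ := exists_rat_btwn (by linarith : y - r < y)
  obtain ⟨q', h3, h4⟩ := exists_rat_btwn (by linarith : y < y + r)
  refine ⟨q, q' - q, ?_, ?_, ?_⟩
  · have : (q : ℝ) < q' := h2.trans h3
    have : q < q' := by exact_mod_cast this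
    linarith
  · rw [abs_lt]; constructor <;> linarith
  · rw [add_sub_cancel, abs_lt]; constructor <;> linarith

namespace Dat
variable {Ω : Set (ℝ × ℝ)} {P : Finset (ℝ × ℝ)} {φ f : ℕ → V → ℤ} {E : Finset Seg}

theorem gN_bound (h : Dat Ω P φ f E) : ∃ B : ℝ, 0 < B ∧ ∀ N x, |gN f N x| ≤ B := by
  obtain ⟨B, hB, hb⟩ := h.bound
  refine ⟨B, hB, fun N x => ?_⟩
  unfold gN
  rcases Nat.eq_zero_or_pos N with h0 | h0
  · simp [h0, hB.le]
  · have hN : (0 : ℝ) < N := by exact_mod_cast h0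
    rw [abs_div, abs_of_pos hN, div_le_iff₀ hN]
    exact hb N h0 _

theorem sub_limit (h : Dat Ω P φ f E) {M : ℕ → ℕ} (hM : Tendsto M atTop atTop)
    (hq : ∀ q : ℚ × ℚ, ∃ c, Tendsto (fun j => gN f (M j) ((q.1 : ℝ), (q.2 : ℝ))) atTop (𝓝 c))
    {y : ℝ × ℝ} (hy : y ∈ Good Ω P E) : ∃ r : ℝ, 0 < r ∧ ∃ a b c : ℝ, ∀ x ∈ Metric.ball y r,
      Tendsto (fun j => gN f (M j) x) atTop (𝓝 (a * x.1 + b * x.2 + c)) := by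
  obtain ⟨r, K, hr, hA⟩ := h.affine hy
  obtain ⟨q1, δ1, hδ1, hq1, hq1'⟩ := exists_rat_near2 y.1 (half_pos hr)
  obtain ⟨q2, δ2, hδ2, hq2, hq2'⟩ := exists_rat_near2 y.2 (half_pos hr)
  obtain ⟨c0, hc0⟩ := hq (q1, q2)
  obtain ⟨c1, hc1⟩ := hq (q1 + δ1, q2)
  obtain ⟨c2, hc2⟩ := hq (q1, q2 + δ2)
  simp only at hc0 hc1 hc2
  have hδ1r : (0 : ℝ) < δ1 := by exact_mod_cast hδ1
  have hδ2r : (0 : ℝ) < δ2 := by exact_mod_cast hδ2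
  have hev : ∀ᶠ N : ℕ in atTop, (1 ≤ N ∧ 1 / (N : ℝ) < r / 2) ∧ ∃ k l : ℤ, |(k : ℝ)| ≤ K ∧ |(l : ℝ)| ≤ K ∧
      ∀ v w : V, dist (sc N v) y < r → dist (sc N w) y < r →
        f N v - f N w = k * (v.1 - w.1) + l * (v.2 - w.2) :=
    (eventually_inv_lt (half_pos hr)).and hA
  -- formulate for points
  have hev2 : ∀ᶠ j in atTop, ∃ k l : ℝ, ∀ x ∈ Metric.ball y (r / 2), ∀ x' ∈ Metric.ball y (r / 2),
      gN f (M j) x - gN f (M j) x' =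
        k * ((⌊(M j : ℝ) * x.1⌋ : ℝ) / (M j : ℝ) - (⌊(M j : ℝ) * x'.1⌋ : ℝ) / (M j : ℝ)) +
        l * ((⌊(M j : ℝ) * x.2⌋ : ℝ) / (M j : ℝ) - (⌊(M j : ℝ) * x'.2⌋ : ℝ) / (M j : ℝ)) := by
    filter_upwards [hM.eventually hev] with j hj
    obtain ⟨⟨hN1, hN2⟩, k, l, _, _, hkl⟩ := hj
    refine ⟨k, l, fun x hx x' hx' => ?_⟩
    have hd : ∀ x ∈ Metric.ball y (r / 2), dist (sc (M j) (flr (M j) x)) y < r := by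
      intro x hx
      rw [Metric.mem_ball] at hx
      have := dist_triangle (sc (M j) (flr (M j) x)) x y
      have := dist_sc_flr hN1 x
      linarith
    have e := hkl _ _ (hd x hx) (hd x' hx')
    have e' : (f (M j) (flr (M j) x) : ℝ) - f (M j) (flr (M j) x') =
        k * ((flr (M j) x).1 - (flr (M j) x').1) + l * ((flr (M j) x).2 - (flr (M j) x').2) := by
      exact_mod_cast e
    unfold gN
    rw [← sub_div, e']
    simp only [flr]
    ring
  have hk : ∀ j, ∃ k l : ℝ, (∃ k l : ℝ, ∀ x ∈ Metric.ball y (r / 2), ∀ x' ∈ Metric.ball y (r / 2),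
      gN f (M j) x - gN f (M j) x' =
        k * ((⌊(M j : ℝ) * x.1⌋ : ℝ) / (M j : ℝ) - (⌊(M j : ℝ) * x'.1⌋ : ℝ) / (M j : ℝ)) +
        l * ((⌊(M j : ℝ) * x.2⌋ : ℝ) / (M j : ℝ) - (⌊(M j : ℝ) * x'.2⌋ : ℝ) / (M j : ℝ))) →
      (∀ x ∈ Metric.ball y (r / 2), ∀ x' ∈ Metric.ball y (r / 2),
      gN f (M j) x - gN f (M j) x' =
        k * ((⌊(M j : ℝ) * x.1⌋ : ℝ) / (M j : ℝ) - (⌊(M j : ℝ) * x'.1⌋ : ℝ) / (M j : ℝ)) +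
        l * ((⌊(M j : ℝ) * x.2⌋ : ℝ) / (M j : ℝ) - (⌊(M j : ℝ) * x'.2⌋ : ℝ) / (M j : ℝ))) := by
    intro j
    by_cases hc : ∃ k l : ℝ, ∀ x ∈ Metric.ball y (r / 2), ∀ x' ∈ Metric.ball y (r / 2),
      gN f (M j) x - gN f (M j) x' =
        k * ((⌊(M j : ℝ) * x.1⌋ : ℝ) / (M j : ℝ) - (⌊(M j : ℝ) * x'.1⌋ : ℝ) / (M j : ℝ)) +
        l * ((⌊(M j : ℝ) * x.2⌋ : ℝ) / (M j : ℝ) - (⌊(M j : ℝ) * x'.2⌋ : ℝ) / (M j : ℝ))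
    · obtain ⟨k, l, hh⟩ := hc
      exact ⟨k, l, fun _ => hh⟩
    · exact ⟨0, 0, fun hh => absurd hh hc⟩
  choose k l hkl using hk
  have hkl' : ∀ᶠ j in atTop, ∀ x ∈ Metric.ball y (r / 2), ∀ x' ∈ Metric.ball y (r / 2),
      gN f (M j) x - gN f (M j) x' =
        k j * ((⌊(M j : ℝ) * x.1⌋ : ℝ) / (M j : ℝ) - (⌊(M j : ℝ) * x'.1⌋ : ℝ) / (M j : ℝ)) +
        l j * ((⌊(M j : ℝ) * x.2⌋ : ℝ) / (M j : ℝ) - (⌊(M j : ℝ) * x'.2⌋ : ℝ) / (M j : ℝ)) :=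
    hev2.mono fun j hj => hkl j hj
  have m0 : ((q1 : ℝ), (q2 : ℝ)) ∈ Metric.ball y (r / 2) := Metric.mem_ball.2 (dist_prod_lt.2 ⟨hq1, hq2⟩)
  have m1 : (((q1 + δ1 : ℚ) : ℝ), (q2 : ℝ)) ∈ Metric.ball y (r / 2) :=
    Metric.mem_ball.2 (dist_prod_lt.2 ⟨hq1', hq2⟩)
  have m2 : ((q1 : ℝ), ((q2 + δ2 : ℚ) : ℝ)) ∈ Metric.ball y (r / 2) :=
    Metric.mem_ball.2 (dist_prod_lt.2 ⟨hq1, hq2'⟩)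
  have fl := floor_div_tendsto hM
  have t1 : Tendsto k atTop (𝓝 ((c1 - c0) / (((q1 + δ1 : ℚ) : ℝ) - q1))) := by
    have hne : ((q1 + δ1 : ℚ) : ℝ) - q1 ≠ 0 := by push_cast; linarith
    have hden := (fl ((q1 + δ1 : ℚ) : ℝ)).sub (fl (q1 : ℝ))
    refine ((hc1.sub hc0).div hden hne).congr' ?_
    filter_upwards [hkl', hden.eventually_ne hne] with j hj hj0
    have := hj _ m1 _ m0
    simp only [sub_self, mul_zero, add_zero] at this
    rw [Pi.div_apply, this]
    exact mul_div_cancel_right₀ _ hj0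
  have t2 : Tendsto l atTop (𝓝 ((c2 - c0) / (((q2 + δ2 : ℚ) : ℝ) - q2))) := by
    have hne : ((q2 + δ2 : ℚ) : ℝ) - q2 ≠ 0 := by push_cast; linarith
    have hden := (fl ((q2 + δ2 : ℚ) : ℝ)).sub (fl (q2 : ℝ))
    refine ((hc2.sub hc0).div hden hne).congr' ?_
    filter_upwards [hkl', hden.eventually_ne hne] with j hj hj0
    have := hj _ m2 _ m0
    simp only [sub_self, mul_zero, zero_add] at this
    rw [Pi.div_apply, this]
    exact mul_div_cancel_right₀ _ hj0
  set a := (c1 - c0) / (((q1 + δ1 : ℚ) : ℝ) - q1)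
  set b := (c2 - c0) / (((q2 + δ2 : ℚ) : ℝ) - q2)
  refine ⟨r / 2, half_pos hr, a, b, c0 - a * q1 - b * q2, fun x hx => ?_⟩
  have t3 := ((t1.mul ((fl x.1).sub (fl q1))).add (t2.mul ((fl x.2).sub (fl q2)))).add hc0
  have e : a * (x.1 - q1) + b * (x.2 - q2) + c0 = a * x.1 + b * x.2 + (c0 - a * q1 - b * q2) := by
    ring
  rw [e] at t3
  refine t3.congr' ?_
  filter_upwards [hkl'] with j hj
  have := hj _ hx _ m0
  simp only at this
  linarith

theorem exists_sub (h : Dat Ω P φ f E) {ns : ℕ → ℕ} (hns : Tendsto ns atTop atTop) :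
    ∃ ms : ℕ → ℕ, Tendsto ms atTop atTop ∧ ∃ u : ℝ × ℝ → ℝ,
      (∀ y ∈ Good Ω P E, Tendsto (fun j => gN f (ns (ms j)) y) atTop (𝓝 (u y))) ∧
      ∀ y ∈ Good Ω P E, ∃ r : ℝ, 0 < r ∧ ∃ a b c : ℝ, ∀ x ∈ Metric.ball y r,
        u x = a * x.1 + b * x.2 + c := by
  obtain ⟨B, hB, hb⟩ := h.gN_bound
  have hcomp : IsCompact (Set.univ.pi fun _ : ℚ × ℚ => Set.Icc (-B) B) :=
    isCompact_univ_pi fun _ => isCompact_Icc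
  obtain ⟨c, _, ms, hms, hlim⟩ := hcomp.tendsto_subseq
    (x := fun j => fun q : ℚ × ℚ => gN f (ns j) ((q.1 : ℝ), (q.2 : ℝ)))
    (fun j q _ => abs_le.1 (hb _ _))
  have hM : Tendsto (fun j => ns (ms j)) atTop atTop := hns.comp hms.tendsto_atTop
  have hq : ∀ q : ℚ × ℚ, ∃ c, Tendsto (fun j => gN f (ns (ms j)) ((q.1 : ℝ), (q.2 : ℝ))) atTop
      (𝓝 c) := fun q => ⟨c q, tendsto_pi_nhds.1 hlim q⟩
  have key := fun y hy => h.sub_limit hM hq (y := y) hy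
  refine ⟨ms, hms.tendsto_atTop, fun x => limUnder atTop fun j => gN f (ns (ms j)) x, ?_, ?_⟩
  · intro y hy
    obtain ⟨r, hr, a, b, c, hx⟩ := key y hy
    exact tendsto_nhds_limUnder ⟨_, hx y (Metric.mem_ball_self hr)⟩
  · intro y hy
    obtain ⟨r, hr, a, b, c, hx⟩ := key y hy
    exact ⟨r, hr, a, b, c, fun x hxx => (hx x hxx).limUnder_eq⟩

end Dat

theorem seg_null (e : Seg) : MeasureTheory.volume (seg e) = 0 := by
  have h1 : affineSpan ℝ ({e.1, e.2} : Set (ℝ × ℝ)) ≠ ⊤ := by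
    intro h
    have h2 : Module.finrank ℝ (vectorSpan ℝ ({e.1, e.2} : Set (ℝ × ℝ))) ≤ 1 :=
      collinear_iff_finrank_le_one.1 (collinear_pair ℝ _ _)
    rw [← direction_affineSpan, h, AffineSubspace.direction_top, finrank_top] at h2
    simp at h2
  refine MeasureTheory.measure_mono_null ?_ (MeasureTheory.Measure.addHaar_affineSubspace _ _ h1)
  unfold seg
  rw [← convexHull_pair]
  exact convexHull_subset_affineSpan _

theorem gsupp_null (E : Finset Seg) : MeasureTheory.volume (gsupp E) = 0 := by
  unfold gsupp
  exact (MeasureTheory.measure_biUnion_null_iff E.countable_toSet).2 fun e _ => seg_null e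

theorem bad_null (E : Finset Seg) (P : Finset (ℝ × ℝ)) :
    MeasureTheory.volume (gsupp E ∪ (↑P : Set (ℝ × ℝ))) = 0 :=
  MeasureTheory.measure_union_null (gsupp_null E) (P.countable_toSet.measure_zero _)

theorem good_dense (Ω : Set (ℝ × ℝ)) (P : Finset (ℝ × ℝ)) (E : Finset Seg) {U : Set (ℝ × ℝ)}
    (hU : IsOpen U) (hUΩ : U ⊆ interior Ω) (hne : U.Nonempty) : (U ∩ Good Ω P E).Nonempty := by
  by_contra hcon
  have hsub : U ⊆ gsupp E ∪ (↑P : Set (ℝ × ℝ)) := by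
    intro x hx
    by_contra hx'
    rw [Set.mem_union, not_or] at hx'
    exact hcon ⟨x, hx, hUΩ hx, hx'.1, by simpa using hx'.2⟩
  have := hU.measure_pos MeasureTheory.volume hne
  exact this.ne' (MeasureTheory.measure_mono_null hsub (bad_null E P))

theorem flr_add1 {N : ℕ} (hN : 1 ≤ N) (x : ℝ × ℝ) :
    flr N (x + ((1 : ℝ) / N) • ((1 : ℝ), (0 : ℝ))) = flr N x + (1, 0) := by
  have h0 : (N : ℝ) ≠ 0 := by positivity
  ext
  · simp only [flr, Prod.fst_add, Prod.smul_fst, smul_eq_mul]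
    rw [← Int.floor_add_one]; congr 1; field_simp
  · simp [flr]

theorem flr_add2 {N : ℕ} (hN : 1 ≤ N) (x : ℝ × ℝ) :
    flr N (x + ((1 : ℝ) / N) • ((0 : ℝ), (1 : ℝ))) = flr N x + (0, 1) := by
  have h0 : (N : ℝ) ≠ 0 := by positivity
  ext
  · simp [flr]
  · simp only [flr, Prod.snd_add, Prod.smul_snd, smul_eq_mul]
    rw [← Int.floor_add_one]; congr 1; field_simp

theorem flr_sub1 {N : ℕ} (hN : 1 ≤ N) (x : ℝ × ℝ) :
    flr N (x - ((1 : ℝ) / N) • ((1 : ℝ), (0 : ℝ))) = flr N x - (1, 0) := by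
  have := flr_add1 hN (x - ((1 : ℝ) / N) • ((1 : ℝ), (0 : ℝ)))
  rw [sub_add_cancel] at this
  rw [this, add_sub_cancel_right]

theorem flr_sub2 {N : ℕ} (hN : 1 ≤ N) (x : ℝ × ℝ) :
    flr N (x - ((1 : ℝ) / N) • ((0 : ℝ), (1 : ℝ))) = flr N x - (0, 1) := by
  have := flr_add2 hN (x - ((1 : ℝ) / N) • ((0 : ℝ), (1 : ℝ)))
  rw [sub_add_cancel] at this
  rw [this, add_sub_cancel_right]

theorem flr_meas (N : ℕ) : Measurable (flr N) := by
  unfold flr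
  fun_prop

theorem shift_int {h ψ : ℝ × ℝ → ℝ} (a : ℝ × ℝ) :
    ∫ x, h (x + a) * ψ x = ∫ x, h x * ψ (x - a) := by
  rw [← MeasureTheory.integral_add_right_eq_self (fun x => h x * ψ (x - a)) a]
  simp

/-- second difference quotient -/
noncomputable def sd (ψ : ℝ × ℝ → ℝ) (N : ℕ) (x : ℝ × ℝ) : ℝ :=
  (ψ (x + ((1 : ℝ) / N) • ((1 : ℝ), (0 : ℝ))) + ψ (x - ((1 : ℝ) / N) • ((1 : ℝ), (0 : ℝ))) - 2 * ψ x)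
      / ((1 : ℝ) / N) ^ 2 +
    (ψ (x + ((1 : ℝ) / N) • ((0 : ℝ), (1 : ℝ))) + ψ (x - ((1 : ℝ) / N) • ((0 : ℝ), (1 : ℝ))) - 2 * ψ x)
      / ((1 : ℝ) / N) ^ 2

theorem int5 {u0 u1 u2 u3 u4 : ℝ × ℝ → ℝ} (c : ℝ) (h0 : MeasureTheory.Integrable u0)
    (h1 : MeasureTheory.Integrable u1) (h2 : MeasureTheory.Integrable u2)
    (h3 : MeasureTheory.Integrable u3) (h4 : MeasureTheory.Integrable u4) :
    ∫ x, (c * u0 x + (u1 x + (u2 x + (u3 x + u4 x)))) =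
      c * (∫ x, u0 x) + ((∫ x, u1 x) + ((∫ x, u2 x) + ((∫ x, u3 x) + ∫ x, u4 x))) := by
  have h34 : MeasureTheory.Integrable (fun x => u3 x + u4 x) := h3.add h4
  have h234 : MeasureTheory.Integrable (fun x => u2 x + (u3 x + u4 x)) := h2.add h34
  have h1234 : MeasureTheory.Integrable (fun x => u1 x + (u2 x + (u3 x + u4 x))) := h1.add h234
  rw [MeasureTheory.integral_add (h0.const_mul c) h1234, MeasureTheory.integral_add h1 h234,
    MeasureTheory.integral_add h2 h34, MeasureTheory.integral_add h3 h4,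
    MeasureTheory.integral_const_mul]

theorem sbp_int {f : V → ℤ} {N : ℕ} (hN : 1 ≤ N) {B : ℝ} (hB : ∀ v, |(f v : ℝ)| ≤ B)
    {ψ : ℝ × ℝ → ℝ} (hψ : Continuous ψ) (hc : HasCompactSupport ψ) :
    ∫ x, (N : ℝ) * (lap f (flr N x) : ℝ) * ψ x = ∫ x, (f (flr N x) : ℝ) / N * sd ψ N x := by
  have hN0 : (N : ℝ) ≠ 0 := by positivity
  set h : ℝ × ℝ → ℝ := fun x => (f (flr N x) : ℝ) with hh
  have hm : Measurable h := by
    have : Measurable (fun v : V => (f v : ℝ)) := Measurable.of_discrete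
    exact this.comp (flr_meas N)
  have hi : MeasureTheory.Integrable ψ := hψ.integrable_of_hasCompactSupport hc
  have I : ∀ a, MeasureTheory.Integrable (fun x => h x * ψ (x - a)) := fun a =>
    (hi.comp_sub_right a).bdd_mul hm.aestronglyMeasurable (c := B)
      (Eventually.of_forall fun x => hB _)
  have I' : ∀ a, MeasureTheory.Integrable (fun x => h x * ψ (x + a)) := fun a => by
    simpa using I (-a)
  have I0 : MeasureTheory.Integrable (fun x => h x * ψ x) := by simpa using I 0
  have J : ∀ a, MeasureTheory.Integrable (fun x => h (x + a) * ψ x) := fun a => by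
    have := (I a).comp_add_right a
    simpa using this
  have J' : ∀ a, MeasureTheory.Integrable (fun x => h (x - a) * ψ x) := fun a => by
    have := J (-a)
    simpa [← sub_eq_add_neg] using this
  have S' : ∀ a, ∫ x, h (x - a) * ψ x = ∫ x, h x * ψ (x + a) := fun a => by
    have := shift_int (h := h) (ψ := ψ) (-a)
    simpa [← sub_eq_add_neg] using this
  set a1 : ℝ × ℝ := ((1 : ℝ) / N) • ((1 : ℝ), (0 : ℝ)) with ha1
  set a2 : ℝ × ℝ := ((1 : ℝ) / N) • ((0 : ℝ), (1 : ℝ)) with ha2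
  have e1 : ∀ x, (N : ℝ) * (lap f (flr N x) : ℝ) * ψ x = N * ((-4) * (h x * ψ x) + (h (x + a1) * ψ x +
      (h (x - a1) * ψ x + (h (x + a2) * ψ x + h (x - a2) * ψ x)))) := by
    intro x
    rw [← lapR_cast, lapR]
    simp only [hh, ha1, ha2, flr_add1 hN, flr_add2 hN, flr_sub1 hN, flr_sub2 hN]
    ring
  have e2 : ∀ x, (f (flr N x) : ℝ) / N * sd ψ N x = N * ((-4) * (h x * ψ x) + (h x * ψ (x - a1) +
      (h x * ψ (x + a1) + (h x * ψ (x - a2) + h x * ψ (x + a2))))) := by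
    intro x
    rw [sd]
    simp only [hh, ← ha1, ← ha2]
    field_simp
    ring
  simp_rw [e1, e2]
  rw [MeasureTheory.integral_const_mul, MeasureTheory.integral_const_mul]
  congr 1
  rw [int5 _ I0 (J a1) (J' a1) (J a2) (J' a2), int5 _ I0 (I a1) (I' a1) (I a2) (I' a2), shift_int,
    shift_int, S', S']

theorem sd_smooth_meas {ψ : ℝ × ℝ → ℝ} (hψ : Continuous ψ) (N : ℕ) : Continuous (sd ψ N) := by
  unfold sd
  fun_prop

theorem dd_zero {ψ : ℝ × ℝ → ℝ} {x : ℝ × ℝ} (hx : x ∉ tsupport ψ) (e : ℝ × ℝ) : dd ψ e x = 0 := by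
  have h1 : (fun y => fderiv ℝ ψ y e) =ᶠ[𝓝 x] fun _ => 0 := by
    have h2 : ∀ᶠ y in 𝓝 x, y ∉ tsupport ψ := (isClosed_tsupport ψ).isOpen_compl.mem_nhds hx
    filter_upwards [h2] with y hy
    rw [fderiv_of_notMem_tsupport ℝ hy]; simp
  unfold dd
  rw [h1.fderiv_eq]
  simp

namespace Dat
variable {Ω : Set (ℝ × ℝ)} {P : Finset (ℝ × ℝ)} {φ f : ℕ → V → ℤ} {E : Finset Seg}

theorem dens (h : Dat Ω P φ f E) {ψ : ℝ × ℝ → ℝ} (hψ : ContDiff ℝ (⊤ : ℕ∞) ψ)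
    (hc : HasCompactSupport ψ) (hs : tsupport ψ ⊆ interior Ω) (hP : ∀ p ∈ P, p ∉ tsupport ψ) :
    ∀ᶠ N in atTop, ∫ x, devDens Ω N (φ N) x * ψ x = -∫ x, gN f N x * sd ψ N x := by
  obtain ⟨ρ, hρ, hth⟩ := IsCompact.exists_thickening_subset_open (s := tsupport ψ)
    (t := interior Ω ∩ (↑P : Set (ℝ × ℝ))ᶜ) hc
    (isOpen_interior.inter P.finite_toSet.isClosed.isOpen_compl)
    (fun x hx => ⟨hs hx, fun hp => hP x hp hx⟩)
  obtain ⟨B, hB, hb⟩ := h.bound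
  filter_upwards [eventually_inv_lt (half_pos hρ)] with N ⟨hN, hN2⟩
  have hN0 : (0 : ℝ) < N := by exact_mod_cast hN
  have key : ∀ x, devDens Ω N (φ N) x * ψ x = -((N : ℝ) * (lap (f N) (flr N x) : ℝ) * ψ x) := by
    intro x
    by_cases hx : x ∈ tsupport ψ
    · have hd := dist_sc_flr hN x
      have h1 : sc N (flr N x) ∈ interior Ω ∩ (↑P : Set (ℝ × ℝ))ᶜ := by
        apply hth
        rw [Metric.mem_thickening_iff]
        exact ⟨x, hx, by linarith⟩
      have hv : flr N x ∈ latGrid Ω N := (mem_latGrid hN _).2 (interior_subset h1.1)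
      have hcnt : cnt P N (flr N x) = 0 := by
        unfold cnt
        refine Finset.sum_eq_zero fun p hp => ?_
        rw [if_neg]
        intro hpe
        have h5 := dist_sc_flr hN p
        rw [← hpe] at h5
        have : p ∈ interior Ω ∩ (↑P : Set (ℝ × ℝ))ᶜ := by
          apply hth
          rw [Metric.mem_thickening_iff]
          refine ⟨x, hx, ?_⟩
          have := dist_triangle p (sc N (flr N x)) x
          rw [dist_comm] at h5
          linarith
        exact this.2 hp
      unfold devDens
      rw [if_pos hv, h.phi N _ hv, hcnt]
      push_cast
      ring
    · have : ψ x = 0 := image_eq_zero_of_notMem_tsupport hx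
      rw [this]; ring
  simp_rw [key]
  rw [MeasureTheory.integral_neg]
  congr 1
  exact sbp_int hN (hb N hN) hψ.continuous hc

theorem weak_lim (h : Dat Ω P φ f E) {m : Seg → ℕ} (hW : WeakLimit Ω φ E m) {M : ℕ → ℕ}
    (hM : Tendsto M atTop atTop) {u : ℝ × ℝ → ℝ}
    (hu : ∀ y ∈ Good Ω P E, Tendsto (fun j => gN f (M j) y) atTop (𝓝 (u y)))
    {ψ : ℝ × ℝ → ℝ} (hψ : ContDiff ℝ (⊤ : ℕ∞) ψ)
    (hc : HasCompactSupport ψ) (hs : tsupport ψ ⊆ interior Ω) (hP : ∀ p ∈ P, p ∉ tsupport ψ) :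
    ∫ x, u x * (dd ψ (1, 0) x + dd ψ (0, 1) x) = -tropPairing E m ψ := by
  have t1 := ((hW ψ ⟨hψ, hs⟩).congr' (h.dens hψ hc hs hP)).comp hM
  obtain ⟨B, hB, hb⟩ := h.gN_bound
  obtain ⟨C1, hC1, hc1⟩ := second_diff_bdd hψ hc (1, 0)
  obtain ⟨C2, hC2, hc2⟩ := second_diff_bdd hψ hc (0, 1)
  set K := Metric.cthickening 1 (tsupport ψ) with hK
  have hKc : IsCompact K := IsCompact.cthickening (s := tsupport ψ) hc
  have hev : ∀ᶠ j in atTop, 1 ≤ M j := hM.eventually (eventually_ge_atTop 1)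
  have hinv : Tendsto (fun j => (1 : ℝ) / (M j : ℝ)) atTop (𝓝 0) :=
    (tendsto_one_div_atTop_nhds_zero_nat (𝕜 := ℝ)).comp hM
  have hpos : ∀ᶠ j in atTop, 0 < (1 : ℝ) / (M j : ℝ) := by
    filter_upwards [hev] with j hj
    have : (0 : ℝ) < M j := by exact_mod_cast hj
    positivity
  have hsd : ∀ x, Tendsto (fun j => sd ψ (M j) x) atTop (𝓝 (dd ψ (1, 0) x + dd ψ (0, 1) x)) := by
    intro x
    exact (second_diff_tendsto hψ (1, 0) x hpos hinv).add (second_diff_tendsto hψ (0, 1) x hpos hinv)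
  have t2 : Tendsto (fun j => ∫ x, gN f (M j) x * sd ψ (M j) x) atTop
      (𝓝 (∫ x, u x * (dd ψ (1, 0) x + dd ψ (0, 1) x))) := by
    refine MeasureTheory.tendsto_integral_filter_of_dominated_convergence
      (K.indicator fun _ => B * (C1 + C2)) ?_ ?_ ?_ ?_
    · refine Eventually.of_forall fun j => ?_
      refine MeasureTheory.AEStronglyMeasurable.mul ?_ (sd_smooth_meas hψ.continuous _).aestronglyMeasurable
      have : Measurable (fun v : V => (f (M j) v : ℝ) / (M j : ℝ)) := Measurable.of_discrete
      exact (this.comp (flr_meas (M j))).aestronglyMeasurable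
    · filter_upwards [hev] with j hj
      refine Eventually.of_forall fun x => ?_
      have hj0 : (1 : ℝ) ≤ M j := by exact_mod_cast hj
      have hjp : 0 < (1 : ℝ) / (M j : ℝ) := by positivity
      have hj1 : (1 : ℝ) / (M j : ℝ) ≤ 1 := by rw [div_le_one (by linarith)]; exact hj0
      by_cases hx : x ∈ K
      · rw [Set.indicator_of_mem hx, norm_mul]
        refine mul_le_mul (hb _ _) ?_ (norm_nonneg _) hB.le
        unfold sd
        refine (norm_add_le _ _).trans (add_le_add ?_ ?_)
        · rw [Real.norm_eq_abs, abs_div, abs_of_nonneg (sq_nonneg ((1 : ℝ) / (M j : ℝ))), div_le_iff₀ (by positivity)]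
          exact hc1 x _ hjp
        · rw [Real.norm_eq_abs, abs_div, abs_of_nonneg (sq_nonneg ((1 : ℝ) / (M j : ℝ))), div_le_iff₀ (by positivity)]
          exact hc2 x _ hjp
      · rw [Set.indicator_of_notMem hx]
        have hz : ∀ a : ℝ × ℝ, dist a x ≤ 1 → ψ a = 0 := by
          intro a ha
          apply image_eq_zero_of_notMem_tsupport
          intro hat
          exact hx (Metric.mem_cthickening_of_dist_le x a 1 _ hat (by rwa [dist_comm]))
        have n1 : ∀ e : ℝ × ℝ, ‖e‖ ≤ 1 → ‖((1 : ℝ) / (M j : ℝ)) • e‖ ≤ 1 := by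
          intro e he
          rw [norm_smul, Real.norm_eq_abs, abs_of_pos hjp]
          nlinarith [norm_nonneg e]
        have a1 := n1 ((1 : ℝ), (0 : ℝ)) (by simp [Prod.norm_def])
        have a2 := n1 ((0 : ℝ), (1 : ℝ)) (by simp [Prod.norm_def])
        have : sd ψ (M j) x = 0 := by
          unfold sd
          have b1 : ψ (x + ((1 : ℝ) / (M j : ℝ)) • ((1 : ℝ), (0 : ℝ))) = 0 := hz _ (by rw [dist_eq_norm, add_sub_cancel_left]; exact a1)
          have b2 : ψ (x - ((1 : ℝ) / (M j : ℝ)) • ((1 : ℝ), (0 : ℝ))) = 0 := hz _ (by rw [dist_comm, dist_eq_norm, sub_sub_cancel]; exact a1)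
          have b3 : ψ (x + ((1 : ℝ) / (M j : ℝ)) • ((0 : ℝ), (1 : ℝ))) = 0 := hz _ (by rw [dist_eq_norm, add_sub_cancel_left]; exact a2)
          have b4 : ψ (x - ((1 : ℝ) / (M j : ℝ)) • ((0 : ℝ), (1 : ℝ))) = 0 := hz _ (by rw [dist_comm, dist_eq_norm, sub_sub_cancel]; exact a2)
          rw [b1, b2, b3, b4, hz x (by simp)]
          simp
        rw [this]; simp
    · rw [MeasureTheory.integrable_indicator_iff hKc.measurableSet]
      exact MeasureTheory.integrableOn_const hKc.measure_lt_top.ne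
    · have hae : ∀ᵐ x : ℝ × ℝ, x ∉ gsupp E ∪ (↑P : Set (ℝ × ℝ)) :=
        MeasureTheory.measure_eq_zero_iff_ae_notMem.1 (bad_null E P)
      filter_upwards [hae] with x hx
      rw [Set.mem_union, not_or] at hx
      by_cases hxt : x ∈ tsupport ψ
      · exact (hu x ⟨hs hxt, hx.1, by simpa using hx.2⟩).mul (hsd x)
      · have h0 := hsd x
        rw [dd_zero hxt, dd_zero hxt] at h0 ⊢
        rw [add_zero] at h0 ⊢
        rw [mul_zero]
        refine squeeze_zero_norm (a := fun j => B * |sd ψ (M j) x|) ?_ ?_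
        · intro j
          rw [norm_mul]
          exact mul_le_mul_of_nonneg_right (hb _ _) (norm_nonneg _)
        · simpa using h0.abs.const_mul B
  have t3 := tendsto_nhds_unique t1 t2.neg
  linarith

end Dat

/-- the chart -/
def Th (x l z : ℝ × ℝ) : ℝ × ℝ := (x.1 + z.1 * l.1 - z.2 * l.2, x.2 + z.1 * l.2 + z.2 * l.1)

/-- squared norm -/
def nq (l : ℝ × ℝ) : ℝ := l.1 ^ 2 + l.2 ^ 2

/-- first coordinate -/
noncomputable def sg (x l y : ℝ × ℝ) : ℝ := (l.1 * (y.1 - x.1) + l.2 * (y.2 - x.2)) / nq l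
/-- second coordinate -/
noncomputable def ta (x l y : ℝ × ℝ) : ℝ := (-l.2 * (y.1 - x.1) + l.1 * (y.2 - x.2)) / nq l

theorem sg_Th {x l : ℝ × ℝ} (hl : nq l ≠ 0) (z : ℝ × ℝ) : sg x l (Th x l z) = z.1 := by
  unfold sg Th
  rw [div_eq_iff hl]; unfold nq; ring

theorem ta_Th {x l : ℝ × ℝ} (hl : nq l ≠ 0) (z : ℝ × ℝ) : ta x l (Th x l z) = z.2 := by
  unfold ta Th
  rw [div_eq_iff hl]; unfold nq; ring

theorem Th_sg {x l : ℝ × ℝ} (hl : nq l ≠ 0) (y : ℝ × ℝ) : Th x l (sg x l y, ta x l y) = y := by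
  unfold sg ta Th
  ext
  · field_simp; unfold nq; ring
  · field_simp; unfold nq; ring

theorem cov {x l : ℝ × ℝ} (hl : 0 < nq l) (g : ℝ × ℝ → ℝ) :
    ∫ y, g y = nq l * ∫ z, g (Th x l z) := by
  let L : (ℝ × ℝ) →L[ℝ] (ℝ × ℝ) := LinearMap.toContinuousLinearMap
    (Matrix.toLin (Module.Basis.finTwoProd ℝ) (Module.Basis.finTwoProd ℝ) !![l.1, -l.2; l.2, l.1])
  have hdet : L.det = nq l := by
    show LinearMap.det (Matrix.toLin (Module.Basis.finTwoProd ℝ) (Module.Basis.finTwoProd ℝ)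
      !![l.1, -l.2; l.2, l.1]) = _
    rw [LinearMap.det_toLin, Matrix.det_fin_two_of]; unfold nq; ring
  have hL : ∀ z, Th x l z = x + L z := by
    intro z
    show _ = x + (Matrix.toLin (Module.Basis.finTwoProd ℝ) (Module.Basis.finTwoProd ℝ)
      !![l.1, -l.2; l.2, l.1]) z
    rw [Matrix.toLin_finTwoProd_apply]
    ext <;> simp [Th] <;> ring
  have hd : ∀ z ∈ (Set.univ : Set (ℝ × ℝ)), HasFDerivWithinAt (Th x l) L Set.univ z := by
    intro z _
    have : HasFDerivAt (fun z => x + L z) L z := L.hasFDerivAt.const_add x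
    have e : Th x l = fun z => x + L z := funext hL
    rw [e]
    exact this.hasFDerivWithinAt
  have hinj : Set.InjOn (Th x l) Set.univ := by
    intro a _ b _ hab
    ext
    · rw [← sg_Th (x := x) hl.ne' a, hab, sg_Th hl.ne']
    · rw [← ta_Th (x := x) hl.ne' a, hab, ta_Th hl.ne']
  have hsurj : Th x l '' Set.univ = Set.univ := by
    rw [Set.image_univ, Set.range_eq_univ]
    exact fun y => ⟨_, Th_sg hl.ne' y⟩
  have := MeasureTheory.integral_image_eq_integral_abs_det_fderiv_smul MeasureTheory.volume
    MeasurableSet.univ hd hinj g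
  rw [hsurj, MeasureTheory.setIntegral_univ, MeasureTheory.setIntegral_univ, hdet,
    abs_of_pos hl] at this
  rw [this]
  simp_rw [smul_eq_mul]
  rw [MeasureTheory.integral_const_mul]

/-- product test function -/
noncomputable def Psi (x l : ℝ × ℝ) (α β : ℝ → ℝ) (y : ℝ × ℝ) : ℝ := α (sg x l y) * β (ta x l y)

theorem sg_fd (x l y : ℝ × ℝ) : HasFDerivAt (sg x l)
    ((nq l)⁻¹ • (l.1 • ContinuousLinearMap.fst ℝ ℝ ℝ + l.2 • ContinuousLinearMap.snd ℝ ℝ ℝ)) y := by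
  have h1 : HasFDerivAt (fun y : ℝ × ℝ => y.1 - x.1) (ContinuousLinearMap.fst ℝ ℝ ℝ) y :=
    (ContinuousLinearMap.fst ℝ ℝ ℝ).hasFDerivAt.sub_const x.1
  have h2 : HasFDerivAt (fun y : ℝ × ℝ => y.2 - x.2) (ContinuousLinearMap.snd ℝ ℝ ℝ) y :=
    (ContinuousLinearMap.snd ℝ ℝ ℝ).hasFDerivAt.sub_const x.2
  have := ((h1.const_mul l.1).add (h2.const_mul l.2)).const_mul (nq l)⁻¹
  refine this.congr_of_eventuallyEq (Eventually.of_forall fun y => ?_)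
  simp only [sg, Pi.add_apply]; ring

theorem ta_eq (x l : ℝ × ℝ) : ta x l = fun y => sg x (-l.2, l.1) y := by
  funext y; simp only [ta, sg, nq]; ring

theorem ta_fd (x l y : ℝ × ℝ) : HasFDerivAt (ta x l)
    ((nq l)⁻¹ • ((-l.2) • ContinuousLinearMap.fst ℝ ℝ ℝ + l.1 • ContinuousLinearMap.snd ℝ ℝ ℝ)) y := by
  have := sg_fd x (-l.2, l.1) y
  rw [ta_eq]
  have e : nq (-l.2, l.1) = nq l := by simp only [nq]; ring
  rwa [e] at this

theorem sg_smooth (x l : ℝ × ℝ) : ContDiff ℝ (⊤ : ℕ∞) (sg x l) := by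
  unfold sg; fun_prop
theorem ta_smooth (x l : ℝ × ℝ) : ContDiff ℝ (⊤ : ℕ∞) (ta x l) := by
  unfold ta; fun_prop

theorem Psi_smooth (x l : ℝ × ℝ) {α β : ℝ → ℝ} (hα : ContDiff ℝ (⊤ : ℕ∞) α)
    (hβ : ContDiff ℝ (⊤ : ℕ∞) β) : ContDiff ℝ (⊤ : ℕ∞) (Psi x l α β) :=
  (hα.comp (sg_smooth x l)).mul (hβ.comp (ta_smooth x l))

theorem deriv_smooth {α : ℝ → ℝ} (hα : ContDiff ℝ (⊤ : ℕ∞) α) : ContDiff ℝ (⊤ : ℕ∞) (deriv α) := by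
  have := hα.iterate_deriv 1
  simpa using this

theorem Psi_fd (x l : ℝ × ℝ) {α β : ℝ → ℝ} (hα : ContDiff ℝ (⊤ : ℕ∞) α)
    (hβ : ContDiff ℝ (⊤ : ℕ∞) β) (y e : ℝ × ℝ) :
    fderiv ℝ (Psi x l α β) y e =
      ((nq l)⁻¹ * (l.1 * e.1 + l.2 * e.2)) * Psi x l (deriv α) β y +
      ((nq l)⁻¹ * (-l.2 * e.1 + l.1 * e.2)) * Psi x l α (deriv β) y := by
  have h1 : HasDerivAt α (deriv α (sg x l y)) (sg x l y) :=
    (hα.differentiable (by simp) _).hasDerivAt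
  have h2 : HasDerivAt β (deriv β (ta x l y)) (ta x l y) :=
    (hβ.differentiable (by simp) _).hasDerivAt
  have := (h1.comp_hasFDerivAt y (sg_fd x l y)).mul (h2.comp_hasFDerivAt y (ta_fd x l y))
  have e1 : Psi x l α β = (α ∘ sg x l) * (β ∘ ta x l) := rfl
  rw [e1, this.fderiv]
  simp [Psi]
  ring

theorem Psi_dd (x l : ℝ × ℝ) {α β : ℝ → ℝ} (hα : ContDiff ℝ (⊤ : ℕ∞) α)
    (hβ : ContDiff ℝ (⊤ : ℕ∞) β) (hl : nq l ≠ 0) (y : ℝ × ℝ) :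
    dd (Psi x l α β) (1, 0) y + dd (Psi x l α β) (0, 1) y =
      (nq l)⁻¹ * (Psi x l (deriv (deriv α)) β y + Psi x l α (deriv (deriv β)) y) := by
  have key : ∀ e : ℝ × ℝ, dd (Psi x l α β) e y =
      ((nq l)⁻¹ * (l.1 * e.1 + l.2 * e.2)) * (((nq l)⁻¹ * (l.1 * e.1 + l.2 * e.2)) * Psi x l (deriv (deriv α)) β y +
      ((nq l)⁻¹ * (-l.2 * e.1 + l.1 * e.2)) * Psi x l (deriv α) (deriv β) y) +
      ((nq l)⁻¹ * (-l.2 * e.1 + l.1 * e.2)) * (((nq l)⁻¹ * (l.1 * e.1 + l.2 * e.2)) * Psi x l (deriv α) (deriv β) y +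
      ((nq l)⁻¹ * (-l.2 * e.1 + l.1 * e.2)) * Psi x l α (deriv (deriv β)) y) := by
    intro e
    unfold dd
    have e1 := funext fun y => Psi_fd x l hα hβ y e
    rw [e1]
    have d1 : DifferentiableAt ℝ (Psi x l (deriv α) β) y :=
      (Psi_smooth x l (deriv_smooth hα) hβ).differentiable (by simp) _
    have d2 : DifferentiableAt ℝ (Psi x l α (deriv β)) y :=
      (Psi_smooth x l hα (deriv_smooth hβ)).differentiable (by simp) _
    have := ((d1.hasFDerivAt.const_mul ((nq l)⁻¹ * (l.1 * e.1 + l.2 * e.2))).add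
      (d2.hasFDerivAt.const_mul ((nq l)⁻¹ * (-l.2 * e.1 + l.1 * e.2))))
    have e2 := this.fderiv
    have e3 : (fun y => (nq l)⁻¹ * (l.1 * e.1 + l.2 * e.2) * Psi x l (deriv α) β y + (nq l)⁻¹ * (-l.2 * e.1 + l.1 * e.2) * Psi x l α (deriv β) y) =
     ((fun y => (nq l)⁻¹ * (l.1 * e.1 + l.2 * e.2) * Psi x l (deriv α) β y) +
        fun y => (nq l)⁻¹ * (-l.2 * e.1 + l.1 * e.2) * Psi x l α (deriv β) y) := rfl
    rw [e3, e2]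
    simp only [ContinuousLinearMap.add_apply, ContinuousLinearMap.smul_apply, smul_eq_mul]
    rw [Psi_fd x l (deriv_smooth hα) hβ y e, Psi_fd x l hα (deriv_smooth hβ) y e]
  rw [key, key]
  field_simp
  unfold nq
  ring

open MeasureTheory (Integrable)

/-- one dimensional test functions -/
structure Tst (α : ℝ → ℝ) : Prop where
  sm : ContDiff ℝ (⊤ : ℕ∞) α
  cs : HasCompactSupport α

namespace Tst
variable {α β : ℝ → ℝ}

theorem der (h : Tst α) : Tst (deriv α) := ⟨deriv_smooth h.sm, h.cs.deriv⟩

theorem idmul (h : Tst α) : Tst (fun t => t * α t) := ⟨contDiff_id.mul h.sm, h.cs.mul_left⟩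

theorem int (h : Tst α) : Integrable α := h.sm.continuous.integrable_of_hasCompactSupport h.cs

theorem c1 (h : Tst α) : ContDiff ℝ 1 α := h.sm.of_le (by exact_mod_cast le_top)

theorem int_deriv (h : Tst α) : ∫ t, deriv α t = 0 := by
  rw [← MeasureTheory.integral_add_compl (measurableSet_Iic (a := (0 : ℝ))) h.der.int, Set.compl_Iic,
    h.cs.integral_Iic_deriv_eq h.c1, h.cs.integral_Ioi_deriv_eq h.c1]
  ring

theorem aux (h : Tst α) : Tst (fun t => t * deriv α t - α t) := ⟨h.der.idmul.sm.sub h.sm, h.der.idmul.cs.sub h.cs⟩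

theorem aux_deriv (h : Tst α) : deriv (fun t => t * deriv α t - α t) = fun t => t * deriv (deriv α) t := by
  funext t
  have d1 := (h.sm.differentiable (by simp) t).hasDerivAt
  have d2 := (h.der.sm.differentiable (by simp) t).hasDerivAt
  have := (((hasDerivAt_id t).mul d2).sub d1).deriv
  have e : (id * deriv α - α) = (fun t => t * deriv α t - α t) := rfl
  rw [e] at this
  rw [this]; simp

theorem int_id_deriv2 (h : Tst α) : ∫ t, t * deriv (deriv α) t = 0 := by
  have := h.aux.int_deriv
  rwa [h.aux_deriv] at this

theorem ioi_deriv2 (h : Tst α) : ∫ t in Set.Ioi (0 : ℝ), deriv (deriv α) t = - deriv α 0 :=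
  h.der.cs.integral_Ioi_deriv_eq h.der.c1 0

theorem ioi_id_deriv2 (h : Tst α) : ∫ t in Set.Ioi (0 : ℝ), t * deriv (deriv α) t = α 0 := by
  have := h.aux.cs.integral_Ioi_deriv_eq h.aux.c1 0
  rw [h.aux_deriv] at this
  rw [this]; simp

end Tst

theorem int_K {α β : ℝ → ℝ} (hα : Tst α) (hβ : Tst β) {K : ℝ → ℝ} (hK : Measurable K)
    (hK1 : ∀ t, |K t| ≤ 1) (a b c : ℝ) :
    Integrable (fun z : ℝ × ℝ => (a + b * z.1 + c * z.2) * K z.2 *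
      (deriv (deriv α) z.1 * β z.2 + α z.1 * deriv (deriv β) z.2)) ∧
    ∫ z : ℝ × ℝ, (a + b * z.1 + c * z.2) * K z.2 *
      (deriv (deriv α) z.1 * β z.2 + α z.1 * deriv (deriv β) z.2) =
      (a * (∫ s, α s) + b * ∫ s, s * α s) * (∫ t, K t * deriv (deriv β) t) +
        c * (∫ s, α s) * ∫ t, K t * (t * deriv (deriv β) t) := by
  have IK : ∀ {g : ℝ → ℝ}, Integrable g → Integrable (fun t => K t * g t) := fun hg =>
    hg.bdd_mul hK.aestronglyMeasurable (c := 1) (Eventually.of_forall hK1)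
  have pr : ∀ {g k : ℝ → ℝ}, Integrable g → Integrable k →
      Integrable (fun z : ℝ × ℝ => g z.1 * k z.2) := fun hg hk => hg.mul_prod hk
  have pi : ∀ (g k : ℝ → ℝ), ∫ z : ℝ × ℝ, g z.1 * k z.2 = (∫ s, g s) * ∫ t, k t := fun g k =>
    MeasureTheory.integral_prod_mul g k
  have p1 := (pr hα.der.der.int (IK hβ.int)).const_mul a
  have p2 := (pr hα.der.der.idmul.int (IK hβ.int)).const_mul b
  have p3 := (pr hα.der.der.int (IK hβ.idmul.int)).const_mul c
  have p4 := (pr hα.int (IK hβ.der.der.int)).const_mul a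
  have p5 := (pr hα.idmul.int (IK hβ.der.der.int)).const_mul b
  have p6 := (pr hα.int (IK hβ.der.der.idmul.int)).const_mul c
  have e : (fun z : ℝ × ℝ => (a + b * z.1 + c * z.2) * K z.2 *
      (deriv (deriv α) z.1 * β z.2 + α z.1 * deriv (deriv β) z.2)) = fun z =>
      a * (deriv (deriv α) z.1 * (K z.2 * β z.2)) + (b * (z.1 * deriv (deriv α) z.1 * (K z.2 * β z.2)) +
      (c * (deriv (deriv α) z.1 * (K z.2 * (z.2 * β z.2))) + (a * (α z.1 * (K z.2 * deriv (deriv β) z.2)) +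
      (b * (z.1 * α z.1 * (K z.2 * deriv (deriv β) z.2)) +
        c * (α z.1 * (K z.2 * (z.2 * deriv (deriv β) z.2))))))) := by
    funext z; ring
  have q5 : Integrable fun z : ℝ × ℝ => (b * (z.1 * α z.1 * (K z.2 * deriv (deriv β) z.2)) +
        c * (α z.1 * (K z.2 * (z.2 * deriv (deriv β) z.2)))) := p5.add p6
  have q4 : Integrable fun z : ℝ × ℝ => (a * (α z.1 * (K z.2 * deriv (deriv β) z.2)) +
      (b * (z.1 * α z.1 * (K z.2 * deriv (deriv β) z.2)) +
        c * (α z.1 * (K z.2 * (z.2 * deriv (deriv β) z.2))))) := p4.add q5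
  have q3 : Integrable fun z : ℝ × ℝ => (c * (deriv (deriv α) z.1 * (K z.2 * (z.2 * β z.2))) + (a * (α z.1 * (K z.2 * deriv (deriv β) z.2)) +
      (b * (z.1 * α z.1 * (K z.2 * deriv (deriv β) z.2)) +
        c * (α z.1 * (K z.2 * (z.2 * deriv (deriv β) z.2)))))) := p3.add q4
  have q2 : Integrable fun z : ℝ × ℝ => (b * (z.1 * deriv (deriv α) z.1 * (K z.2 * β z.2)) +
      (c * (deriv (deriv α) z.1 * (K z.2 * (z.2 * β z.2))) + (a * (α z.1 * (K z.2 * deriv (deriv β) z.2)) +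
      (b * (z.1 * α z.1 * (K z.2 * deriv (deriv β) z.2)) +
        c * (α z.1 * (K z.2 * (z.2 * deriv (deriv β) z.2))))))) := p2.add q3
  rw [e]
  refine ⟨p1.add q2, ?_⟩
  rw [MeasureTheory.integral_add p1 q2, MeasureTheory.integral_add p2 q3,
    MeasureTheory.integral_add p3 q4, MeasureTheory.integral_add p4 q5,
    MeasureTheory.integral_add p5 p6]
  simp only [MeasureTheory.integral_const_mul]
  rw [pi (fun s => deriv (deriv α) s) (fun t => K t * β t),
    pi (fun s => s * deriv (deriv α) s) (fun t => K t * β t),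
    pi (fun s => deriv (deriv α) s) (fun t => K t * (t * β t)),
    pi (fun s => α s) (fun t => K t * deriv (deriv β) t),
    pi (fun s => s * α s) (fun t => K t * deriv (deriv β) t),
    pi (fun s => α s) (fun t => K t * (t * deriv (deriv β) t)), hα.der.int_deriv, hα.int_id_deriv2]
  ring

/-- the jump integral -/
theorem jump_int {α β : ℝ → ℝ} (hα : Tst α) (hβ : Tst β) {w : ℝ × ℝ → ℝ} {a0 b0 c0 a b c : ℝ}
    (hw : ∀ z : ℝ × ℝ, z.2 ≠ 0 → deriv (deriv α) z.1 * β z.2 + α z.1 * deriv (deriv β) z.2 ≠ 0 →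
      w z = (a0 + b0 * z.1 + c0 * z.2) + if 0 < z.2 then a + b * z.1 + c * z.2 else 0) :
    ∫ z : ℝ × ℝ, w z * (deriv (deriv α) z.1 * β z.2 + α z.1 * deriv (deriv β) z.2) =
      c * (∫ s, α s) * β 0 - (a * (∫ s, α s) + b * ∫ s, s * α s) * deriv β 0 := by
  have A := int_K hα hβ (K := fun _ => 1) measurable_const (by simp) a0 b0 c0
  have Bd := int_K hα hβ (K := Set.indicator (Set.Ioi 0) fun _ => 1)
    (measurable_const.indicator measurableSet_Ioi)
    (by intro t; by_cases h : t ∈ Set.Ioi (0 : ℝ) <;> simp [h]) a b c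
  have hae : ∀ᵐ z : ℝ × ℝ, z.2 ≠ 0 := by
    have h0 : MeasureTheory.volume ((Set.univ : Set ℝ) ×ˢ ({0} : Set ℝ)) = 0 := by
      rw [MeasureTheory.Measure.volume_eq_prod, MeasureTheory.Measure.prod_prod]; simp
    have := MeasureTheory.measure_eq_zero_iff_ae_notMem.1 h0
    filter_upwards [this] with z hz h
    exact hz ⟨trivial, h⟩
  have e : ∫ z : ℝ × ℝ, w z * (deriv (deriv α) z.1 * β z.2 + α z.1 * deriv (deriv β) z.2) =
      ∫ z : ℝ × ℝ, ((a0 + b0 * z.1 + c0 * z.2) * 1 *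
      (deriv (deriv α) z.1 * β z.2 + α z.1 * deriv (deriv β) z.2) +
      (a + b * z.1 + c * z.2) * (Set.indicator (Set.Ioi 0) (fun _ => 1) z.2) *
      (deriv (deriv α) z.1 * β z.2 + α z.1 * deriv (deriv β) z.2)) := by
    refine MeasureTheory.integral_congr_ae ?_
    filter_upwards [hae] with z hz
    by_cases h0 : deriv (deriv α) z.1 * β z.2 + α z.1 * deriv (deriv β) z.2 = 0
    · rw [h0]; ring
    · rw [hw z hz h0]
      by_cases h : 0 < z.2
      · rw [if_pos h, Set.indicator_of_mem (show z.2 ∈ Set.Ioi 0 from h)]; ring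
      · rw [if_neg h, Set.indicator_of_notMem (show z.2 ∉ Set.Ioi 0 from h)]; ring
  rw [e, MeasureTheory.integral_add A.1 Bd.1, A.2, Bd.2]
  have i1 : ∀ g : ℝ → ℝ, ∫ t, Set.indicator (Set.Ioi (0 : ℝ)) (fun _ => (1 : ℝ)) t * g t =
      ∫ t in Set.Ioi (0 : ℝ), g t := by
    intro g
    rw [← MeasureTheory.integral_indicator measurableSet_Ioi]
    congr 1
    funext t
    by_cases h : t ∈ Set.Ioi (0 : ℝ)
    · rw [Set.indicator_of_mem h, Set.indicator_of_mem h, one_mul]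
    · rw [Set.indicator_of_notMem h, Set.indicator_of_notMem h, zero_mul]
  rw [i1, i1, hβ.ioi_deriv2, hβ.ioi_id_deriv2]
  simp only [one_mul]
  rw [hβ.der.int_deriv, hβ.int_id_deriv2]
  ring

open MeasureTheory (Integrable)

theorem Th_cont (x l : ℝ × ℝ) : Continuous (Th x l) := by unfold Th; fun_prop

theorem enorm2_sq (l : ℝ × ℝ) : enorm2 l * enorm2 l = nq l := by
  unfold enorm2 nq
  exact Real.mul_self_sqrt (by positivity)

theorem enorm2_smul {t : ℝ} (ht : 0 < t) (l : ℝ × ℝ) : enorm2 (t • l) = t * enorm2 l := by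
  unfold enorm2
  have : (t • l).1 ^ 2 + (t • l).2 ^ 2 = t ^ 2 * (l.1 ^ 2 + l.2 ^ 2) := by
    simp; ring
  rw [this, Real.sqrt_mul (sq_nonneg t), Real.sqrt_sq ht.le]

theorem Psi_tsupport {x l : ℝ × ℝ} {α β : ℝ → ℝ} {ε : ℝ} (hα : tsupport α ⊆ Set.Icc (-ε) ε)
    (hβ : tsupport β ⊆ Set.Icc (-ε) ε) (hl : nq l ≠ 0) :
    tsupport (Psi x l α β) ⊆ Th x l '' (Set.Icc (-ε) ε ×ˢ Set.Icc (-ε) ε) := by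
  have hcl : IsClosed (Th x l '' (Set.Icc (-ε) ε ×ˢ Set.Icc (-ε) ε)) :=
    ((isCompact_Icc.prod isCompact_Icc).image (Th_cont x l)).isClosed
  refine closure_minimal ?_ hcl
  intro y hy
  rw [Function.mem_support] at hy
  unfold Psi at hy
  refine ⟨(sg x l y, ta x l y), ⟨?_, ?_⟩, Th_sg hl y⟩
  · exact hα (subset_tsupport _ (left_ne_zero_of_mul hy))
  · exact hβ (subset_tsupport _ (right_ne_zero_of_mul hy))

theorem pairing_Psi {E : Finset Seg} {m : Seg → ℕ} {e : Seg} (he : e ∈ E) {l : ℝ × ℝ} {τ t0 ε : ℝ}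
    (hlp : toR (prim (e.2 - e.1)) = l) (hd : e.2 - e.1 = τ • l) (hτ : 0 < τ) {x : ℝ × ℝ}
    (hx : x = e.1 + t0 • (e.2 - e.1)) (h1 : ε < τ * t0) (h2 : ε < τ * (1 - t0)) (hl : nq l ≠ 0)
    (hoth : ∀ e' ∈ E, e' ≠ e → ∀ z ∈ Set.Icc (-ε) ε ×ˢ Set.Icc (-ε) ε, Th x l z ∉ seg e')
    {α β : ℝ → ℝ} (hα : tsupport α ⊆ Set.Icc (-ε) ε)
    (hβ : tsupport β ⊆ Set.Icc (-ε) ε) :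
    tropPairing E m (Psi x l α β) = nq l * m e * β 0 * ∫ s, α s := by
  unfold tropPairing
  rw [Finset.sum_eq_single e]
  · unfold segInt
    rw [hlp]
    have e1 : ∀ t : ℝ, Psi x l α β (e.1 + t • (e.2 - e.1)) = α (τ * t - τ * t0) * β 0 := by
      intro t
      have : e.1 + t • (e.2 - e.1) = Th x l (τ * t - τ * t0, 0) := by
        rw [hx, hd]
        ext <;> simp [Th] <;> ring
      rw [this]
      unfold Psi
      rw [sg_Th hl, ta_Th hl]
    simp_rw [e1]
    rw [intervalIntegral.integral_mul_const,
      intervalIntegral.integral_comp_mul_sub (fun s => α s) hτ.ne' (τ * t0),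
      intervalIntegral.integral_eq_integral_of_support_subset, hd, enorm2_smul hτ]
    · rw [← enorm2_sq, smul_eq_mul]
      field_simp
    · refine (subset_tsupport _).trans (hα.trans fun s hs => ?_)
      constructor
      · have := hs.1; simp only [mul_zero, zero_sub]; linarith
      · have := hs.2; linarith
  · intro e' he' hne
    unfold segInt
    have : ∀ t ∈ Set.uIcc (0 : ℝ) 1, Psi x l α β (e'.1 + t • (e'.2 - e'.1)) = 0 := by
      intro t ht
      rw [Set.uIcc_of_le zero_le_one] at ht
      apply image_eq_zero_of_notMem_tsupport
      intro hm
      obtain ⟨z, hz, hzz⟩ := Psi_tsupport hα hβ hl hm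
      refine hoth e' he' hne z hz ?_
      rw [hzz]
      unfold seg
      rw [segment_eq_image']
      exact ⟨t, ht, rfl⟩
    rw [intervalIntegral.integral_congr (g := fun _ => 0) this]
    simp
  · intro hn; exact absurd he hn

namespace Dat
variable {Ω : Set (ℝ × ℝ)} {P : Finset (ℝ × ℝ)} {φ f : ℕ → V → ℤ} {E : Finset Seg}

theorem jump (h : Dat Ω P φ f E) {m : Seg → ℕ} (hW : WeakLimit Ω φ E m) {M : ℕ → ℕ}
    (hM : Tendsto M atTop atTop) {u : ℝ × ℝ → ℝ}
    (hu : ∀ y ∈ Good Ω P E, Tendsto (fun j => gN f (M j) y) atTop (𝓝 (u y)))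
    {e : Seg} (he : e ∈ E) {l : ℝ × ℝ} {τ t0 ε : ℝ} (hε : 0 < ε)
    (hlp : toR (prim (e.2 - e.1)) = l) (hd : e.2 - e.1 = τ • l) (hτ : 0 < τ) {x : ℝ × ℝ}
    (hx : x = e.1 + t0 • (e.2 - e.1)) (h1 : ε < τ * t0) (h2 : ε < τ * (1 - t0)) (hl : 0 < nq l)
    (hoth : ∀ e' ∈ E, e' ≠ e → ∀ z ∈ Set.Icc (-ε) ε ×ˢ Set.Icc (-ε) ε, Th x l z ∉ seg e')
    (hin : ∀ z ∈ Set.Icc (-ε) ε ×ˢ Set.Icc (-ε) ε, Th x l z ∈ interior Ω ∧ Th x l z ∉ P)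
    {a0 b0 c0 a b c : ℝ}
    (hw : ∀ z ∈ Set.Icc (-ε) ε ×ˢ Set.Icc (-ε) ε, z.2 ≠ 0 →
      u (Th x l z) = (a0 + b0 * z.1 + c0 * z.2) + if 0 < z.2 then a + b * z.1 + c * z.2 else 0) :
    a = 0 ∧ b = 0 ∧ c = -(nq l * m e) := by
  have main : ∀ α β : ℝ → ℝ, Tst α → Tst β → tsupport α ⊆ Set.Icc (-ε) ε →
      tsupport β ⊆ Set.Icc (-ε) ε →
      c * (∫ s, α s) * β 0 - (a * (∫ s, α s) + b * ∫ s, s * α s) * deriv β 0 =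
        -(nq l * m e * β 0 * ∫ s, α s) := by
    intro α β hα hβ sα sβ
    have hts := Psi_tsupport (x := x) sα sβ hl.ne'
    have w1 := h.weak_lim hW hM hu (ψ := Psi x l α β) (Psi_smooth x l hα.sm hβ.sm)
      (((isCompact_Icc.prod isCompact_Icc).image (Th_cont x l)).of_isClosed_subset
        (isClosed_tsupport _) hts)
      (fun y hy => by
        obtain ⟨z, hz, rfl⟩ := hts hy
        exact (hin z hz).1)
      (fun p hp hy => by
        obtain ⟨z, hz, rfl⟩ := hts hy
        exact (hin z hz).2 hp)
    rw [pairing_Psi he hlp hd hτ hx h1 h2 hl.ne' hoth sα sβ, cov (x := x) hl] at w1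
    simp_rw [Psi_dd x l hα.sm hβ.sm hl.ne'] at w1
    have e1 : ∀ z : ℝ × ℝ, u (Th x l z) * ((nq l)⁻¹ * (Psi x l (deriv (deriv α)) β (Th x l z) +
        Psi x l α (deriv (deriv β)) (Th x l z))) = (nq l)⁻¹ * (u (Th x l z) *
        (deriv (deriv α) z.1 * β z.2 + α z.1 * deriv (deriv β) z.2)) := by
      intro z
      unfold Psi
      rw [sg_Th hl.ne', ta_Th hl.ne']
      ring
    simp_rw [e1] at w1
    rw [MeasureTheory.integral_const_mul, mul_inv_cancel_left₀ hl.ne'] at w1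
    rw [← w1]
    have sα' : tsupport (deriv (deriv α)) ⊆ Set.Icc (-ε) ε :=
      ((tsupport_deriv_subset ..).trans (tsupport_deriv_subset ..)).trans sα
    have sβ' : tsupport (deriv (deriv β)) ⊆ Set.Icc (-ε) ε :=
      ((tsupport_deriv_subset ..).trans (tsupport_deriv_subset ..)).trans sβ
    refine (jump_int hα hβ (w := fun z => u (Th x l z)) (a0 := a0) (b0 := b0) (c0 := c0) (a := a) (b := b) (c := c) ?_).symm
    intro z hz hne
    refine hw z ?_ hz
    by_cases hh : deriv (deriv α) z.1 * β z.2 = 0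
    · rw [hh, zero_add] at hne
      exact ⟨sα (subset_tsupport _ (left_ne_zero_of_mul hne)),
        sβ' (subset_tsupport _ (right_ne_zero_of_mul hne))⟩
    · exact ⟨sα' (subset_tsupport _ (left_ne_zero_of_mul hh)),
        sβ (subset_tsupport _ (right_ne_zero_of_mul hh))⟩
  let B : ContDiffBump (0 : ℝ) := ⟨ε / 2, ε, by positivity, by linarith⟩
  have tB : Tst B := ⟨B.contDiff, B.hasCompactSupport⟩
  have sB : tsupport B ⊆ Set.Icc (-ε) ε := by
    rw [B.tsupport_eq, Real.closedBall_eq_Icc]; simp [B]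
  have sB' : tsupport (fun t => t * B t) ⊆ Set.Icc (-ε) ε :=
    (closure_mono (Function.support_mul_subset_right _ _)).trans sB
  have B0 : B 0 = 1 := B.one_of_mem_closedBall (Metric.mem_closedBall_self B.rIn_pos.le)
  have hpos : 0 < ∫ s, B s := B.integral_pos
  have odd : ∫ s, s * B s = 0 := by
    have h1 := MeasureTheory.integral_neg_eq_self (fun s => s * B s) MeasureTheory.volume
    have h2 : ∀ s, (-s) * B (-s) = -(s * B s) := by intro s; rw [B.neg]; ring
    simp_rw [h2] at h1
    rw [MeasureTheory.integral_neg] at h1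
    linarith
  have hpos2 : 0 < ∫ s, s * (s * B s) := by
    have hc : Continuous fun s => s * (s * B s) := tB.idmul.idmul.sm.continuous
    refine hc.integral_pos_of_hasCompactSupport_nonneg_nonzero tB.idmul.idmul.cs ?_ (x := ε / 2) ?_
    · intro s
      have := B.nonneg (x := s)
      show 0 ≤ s * (s * B s)
      nlinarith [mul_nonneg (mul_self_nonneg s) this]
    · have : B (ε / 2) = 1 := B.one_of_mem_closedBall (by
        rw [Metric.mem_closedBall, Real.dist_eq, sub_zero, abs_of_pos (by positivity)])
      rw [this]
      positivity
  have dB : deriv (fun t => t * B t) 0 = 1 := by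
    have := ((hasDerivAt_id (0 : ℝ)).mul (tB.sm.differentiable (by simp) 0).hasDerivAt).deriv
    have e : (id * (B : ℝ → ℝ)) = (fun t => t * B t) := rfl
    rw [e] at this
    rw [this]; simp [B0]
  have m1 := main _ _ tB tB.idmul sB sB'
  have m2 := main _ _ tB.idmul tB.idmul sB' sB'
  have m3 := main _ _ tB tB sB sB
  rw [dB, odd] at m1
  rw [dB, odd] at m2
  rw [odd] at m3
  have ha : a = 0 := by
    have : a * ∫ s, B s = 0 := by linarith
    exact (mul_eq_zero.1 this).resolve_right hpos.ne'
  have hb : b = 0 := by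
    have : b * ∫ s, s * (s * B s) = 0 := by linarith
    exact (mul_eq_zero.1 this).resolve_right hpos2.ne'
  refine ⟨ha, hb, ?_⟩
  rw [ha, B0] at m3
  have : (c + nq l * m e) * ∫ s, B s = 0 := by linarith
  have := (mul_eq_zero.1 this).resolve_right hpos.ne'
  linarith

end Dat

def LocAff (w : ℝ × ℝ → ℝ) (G : Set (ℝ × ℝ)) (x : ℝ × ℝ) : Prop :=
  ∃ r > 0, ∃ a b c : ℝ, ∀ y ∈ Metric.ball x r, y ∈ G → w y = a * y.1 + b * y.2 + c

theorem LocAff.sub {w w' : ℝ × ℝ → ℝ} {G : Set (ℝ × ℝ)} {x : ℝ × ℝ} (h : LocAff w G x)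
    (h' : LocAff w' G x) : LocAff (fun y => w y - w' y) G x := by
  obtain ⟨r, hr, a, b, c, H⟩ := h
  obtain ⟨r', hr', a', b', c', H'⟩ := h'
  refine ⟨min r r', lt_min hr hr', a - a', b - b', c - c', fun y hy hG => ?_⟩
  rw [Metric.mem_ball, lt_min_iff] at hy
  have e1 := H y hy.1 hG
  have e2 := H' y hy.2 hG
  show w y - w' y = _
  rw [e1, e2]; ring

theorem aff_unique {U : Set (ℝ × ℝ)} (hU : IsOpen U) (hne : U.Nonempty) {a b c a' b' c' : ℝ}
    (h : ∀ y ∈ U, a * y.1 + b * y.2 + c = a' * y.1 + b' * y.2 + c') : a = a' ∧ b = b' ∧ c = c' := by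
  obtain ⟨y, hy⟩ := hne
  obtain ⟨r, hr, hb⟩ := Metric.isOpen_iff.1 hU y hy
  have h0 := h y hy
  have h1 := h (y.1 + r / 2, y.2) (hb (by
    rw [Metric.mem_ball, Prod.dist_eq]; simp [abs_of_pos hr, hr]))
  have h2 := h (y.1, y.2 + r / 2) (hb (by
    rw [Metric.mem_ball, Prod.dist_eq]; simp [abs_of_pos hr, hr]))
  simp only at h1 h2
  have ha : a = a' := by
    have : (a - a') * r = 0 := by linarith
    have := (mul_eq_zero.1 this).resolve_right hr.ne'
    linarith
  have hb : b = b' := by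
    have : (b - b') * r = 0 := by linarith
    have := (mul_eq_zero.1 this).resolve_right hr.ne'
    linarith
  subst ha hb
  exact ⟨rfl, rfl, by linarith⟩

theorem glue {w : ℝ × ℝ → ℝ} {G X : Set (ℝ × ℝ)} (hG : IsOpen G) (hX : IsPreconnected X)
    (hcl : X ⊆ closure G) (hloc : ∀ x ∈ X, LocAff w G x) :
    ∃ a b c : ℝ, ∀ y ∈ X, y ∈ G → w y = a * y.1 + b * y.2 + c := by
  rcases X.eq_empty_or_nonempty with rfl | ⟨x0, hx0⟩
  · exact ⟨0, 0, 0, fun y hy => absurd hy (Set.notMem_empty y)⟩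
  choose! r hr a b c H using hloc
  let q : X → ℝ × ℝ × ℝ := fun x => (a x, b x, c x)
  have hq : IsLocallyConstant q := by
    rw [IsLocallyConstant.iff_exists_open]
    intro x
    refine ⟨Subtype.val ⁻¹' Metric.ball (x : ℝ × ℝ) (r x),
      Metric.isOpen_ball.preimage continuous_subtype_val, Metric.mem_ball_self (hr x x.2), ?_⟩
    intro x' hx'
    have hx'' : (x' : ℝ × ℝ) ∈ Metric.ball (x : ℝ × ℝ) (r x) := hx'
    have hop : IsOpen (Metric.ball (x : ℝ × ℝ) (r x) ∩ Metric.ball (x' : ℝ × ℝ) (r x')) :=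
      Metric.isOpen_ball.inter Metric.isOpen_ball
    have := mem_closure_iff.1 (hcl x'.2) _ hop ⟨hx'', Metric.mem_ball_self (hr x' x'.2)⟩
    obtain ⟨e1, e2, e3⟩ := aff_unique (hop.inter hG) this (a := a x') (b := b x') (c := c x')
      (a' := a x) (b' := b x) (c' := c x) (fun y hy => by
        rw [← H x' x'.2 y hy.1.2 hy.2, ← H x x.2 y hy.1.1 hy.2])
    simp only [q, e1, e2, e3]
  have : PreconnectedSpace X := isPreconnected_iff_preconnectedSpace.1 hX
  refine ⟨a x0, b x0, c x0, fun y hy hyG => ?_⟩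
  have e := hq.apply_eq_of_preconnectedSpace ⟨y, hy⟩ ⟨x0, hx0⟩
  simp only [q, Prod.mk.injEq] at e
  rw [H y hy y (Metric.mem_ball_self (hr y hy)) hyG, e.1, e.2.1, e.2.2]

theorem punctured {z : ℝ × ℝ} {r : ℝ} (hr : 0 < r) : IsPreconnected (Metric.ball z r \ {z}) := by
  have e : Metric.ball z r \ {z} =
      ((Metric.ball z r ∩ {y | z.1 < y.1}) ∪ (Metric.ball z r ∩ {y | z.2 < y.2})) ∪
      ((Metric.ball z r ∩ {y | y.1 < z.1}) ∪ (Metric.ball z r ∩ {y | y.2 < z.2})) := by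
    ext y
    constructor
    · rintro ⟨h1, h2⟩
      have : y.1 ≠ z.1 ∨ y.2 ≠ z.2 := by
        by_contra hc
        push Not at hc
        exact h2 (Prod.ext hc.1 hc.2)
      rcases this with h | h <;> rcases lt_or_gt_of_ne h with h | h
      · exact Or.inr (Or.inl ⟨h1, h⟩)
      · exact Or.inl (Or.inl ⟨h1, h⟩)
      · exact Or.inr (Or.inr ⟨h1, h⟩)
      · exact Or.inl (Or.inr ⟨h1, h⟩)
    · rintro ((⟨h1, h⟩ | ⟨h1, h⟩) | (⟨h1, h⟩ | ⟨h1, h⟩)) <;>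
      · refine ⟨h1, fun h2 => ?_⟩
        have h2 : y = z := h2
        subst h2
        simp at h
  have cb : Convex ℝ (Metric.ball z r) := convex_ball z r
  have l1 : IsLinearMap ℝ (fun y : ℝ × ℝ => y.1) := ⟨fun _ _ => rfl, fun _ _ => rfl⟩
  have l2 : IsLinearMap ℝ (fun y : ℝ × ℝ => y.2) := ⟨fun _ _ => rfl, fun _ _ => rfl⟩
  have c1 := (cb.inter (convex_halfSpace_gt l1 z.1)).isPreconnected
  have c2 := (cb.inter (convex_halfSpace_gt l2 z.2)).isPreconnected
  have c3 := (cb.inter (convex_halfSpace_lt l1 z.1)).isPreconnected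
  have c4 := (cb.inter (convex_halfSpace_lt l2 z.2)).isPreconnected
  have pt : ∀ s t : ℝ, |s| < r → |t| < r → (z.1 + s, z.2 + t) ∈ Metric.ball z r := by
    intro s t hs ht
    rw [Metric.mem_ball, Prod.dist_eq]; simp [hs, ht]
  have hh : |r / 2| < r := by rw [abs_of_pos (by positivity)]; linarith
  have hh' : |-(r / 2)| < r := by rw [abs_neg]; exact hh
  have p1 := pt _ _ hh hh
  have p2 := pt _ _ hh' hh'
  have p3 := pt _ _ hh hh'
  rw [e]
  refine IsPreconnected.union (z.1 + r / 2, z.2 + -(r / 2)) ?_ ?_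
    (IsPreconnected.union (z.1 + r / 2, z.2 + r / 2) ?_ ?_ c1 c2)
    (IsPreconnected.union (z.1 + -(r / 2), z.2 + -(r / 2)) ?_ ?_ c3 c4)
  · exact Or.inl ⟨p3, show z.1 < z.1 + r / 2 by linarith⟩
  · exact Or.inr ⟨p3, show z.2 + -(r / 2) < z.2 by linarith⟩
  · exact ⟨p1, show z.1 < z.1 + r / 2 by linarith⟩
  · exact ⟨p1, show z.2 < z.2 + r / 2 by linarith⟩
  · exact ⟨p2, show z.1 + -(r / 2) < z.1 by linarith⟩
  · exact ⟨p2, show z.2 + -(r / 2) < z.2 by linarith⟩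

/-- Local affinity off a finite set extends to the finite set. -/
theorem glue_all {w : ℝ × ℝ → ℝ} {G X : Set (ℝ × ℝ)} {S : Set (ℝ × ℝ)} (hG : IsOpen G)
    (hX : IsPreconnected X) (hXo : IsOpen X) (hcl : X ⊆ closure G) (hS : S.Finite)
    (hSG : ∀ z ∈ S, z ∉ G)
    (hloc : ∀ x ∈ X, x ∉ S → LocAff w G x) :
    ∃ a b c : ℝ, ∀ y ∈ X, y ∈ G → w y = a * y.1 + b * y.2 + c := by
  refine glue hG hX hcl fun x hx => ?_
  by_cases hxS : x ∈ S
  · have ho : IsOpen (X ∩ (S \ {x})ᶜ) := hXo.inter (hS.subset Set.sdiff_subset).isClosed.isOpen_compl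
    obtain ⟨r, hr, hb⟩ := Metric.isOpen_iff.1 ho x ⟨hx, fun h => h.2 rfl⟩
    obtain ⟨a, b, c, H⟩ := glue (w := w) hG (punctured (z := x) hr)
      (fun y hy => hcl (hb hy.1).1) (fun y hy => hloc y (hb hy.1).1 fun h =>
        (hb hy.1).2 ⟨h, hy.2⟩)
    refine ⟨r, hr, a, b, c, fun y hy hyG => H y ⟨hy, fun h => ?_⟩ hyG⟩
    have h : y = x := h
    subst h
    exact hSG _ hxS hyG
  · exact hloc x hx hxS

theorem prim_pm {l l' : ℤ × ℤ} (h : Int.gcd l.1 l.2 = 1) (h' : Int.gcd l'.1 l'.2 = 1)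
    {c : ℝ} (hc : c ≠ 0) (hcl : toR l = c • toR l') : l' = l ∨ l' = -l := by
  have hx : l.1 * l'.2 = l.2 * l'.1 := by
    have e1 : (l.1 : ℝ) = c * l'.1 := congrArg Prod.fst hcl
    have e2 : (l.2 : ℝ) = c * l'.2 := congrArg Prod.snd hcl
    have : (l.1 : ℝ) * l'.2 = l.2 * l'.1 := by rw [e1, e2]; ring
    exact_mod_cast this
  obtain ⟨p, q, hpq⟩ := Int.isCoprime_iff_gcd_eq_one.2 h
  set k := p * l'.1 + q * l'.2 with hk
  have k1 : l'.1 = k * l.1 := by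
    rw [hk]; linear_combination (-l'.1) * hpq - q * hx
  have k2 : l'.2 = k * l.2 := by
    rw [hk]; linear_combination (-l'.2) * hpq + p * hx
  have hk1 : IsUnit k := by
    obtain ⟨p', q', h2⟩ := Int.isCoprime_iff_gcd_eq_one.2 h'
    rw [k1, k2] at h2
    exact IsUnit.of_mul_eq_one (p' * l.1 + q' * l.2) (by linear_combination h2)
  rcases Int.isUnit_iff.1 hk1 with h1 | h1
  · left; ext <;> simp [k1, k2, h1]
  · right; ext <;> simp [k1, k2, h1]

theorem prim_spec {d : ℝ × ℝ} (h : RatDir d) : PrimOut d (prim d) := by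
  unfold prim
  have h' : ∃ l, PrimOut d l := h
  rw [dif_pos h']
  exact h'.choose_spec

theorem nq_pos {l : ℤ × ℤ} (h : Int.gcd l.1 l.2 = 1) : 0 < nq (toR l) := by
  unfold nq toR
  have : l.1 ≠ 0 ∨ l.2 ≠ 0 := by
    by_contra hc; push Not at hc; rw [hc.1, hc.2] at h; simp at h
  rcases this with h | h
  · have : (l.1 : ℝ) ≠ 0 := by exact_mod_cast h
    positivity
  · have : (l.2 : ℝ) ≠ 0 := by exact_mod_cast h
    positivity

/-- Shape of the min of two affine functions tying along a line through `x`. -/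
theorem weight_shape {F : ℝ × ℝ → ℝ} {x : ℝ × ℝ} {l l' : ℤ × ℤ} {m : ℕ}
    (hw : EdgeWeightIs F x l' m) (hl : l' = l ∨ l' = -l) (hcor : x ∈ cornerLocus F)
    (hgl : Int.gcd l.1 l.2 = 1) :
    ∃ r > 0, ∃ a0 b0 c0 : ℝ, ∀ z, Th x (toR l) z ∈ Metric.ball x r →
      F (Th x (toR l) z) = (a0 + b0 * z.1 + c0 * z.2) +
        if 0 < z.2 then -(nq (toR l) * m) * z.2 else 0 := by
  obtain ⟨U, hU, g1, g2, c1, c2, hg, hF⟩ := hw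
  obtain ⟨r, hr, hrU⟩ := Metric.mem_nhds_iff.1 hU
  have hq := nq_pos hgl
  have hg1 : g1.1 - g2.1 = m * (-l'.2) := by
    have := congrArg Prod.fst hg; simpa [toR] using this
  have hg2 : g1.2 - g2.2 = m * l'.1 := by
    have := congrArg Prod.snd hg; simpa [toR] using this
  have tie : g1.1 * x.1 + g1.2 * x.2 + c1 = g2.1 * x.1 + g2.2 * x.2 + c2 := by
    by_contra hne
    have hcor' : ¬ LocallyAffine F x := hcor
    apply hcor'
    have cont1 : Continuous fun y : ℝ × ℝ => g1.1 * y.1 + g1.2 * y.2 + c1 := by fun_prop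
    have cont2 : Continuous fun y : ℝ × ℝ => g2.1 * y.1 + g2.2 * y.2 + c2 := by fun_prop
    rcases lt_or_gt_of_ne hne with hlt | hlt
    · have := cont1.continuousAt.eventually_lt cont2.continuousAt hlt
      refine ⟨_, inter_mem hU this, g1.1, g1.2, c1, fun y hy => ?_⟩
      have h2 : g1.1 * y.1 + g1.2 * y.2 + c1 < g2.1 * y.1 + g2.2 * y.2 + c2 := hy.2
      rw [hF y hy.1, min_eq_left h2.le]
    · have := cont2.continuousAt.eventually_lt cont1.continuousAt hlt
      refine ⟨_, inter_mem hU this, g2.1, g2.2, c2, fun y hy => ?_⟩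
      have h2 : g2.1 * y.1 + g2.2 * y.2 + c2 < g1.1 * y.1 + g1.2 * y.2 + c1 := hy.2
      rw [hF y hy.1, min_eq_right h2.le]
  rcases hl with rfl | rfl
  · refine ⟨r, hr, g1.1 * x.1 + g1.2 * x.2 + c1, g1.1 * l'.1 + g1.2 * l'.2,
      -g1.1 * l'.2 + g1.2 * l'.1, fun z hz => ?_⟩
    rw [hF _ (hrU hz)]
    have e1 : g1.1 * (Th x (toR l') z).1 + g1.2 * (Th x (toR l') z).2 + c1 =
        g1.1 * x.1 + g1.2 * x.2 + c1 + (g1.1 * l'.1 + g1.2 * l'.2) * z.1 +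
        (-g1.1 * l'.2 + g1.2 * l'.1) * z.2 := by
      simp only [Th, toR]; ring
    have e2 : g2.1 * (Th x (toR l') z).1 + g2.2 * (Th x (toR l') z).2 + c2 =
        g1.1 * x.1 + g1.2 * x.2 + c1 + (g1.1 * l'.1 + g1.2 * l'.2) * z.1 +
        (-g1.1 * l'.2 + g1.2 * l'.1) * z.2 + -(nq (toR l') * m) * z.2 := by
      rw [tie]
      have h1 : g1.1 = g2.1 + m * (-l'.2) := by linarith
      have h2 : g1.2 = g2.2 + m * l'.1 := by linarith
      rw [h1, h2]
      simp only [Th, toR, nq]; ring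
    rw [e1, e2]
    have hm : 0 ≤ nq (toR l') * (m : ℝ) := by positivity
    split_ifs with h0
    · rw [min_eq_right]; nlinarith
    · rw [min_eq_left, add_zero]; push Not at h0; nlinarith
  · refine ⟨r, hr, g2.1 * x.1 + g2.2 * x.2 + c2, g2.1 * l.1 + g2.2 * l.2,
      -g2.1 * l.2 + g2.2 * l.1, fun z hz => ?_⟩
    rw [hF _ (hrU hz)]
    simp only [Prod.fst_neg, Prod.snd_neg, Int.cast_neg] at hg1 hg2
    have e2 : g2.1 * (Th x (toR l) z).1 + g2.2 * (Th x (toR l) z).2 + c2 =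
        g2.1 * x.1 + g2.2 * x.2 + c2 + (g2.1 * l.1 + g2.2 * l.2) * z.1 +
        (-g2.1 * l.2 + g2.2 * l.1) * z.2 := by
      simp only [Th, toR]; ring
    have e1 : g1.1 * (Th x (toR l) z).1 + g1.2 * (Th x (toR l) z).2 + c1 =
        g2.1 * x.1 + g2.2 * x.2 + c2 + (g2.1 * l.1 + g2.2 * l.2) * z.1 +
        (-g2.1 * l.2 + g2.2 * l.1) * z.2 + -(nq (toR l) * m) * z.2 := by
      rw [← tie]
      have h1 : g2.1 = g1.1 + m * (-l.2) := by linarith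
      have h2 : g2.2 = g1.2 + m * l.1 := by linarith
      rw [h1, h2]
      simp only [Th, toR, nq]; ring
    rw [e1, e2]
    have hm : 0 ≤ nq (toR l) * (m : ℝ) := by positivity
    split_ifs with h0
    · rw [min_eq_left]; nlinarith
    · rw [min_eq_right, add_zero]; push Not at h0; nlinarith

theorem edge_data {E : Finset Seg} {e : Seg} (hE : EdgeSet E) (he : e ∈ E)
    (hR : RatDir (e.2 - e.1)) {x : ℝ × ℝ} (hx : x ∈ seg e) (h1 : x ≠ e.1) (h2 : x ≠ e.2) :
    ∃ τ t0 : ℝ, 0 < τ ∧ 0 < t0 ∧ t0 < 1 ∧ Int.gcd (prim (e.2 - e.1)).1 (prim (e.2 - e.1)).2 = 1 ∧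
      e.2 - e.1 = τ • toR (prim (e.2 - e.1)) ∧ x = e.1 + t0 • (e.2 - e.1) := by
  obtain ⟨hg, τ, hτ, hd⟩ := prim_spec hR
  unfold seg at hx
  rw [segment_eq_image'] at hx
  obtain ⟨t0, ht, rfl⟩ := hx
  refine ⟨τ, t0, hτ, ?_, ?_, hg, hd, rfl⟩
  · refine lt_of_le_of_ne ht.1 fun h => h1 ?_
    rw [← h]; simp
  · refine lt_of_le_of_ne ht.2 fun h => h2 ?_
    rw [h]; simp

theorem edge_weight {Ω : Set (ℝ × ℝ)} {E : Finset Seg} {m : Seg → ℕ} {F : ℝ × ℝ → ℝ}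
    {C : PlaneTropData} (hExt : ExtendsCurve Ω E m C) (hRep : RepresentsCornerLocus F C)
    (hE : EdgeSet E) {e : Seg} (he : e ∈ E)
    (hR : RatDir (e.2 - e.1)) {x : ℝ × ℝ} (hx : x ∈ seg e) (h1 : x ≠ e.1) (h2 : x ≠ e.2) :
    ∃ l', EdgeWeightIs F x l' (m e) ∧ (l' = prim (e.2 - e.1) ∨ l' = -prim (e.2 - e.1)) := by
  obtain ⟨τ, t0, hτ, ht0, ht1, hg, hd, hx0⟩ := edge_data hE he hR hx h1 h2
  have hne := (hE e he).1
  have key : ∀ (q d' : ℝ × ℝ) (s1 s2 : ℝ), e.1 = q + s1 • d' → e.2 = q + s2 • d' →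
      x = q + (s1 + t0 * (s2 - s1)) • d' ∧ s1 ≠ s2 ∧ d' ≠ 0 ∧
      ∀ l', PrimOut d' l' → l' = prim (e.2 - e.1) ∨ l' = -prim (e.2 - e.1) := by
    intro q d' s1 s2 e1 e2
    have hs : s1 ≠ s2 := by
      rintro rfl; exact hne (e1.trans e2.symm)
    refine ⟨?_, hs, ?_, ?_⟩
    · rw [hx0, e1, e2]; ext <;> simp <;> ring
    · rintro rfl; apply hne; rw [e1, e2]; simp
    · rintro l' ⟨hg', t', ht', hd'⟩
      refine prim_pm hg hg' (c := τ⁻¹ * ((s2 - s1) * t')) ?_ ?_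
      · have : s2 - s1 ≠ 0 := sub_ne_zero.2 hs.symm
        positivity
      · have : τ • toR (prim (e.2 - e.1)) = ((s2 - s1) * t') • toR l' := by
          rw [← hd, mul_smul, ← hd', e1, e2]
          ext <;> simp <;> ring
        rw [mul_smul, ← this, inv_smul_smul₀ hτ.ne']
  rcases hExt.2.2 e he with ⟨e', he', hsub, hm⟩ | ⟨r, hr, hsub, hm⟩
  · have a1 : e.1 ∈ seg e' := hsub (left_mem_segment ℝ e.1 e.2)
    have a2 : e.2 ∈ seg e' := hsub (right_mem_segment ℝ e.1 e.2)
    have hxe := hsub hx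
    unfold seg at a1 a2
    rw [segment_eq_image'] at a1 a2
    obtain ⟨s1, hs1, e1⟩ := a1
    obtain ⟨s2, hs2, e2⟩ := a2
    obtain ⟨kx, hs, hd0, hl⟩ := key _ _ _ _ e1.symm e2.symm
    refine ⟨_, ?_, hl _ (prim_spec (hExt.1.2.1 e' he').2)⟩
    rw [← hm]
    refine hRep.2.1 e' he' x hxe ?_ ?_
    · intro hh
      rw [hh] at kx
      have : (s1 + t0 * (s2 - s1)) • (e'.2 - e'.1) = 0 := by
        have := kx.symm; rwa [add_eq_left] at this
      have := (smul_eq_zero.1 this).resolve_right hd0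
      apply hs
      have b1 := mul_nonneg (sub_pos.2 ht1).le hs1.1
      have b2 := mul_nonneg ht0.le hs2.1
      have c1 : (1 - t0) * s1 = 0 := by nlinarith
      have c2 : t0 * s2 = 0 := by nlinarith
      rw [(mul_eq_zero.1 c1).resolve_left (by linarith), (mul_eq_zero.1 c2).resolve_left ht0.ne']
    · intro hh
      rw [hh] at kx
      have : (1 - (s1 + t0 * (s2 - s1))) • (e'.2 - e'.1) = 0 := by
        rw [sub_smul, one_smul, sub_eq_zero]
        nth_rewrite 1 [kx]
        abel
      have := (smul_eq_zero.1 this).resolve_right hd0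
      apply hs
      have b1 := mul_nonneg (sub_pos.2 ht1).le (sub_nonneg.2 hs1.2)
      have b2 := mul_nonneg ht0.le (sub_nonneg.2 hs2.2)
      have c1 : (1 - t0) * (1 - s1) = 0 := by nlinarith
      have c2 : t0 * (1 - s2) = 0 := by nlinarith
      have := (mul_eq_zero.1 c1).resolve_left (by linarith)
      have := (mul_eq_zero.1 c2).resolve_left ht0.ne'
      linarith
  · obtain ⟨s1, hs1, e1⟩ := hsub (left_mem_segment ℝ e.1 e.2)
    obtain ⟨s2, hs2, e2⟩ := hsub (right_mem_segment ℝ e.1 e.2)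
    have hxe := hsub hx
    obtain ⟨kx, hs, hd0, hl⟩ := key _ _ _ _ e1 e2
    refine ⟨_, ?_, hl _ ⟨(hExt.1.2.2.1 r hr).2, 1, one_pos, (one_smul _ _).symm⟩⟩
    rw [← hm]
    refine hRep.2.2 r hr x hxe ?_
    intro hh
    rw [hh] at kx
    have : (s1 + t0 * (s2 - s1)) • (toR r.2) = 0 := by
      have := kx.symm; rwa [add_eq_left] at this
    have := (smul_eq_zero.1 this).resolve_right hd0
    apply hs
    have b1 := mul_nonneg (sub_pos.2 ht1).le hs1
    have b2 := mul_nonneg ht0.le hs2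
    have c1 : (1 - t0) * s1 = 0 := by nlinarith
    have c2 : t0 * s2 = 0 := by nlinarith
    rw [(mul_eq_zero.1 c1).resolve_left (by linarith), (mul_eq_zero.1 c2).resolve_left ht0.ne']

namespace Dat
variable {Ω : Set (ℝ × ℝ)} {P : Finset (ℝ × ℝ)} {φ f : ℕ → V → ℤ} {E : Finset Seg}

theorem locaff_edge (h : Dat Ω P φ f E) {m : Seg → ℕ} (hW : WeakLimit Ω φ E m) {M : ℕ → ℕ}
    (hM : Tendsto M atTop atTop) {u : ℝ × ℝ → ℝ}
    (hu : ∀ y ∈ Good Ω P E, Tendsto (fun j => gN f (M j) y) atTop (𝓝 (u y)))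
    (hua : ∀ y ∈ Good Ω P E, ∃ r : ℝ, 0 < r ∧ ∃ a b c : ℝ, ∀ x ∈ Metric.ball y r,
        u x = a * x.1 + b * x.2 + c)
    (hE : EdgeSet E) (hPl : Planar E) {F : ℝ × ℝ → ℝ}
    {C : PlaneTropData} (hExt : ExtendsCurve Ω E m C) (hRep : RepresentsCornerLocus F C)
    {e : Seg} (he : e ∈ E)
    (hR : RatDir (e.2 - e.1)) {x : ℝ × ℝ} (hx : x ∈ seg e) (h1 : x ≠ e.1) (h2 : x ≠ e.2)
    (hxΩ : x ∈ interior Ω) (hxP : x ∉ P) : LocAff (fun y => u y - F y) (Good Ω P E) x := by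
  classical
  obtain ⟨l', hw, hl'⟩ := edge_weight hExt hRep hE he hR hx h1 h2
  obtain ⟨τ, t0, hτ, ht0, ht1, hg, hd, hx0⟩ := edge_data hE he hR hx h1 h2
  have hcor : x ∈ cornerLocus F := by
    have : x ∈ gsupp E := Set.mem_biUnion he hx
    rw [← hExt.2.1] at this
    rw [← hRep.1]; exact this.1
  obtain ⟨r, hr, A, B, D, hF⟩ := weight_shape hw hl' hcor hg
  set l := toR (prim (e.2 - e.1)) with hldef
  have hl : 0 < nq l := nq_pos hg
  have hxE : x ∉ gsupp (E.erase e) := by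
    intro hh
    unfold gsupp at hh
    simp only [Set.mem_iUnion] at hh
    obtain ⟨e', he', hxe'⟩ := hh
    have := (hPl e he e' (Finset.mem_of_mem_erase he') (Finset.ne_of_mem_erase he').symm ⟨hx, hxe'⟩).1
    rcases this with h' | h'
    · exact h1 h'
    · exact h2 h'
  have hO : IsOpen (Th x l ⁻¹' ((interior Ω ∩ (↑P : Set (ℝ × ℝ))ᶜ) ∩
      ((gsupp (E.erase e))ᶜ ∩ Metric.ball x r))) :=
    ((isOpen_interior.inter P.finite_toSet.isClosed.isOpen_compl).inter
      ((isClosed_gsupp _).isOpen_compl.inter Metric.isOpen_ball)).preimage (Th_cont x l)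
  obtain ⟨ε1, hε1, hb⟩ := Metric.isOpen_iff.1 hO 0 (by
    have : Th x l 0 = x := by simp [Th]
    rw [Set.mem_preimage, this]
    exact ⟨⟨hxΩ, by simpa using hxP⟩, hxE, Metric.mem_ball_self hr⟩)
  obtain ⟨ε, hε, hεm⟩ := exists_between (show 0 < min ε1 (min (τ * t0) (τ * (1 - t0))) from
    lt_min hε1 (lt_min (by positivity) (mul_pos hτ (by linarith))))
  rw [lt_min_iff, lt_min_iff] at hεm
  have hbox : ∀ z ∈ Set.Icc (-ε) ε ×ˢ Set.Icc (-ε) ε, Th x l z ∈ (interior Ω ∩ (↑P : Set (ℝ × ℝ))ᶜ) ∩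
      ((gsupp (E.erase e))ᶜ ∩ Metric.ball x r) := by
    intro z hz
    refine hb ?_
    rw [Metric.mem_ball, Prod.dist_eq]
    simp only [Prod.fst_zero, Prod.snd_zero, Real.dist_eq, sub_zero]
    exact max_lt ((abs_le.2 hz.1).trans_lt hεm.1) ((abs_le.2 hz.2).trans_lt hεm.1)
  have hoth : ∀ e' ∈ E, e' ≠ e → ∀ z ∈ Set.Icc (-ε) ε ×ˢ Set.Icc (-ε) ε, Th x l z ∉ seg e' := by
    intro e' he' hne z hz hh
    exact (hbox z hz).2.1 (Set.mem_biUnion (Finset.mem_erase.2 ⟨hne, he'⟩ :) hh)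
  have hin : ∀ z ∈ Set.Icc (-ε) ε ×ˢ Set.Icc (-ε) ε, Th x l z ∈ interior Ω ∧ Th x l z ∉ P := by
    intro z hz
    exact ⟨(hbox z hz).1.1, by simpa using (hbox z hz).1.2⟩
  have hlin : ∀ z ∈ Set.Icc (-ε) ε ×ˢ Set.Icc (-ε) ε, Th x l z ∈ seg e ↔ z.2 = 0 := by
    intro z hz
    constructor
    · intro hh
      unfold seg at hh
      rw [segment_eq_image'] at hh
      obtain ⟨t, ht, hh⟩ := hh
      have e1 : Th x l z = Th x l (τ * t - τ * t0, 0) := by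
        rw [← hh]
        simp only [hx0, hd]
        ext <;> simp [Th] <;> ring
      have := congrArg (ta x l) e1
      rwa [ta_Th hl.ne', ta_Th hl.ne'] at this
    · intro hz2
      unfold seg
      rw [segment_eq_image']
      refine ⟨t0 + z.1 / τ, ⟨?_, ?_⟩, ?_⟩
      · have := hz.1.1
        have : -(τ * t0) ≤ z.1 := by linarith [hεm.2.1]
        have : 0 ≤ (τ * t0 + z.1) / τ := div_nonneg (by linarith) hτ.le
        rwa [add_div, mul_div_cancel_left₀ _ hτ.ne'] at this
      · have := hz.1.2
        have : (τ * t0 + z.1) / τ ≤ 1 := by rw [div_le_one hτ]; linarith [hεm.2.2]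
        rwa [add_div, mul_div_cancel_left₀ _ hτ.ne'] at this
      · simp only [hx0, hd]
        ext <;> simp [Th, hz2] <;> field_simp <;> ring
  have hgood : ∀ z ∈ Set.Icc (-ε) ε ×ˢ Set.Icc (-ε) ε, z.2 ≠ 0 → Th x l z ∈ Good Ω P E := by
    intro z hz hne
    refine ⟨(hin z hz).1, ?_, (hin z hz).2⟩
    intro hh
    unfold gsupp at hh
    simp only [Set.mem_iUnion] at hh
    obtain ⟨e', he', hh⟩ := hh
    by_cases hee : e' = e
    · subst hee; exact hne ((hlin z hz).1 hh)
    · exact hoth e' he' hee z hz hh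
  have half : ∀ S : Set ℝ, Convex ℝ S → S ⊆ Set.Icc (-ε) ε → (∀ t ∈ S, t ≠ 0) →
      ∃ a b c : ℝ, ∀ z : ℝ × ℝ, z.1 ∈ Set.Icc (-ε) ε → z.2 ∈ S →
        u (Th x l z) = a + b * z.1 + c * z.2 := by
    intro S hS hSi hS0
    have hg1 : ∀ y ∈ Th x l '' (Set.Icc (-ε) ε ×ˢ S), y ∈ Good Ω P E := by
      rintro _ ⟨z, hz, rfl⟩
      exact hgood z ⟨hz.1, hSi hz.2⟩ (hS0 _ hz.2)
    obtain ⟨p, q, s, H⟩ := glue (w := u) (isOpen_good Ω P E)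
      (((convex_Icc (-ε) ε).prod hS).isPreconnected.image (Th x l) (Th_cont x l).continuousOn)
      (fun y hy => subset_closure (hg1 y hy)) (fun y hy => by
        obtain ⟨r, hr, a, b, c, H⟩ := hua y (hg1 y hy)
        exact ⟨r, hr, a, b, c, fun y hy _ => H y hy⟩)
    refine ⟨p * x.1 + q * x.2 + s, p * l.1 + q * l.2, -p * l.2 + q * l.1, fun z hz1 hz2 => ?_⟩
    have hm : Th x l z ∈ Th x l '' (Set.Icc (-ε) ε ×ˢ S) := ⟨z, ⟨hz1, hz2⟩, rfl⟩
    rw [H _ hm (hg1 _ hm)]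
    simp only [Th]; ring
  obtain ⟨a0, b0, c0, Hm⟩ := half (Set.Ico (-ε) 0) (convex_Ico _ _)
    (fun t ht => ⟨ht.1, ht.2.le.trans hε.le⟩) (fun t ht => ht.2.ne)
  obtain ⟨a1, b1, c1, Hp⟩ := half (Set.Ioc 0 ε) (convex_Ioc _ _)
    (fun t ht => ⟨by linarith [ht.1], ht.2⟩) (fun t ht => ht.1.ne')
  have hwz : ∀ z ∈ Set.Icc (-ε) ε ×ˢ Set.Icc (-ε) ε, z.2 ≠ 0 →
      u (Th x l z) = (a0 + b0 * z.1 + c0 * z.2) +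
        if 0 < z.2 then (a1 - a0) + (b1 - b0) * z.1 + (c1 - c0) * z.2 else 0 := by
    intro z hz hne
    split_ifs with h0
    · rw [Hp z hz.1 ⟨h0, hz.2.2⟩]; ring
    · rw [Hm z hz.1 ⟨hz.2.1, lt_of_le_of_ne (not_lt.1 h0) hne⟩]; ring
  obtain ⟨ja, jb, jc⟩ := h.jump hW hM hu he hε rfl hd hτ hx0 hεm.2.1 hεm.2.2 hl hoth hin hwz
  have hdiff : ∀ z ∈ Set.Icc (-ε) ε ×ˢ Set.Icc (-ε) ε, z.2 ≠ 0 →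
      u (Th x l z) - F (Th x l z) = (a0 - A) + (b0 - B) * z.1 + (c0 - D) * z.2 := by
    intro z hz hne
    rw [hwz z hz hne, hF z (hbox z hz).2.2, ja, jb, jc]
    split_ifs <;> ring
  -- back to the `y` coordinates
  have hN : ∀ᶠ y in 𝓝 x, |sg x l y| < ε ∧ |ta x l y| < ε := by
    have s0 : sg x l x = 0 := by simp [sg]
    have t0 : ta x l x = 0 := by simp [ta]
    have c1 : ContinuousAt (fun y => |sg x l y|) x := (sg_smooth x l).continuous.abs.continuousAt
    have c2 : ContinuousAt (fun y => |ta x l y|) x := (ta_smooth x l).continuous.abs.continuousAt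
    exact (c1.eventually_lt continuousAt_const (by simpa [s0] using hε)).and
      (c2.eventually_lt continuousAt_const (by simpa [t0] using hε))
  obtain ⟨ρ, hρ, Hρ⟩ := Metric.eventually_nhds_iff_ball.1 hN
  refine ⟨ρ, hρ, (b0 - B) * l.1 / nq l - (c0 - D) * l.2 / nq l,
    (b0 - B) * l.2 / nq l + (c0 - D) * l.1 / nq l,
    (a0 - A) - (b0 - B) * (l.1 * x.1 + l.2 * x.2) / nq l
      - (c0 - D) * (-l.2 * x.1 + l.1 * x.2) / nq l, fun y hy hyG => ?_⟩
  obtain ⟨y1, y2⟩ := Hρ y hy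
  have hz : (sg x l y, ta x l y) ∈ Set.Icc (-ε) ε ×ˢ Set.Icc (-ε) ε :=
    ⟨abs_le.1 y1.le, abs_le.1 y2.le⟩
  have hne : (sg x l y, ta x l y).2 ≠ 0 := by
    intro h0
    have := (hlin _ hz).2 h0
    rw [Th_sg hl.ne'] at this
    exact hyG.2.1 (Set.mem_biUnion he this)
  have := hdiff _ hz hne
  rw [Th_sg hl.ne'] at this
  show u y - F y = _
  rw [this]
  simp only [sg, ta]
  field_simp
  ring

end Dat

theorem trop_cont {F : ℝ × ℝ → ℝ} (hF : IsTropPoly F) : Continuous F := by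
  obtain ⟨A, hA, a, h⟩ := hF
  have : F = fun x => A.inf' hA fun kl => (kl.1 : ℝ) * x.1 + (kl.2 : ℝ) * x.2 + a kl := funext h
  rw [this]
  exact Continuous.finset_inf'_apply hA fun kl _ => by fun_prop

theorem affine_zero {Ω : Set (ℝ × ℝ)} (hb : Bornology.IsBounded Ω) {a b c : ℝ}
    (h : ∀ z ∈ frontier Ω, a * z.1 + b * z.2 + c = 0) {y : ℝ × ℝ} (hy : y ∈ Ω) :
    a * y.1 + b * y.2 + c = 0 := by
  obtain ⟨d, hd, hd0⟩ : ∃ d : ℝ × ℝ, a * d.1 + b * d.2 = 0 ∧ d ≠ 0 := by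
    by_cases hab : a = 0 ∧ b = 0
    · exact ⟨(1, 0), by simp [hab.1], by simp⟩
    · refine ⟨(-b, a), by simp; ring, fun h0 => hab ?_⟩
      simp only [Prod.mk_eq_zero, neg_eq_zero] at h0
      exact ⟨h0.2, h0.1⟩
  have hc : Continuous fun s : ℝ => y + s • d := by fun_prop
  have : (frontier ((fun s : ℝ => y + s • d) ⁻¹' Ω)).Nonempty := by
    rw [nonempty_frontier_iff]
    refine ⟨⟨0, by simpa using hy⟩, fun hu => ?_⟩
    obtain ⟨R, hR⟩ := hb.subset_closedBall y
    have hall : ∀ s : ℝ, |s| * ‖d‖ ≤ R := by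
      intro s
      have h1 : s ∈ (fun s : ℝ => y + s • d) ⁻¹' Ω := by rw [hu]; trivial
      have h2 := hR h1
      rwa [Metric.mem_closedBall, dist_eq_norm, add_sub_cancel_left, norm_smul, Real.norm_eq_abs] at h2
    have hn : 0 < ‖d‖ := norm_pos_iff.2 hd0
    have h3 := hall ((|R| + 1) / ‖d‖)
    rw [abs_of_pos (by positivity), div_mul_cancel₀ _ hn.ne'] at h3
    linarith [le_abs_self R]
  obtain ⟨s, hs⟩ := this
  have := h _ (hc.frontier_preimage_subset Ω hs)
  simp only [Prod.fst_add, Prod.snd_add, Prod.smul_fst, Prod.smul_snd, smul_eq_mul] at this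
  linear_combination this - s * hd

namespace Dat
variable {Ω : Set (ℝ × ℝ)} {P : Finset (ℝ × ℝ)} {φ f : ℕ → V → ℤ} {E : Finset Seg}

theorem identify (h : Dat Ω P φ f E) {m : Seg → ℕ} (hW : WeakLimit Ω φ E m) {M : ℕ → ℕ}
    (hM : Tendsto M atTop atTop) {u : ℝ × ℝ → ℝ}
    (hu : ∀ y ∈ Good Ω P E, Tendsto (fun j => gN f (M j) y) atTop (𝓝 (u y)))
    (hua : ∀ y ∈ Good Ω P E, ∃ r : ℝ, 0 < r ∧ ∃ a b c : ℝ, ∀ x ∈ Metric.ball y r,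
        u x = a * x.1 + b * x.2 + c)
    (hE : EdgeSet E) (hPl : Planar E) (hRat : ∀ e ∈ E, RatDir (e.2 - e.1)) {F : ℝ × ℝ → ℝ}
    {C : PlaneTropData} (hExt : ExtendsCurve Ω E m C) (hRep : RepresentsCornerLocus F C)
    (hT : IsTropPoly F) (hF0 : ∀ x ∈ frontier Ω, F x = 0) :
    ∀ y ∈ Good Ω P E, u y = F y := by
  have hFc := trop_cont hT
  have hconv := h.hΩ.convex
  have hcpt := h.hΩ.isCompact
  have hdense : interior Ω ⊆ closure (Good Ω P E) := by
    intro x hx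
    rw [mem_closure_iff]
    intro U hU hxU
    obtain ⟨y, hy, hyG⟩ := good_dense Ω P E (hU.inter isOpen_interior) Set.inter_subset_right ⟨x, hxU, hx⟩
    exact ⟨y, hy.1, hyG⟩
  have hgl := glue_all (w := fun y => u y - F y) (G := Good Ω P E) (X := interior Ω)
    (S := ((fun e : Seg => e.1) '' (↑E : Set Seg) ∪ (fun e : Seg => e.2) '' (↑E : Set Seg)) ∪
      (↑P : Set (ℝ × ℝ)))
    (isOpen_good Ω P E) hconv.interior.isPreconnected isOpen_interior hdense
    (((E.finite_toSet.image _).union (E.finite_toSet.image _)).union P.finite_toSet)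
    (by
      rintro z ((⟨e, he, rfl⟩ | ⟨e, he, rfl⟩) | hz) hG
      · exact hG.2.1 (Set.mem_biUnion he (left_mem_segment ℝ e.1 e.2))
      · exact hG.2.1 (Set.mem_biUnion he (right_mem_segment ℝ e.1 e.2))
      · exact hG.2.2 (by simpa using hz))
    (by
      intro x hx hxS
      have hxP : x ∉ P := fun hh => hxS (Or.inr (by simpa using hh))
      by_cases hxE : x ∈ gsupp E
      · have hxE' := hxE
        unfold gsupp at hxE'
        simp only [Set.mem_iUnion] at hxE'
        obtain ⟨e, he, hxe⟩ := hxE'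
        refine h.locaff_edge hW hM hu hua hE hPl hExt hRep he (hRat e he) hxe ?_ ?_ hx hxP
        · rintro rfl; exact hxS (Or.inl (Or.inl ⟨e, he, rfl⟩))
        · rintro rfl; exact hxS (Or.inl (Or.inr ⟨e, he, rfl⟩))
      · have hg : x ∈ Good Ω P E := ⟨hx, hxE, hxP⟩
        refine LocAff.sub ?_ ?_
        · obtain ⟨r, hr, a, b, c, H⟩ := hua x hg
          exact ⟨r, hr, a, b, c, fun y hy _ => H y hy⟩
        · have : x ∉ cornerLocus F := by
            intro hc
            rw [← hRep.1] at hc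
            apply hxE
            rw [← hExt.2.1]
            exact ⟨hc, interior_subset hx⟩
          have hla : LocallyAffine F x := by
            by_contra hn; exact this hn
          obtain ⟨U, hU, c1, c2, c0, H⟩ := hla
          obtain ⟨r, hr, hrU⟩ := Metric.mem_nhds_iff.1 hU
          exact ⟨r, hr, c1, c2, c0, fun y hy _ => H y (hrU hy)⟩)
  obtain ⟨a, b, c, H⟩ := hgl
  have hfr : ∀ z ∈ frontier Ω, a * z.1 + b * z.2 + c = 0 := by
    intro z hz
    have hzc : z ∈ closure (Good Ω P E) := by
      have h1 : z ∈ closure (interior Ω) := by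
        rw [hconv.closure_interior_eq_closure_of_nonempty_interior h.hΩ.2]
        exact frontier_subset_closure hz
      exact closure_minimal hdense isClosed_closure h1
    have habs : ∀ ε > 0, |a * z.1 + b * z.2 + c| ≤ 3 * ε := by
      intro ε hε
      obtain ⟨δ, hδ, N0, hN0, hbd⟩ := boundary_bound h.hΩ h.hPΩ ε hε
      have c1 : Continuous fun y : ℝ × ℝ => |(a * y.1 + b * y.2 + c) - (a * z.1 + b * z.2 + c)| := by
        fun_prop
      have c2 : Continuous fun y : ℝ × ℝ => |F y| := hFc.abs
      have n1 := (c1.continuousAt (x := z)).eventually_lt continuousAt_const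
        (show _ < ε by simpa using hε)
      have n2 := (c2.continuousAt (x := z)).eventually_lt continuousAt_const
        (show _ < ε by simpa [hF0 z hz] using hε)
      have n3 : ∀ᶠ y in 𝓝 z, dist y z < δ / 2 := Metric.ball_mem_nhds z (by positivity)
      obtain ⟨y, ⟨⟨y1, y2⟩, y3⟩, hyG⟩ := mem_closure_iff_nhds.1 hzc _ ((n1.and n2).and n3)
      have hu0 : 0 ≤ u y := ge_of_tendsto' (hu y hyG) fun j =>
        div_nonneg (by exact_mod_cast (h.odo _).nonneg _) (Nat.cast_nonneg _)
      have hu1 : u y ≤ ε := by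
        refine le_of_tendsto (hu y hyG) ?_
        have ev := hM.eventually ((eventually_inv_lt (show 0 < δ / 2 by positivity)).and
          (eventually_ge_atTop N0))
        filter_upwards [ev] with j hj
        obtain ⟨⟨hj1, hj2⟩, hj3⟩ := hj
        have hpos : (0 : ℝ) < M j := by positivity
        unfold gN
        rw [div_le_iff₀ hpos]
        by_cases hin : flr (M j) y ∈ latGrid Ω (M j)
        · refine hbd _ hj3 _ (h.odo _) _ hin z hz ?_
          have := dist_triangle (sc (M j) (flr (M j) y)) y z
          linarith [dist_sc_flr hj1 y]
        · rw [(h.odo _).zero _ hin]; simp; positivity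
      have e := H y hyG.1 hyG
      have e' : a * y.1 + b * y.2 + c = u y - F y := e.symm
      have y2' := abs_lt.1 y2
      have y1' := abs_lt.1 y1
      rw [abs_le]
      constructor <;> linarith
    by_contra hne
    have := habs (|a * z.1 + b * z.2 + c| / 6) (by positivity)
    have : 0 < |a * z.1 + b * z.2 + c| := by positivity
    linarith
  intro y hy
  have e := H y hy.1 hy
  have e' : u y - F y = a * y.1 + b * y.2 + c := e
  rw [affine_zero hcpt.isBounded hfr (interior_subset hy.1)] at e'
  linarith

theorem good_tendsto (h : Dat Ω P φ f E) {m : Seg → ℕ} (hW : WeakLimit Ω φ E m)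
    (hE : EdgeSet E) (hPl : Planar E) (hRat : ∀ e ∈ E, RatDir (e.2 - e.1)) {F : ℝ × ℝ → ℝ}
    {C : PlaneTropData} (hExt : ExtendsCurve Ω E m C) (hRep : RepresentsCornerLocus F C)
    (hT : IsTropPoly F) (hF0 : ∀ x ∈ frontier Ω, F x = 0) :
    ∀ y ∈ Good Ω P E, Tendsto (fun N => gN f N y) atTop (𝓝 (F y)) := by
  intro y hy
  refine tendsto_of_subseq_tendsto fun ns hns => ?_
  obtain ⟨ms, hms, u, hu, hua⟩ := h.exists_sub hns
  refine ⟨ms, ?_⟩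
  rw [← h.identify hW (hns.comp hms) hu hua hE hPl hRat hExt hRep hT hF0 y hy]
  exact hu y hy

theorem good_unif (h : Dat Ω P φ f E) {y : ℝ × ℝ} (hy : y ∈ Good Ω P E) {t : ℝ}
    (ht : Tendsto (fun N => gN f N y) atTop (𝓝 t)) {κ : ℝ} (hκ : 0 < κ) :
    ∃ δ > 0, ∀ᶠ N in atTop, ∀ v, dist (sc N v) y < δ → |(f N v : ℝ) / N - t| ≤ κ := by
  obtain ⟨r, K, hr, hA⟩ := h.affine hy
  set δ := min (r / 2) (κ / (8 * (|K| + 1))) with hδ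
  have hδ0 : 0 < δ := lt_min (by positivity) (by positivity)
  have hδr : δ ≤ r / 2 := min_le_left _ _
  have hδκ : 8 * ((|K| + 1) * δ) ≤ κ := by
    have : δ ≤ κ / (8 * (|K| + 1)) := min_le_right _ _
    rw [le_div_iff₀ (by positivity)] at this
    linarith
  refine ⟨δ, hδ0, ?_⟩
  have ht' : ∀ᶠ N in atTop, |gN f N y - t| < κ / 2 := by
    have := Metric.tendsto_nhds.1 ht (κ / 2) (by positivity)
    simpa [Real.dist_eq] using this
  filter_upwards [hA, eventually_inv_lt hδ0, ht'] with N hN1 hN2 hN3 v hv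
  obtain ⟨k, l, hk, hl, H⟩ := hN1
  have hNpos : (0 : ℝ) < N := by have := hN2.1; positivity
  have hfl := dist_sc_flr hN2.1 y
  have e := H v (flr N y) (by linarith) (by linarith)
  have eR : (f N v : ℝ) - f N (flr N y) =
      k * ((v.1 : ℝ) - (flr N y).1) + l * ((v.2 : ℝ) - (flr N y).2) := by exact_mod_cast e
  have hd : dist (sc N v) (sc N (flr N y)) ≤ 2 * δ := by
    have := dist_triangle_right (sc N v) (sc N (flr N y)) y
    linarith
  rw [dist_prod_le] at hd
  obtain ⟨d1, d2⟩ := hd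
  simp only [sc] at d1 d2
  rw [← sub_div] at d1 d2
  have eq : (f N v : ℝ) / N - gN f N y = k * (((v.1 : ℝ) - (flr N y).1) / N) +
      l * (((v.2 : ℝ) - (flr N y).2) / N) := by
    unfold gN; rw [← sub_div, eR]; ring
  have b1 : |(f N v : ℝ) / N - gN f N y| ≤ 4 * ((|K| + 1) * δ) := by
    rw [eq]
    refine (abs_add_le _ _).trans ?_
    rw [abs_mul, abs_mul]
    have hk' : |(k : ℝ)| ≤ |K| + 1 := hk.trans ((le_abs_self K).trans (by linarith))
    have hl' : |(l : ℝ)| ≤ |K| + 1 := hl.trans ((le_abs_self K).trans (by linarith))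
    have m1 := mul_le_mul hk' d1 (abs_nonneg _) (by positivity)
    have m2 := mul_le_mul hl' d2 (abs_nonneg _) (by positivity)
    linarith
  have := abs_sub_le ((f N v : ℝ) / N) (gN f N y) t
  linarith

end Dat

theorem cs1d (g : ℤ → ℝ) (j : ℤ) (n : ℕ) (J : Finset ℤ) (hJ : ∀ k < n, j + (k : ℤ) ∈ J) :
    (g (j + n) - g j) ^ 2 ≤ n * ∑ k ∈ J, (g (k + 1) - g k) ^ 2 := by
  have e : g (j + n) - g j = ∑ k ∈ Finset.range n, (g (j + k + 1) - g (j + k)) := by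
    have := Finset.sum_range_sub (fun k : ℕ => g (j + k)) n
    simp only [Nat.cast_add, Nat.cast_one, Nat.cast_zero, add_zero, ← add_assoc] at this
    exact this.symm
  rw [e]
  refine sq_sum_le_card_mul_sum_sq.trans ?_
  rw [Finset.card_range]
  refine mul_le_mul_of_nonneg_left ?_ (Nat.cast_nonneg n)
  have inj : Set.InjOn (fun k : ℕ => j + (k : ℤ)) (Finset.range n : Set ℕ) := by
    intro x _ y _ h; simpa using h
  rw [← Finset.sum_image (f := fun k => (g (k + 1) - g k) ^ 2) inj]
  refine Finset.sum_le_sum_of_subset_of_nonneg ?_ fun _ _ _ => sq_nonneg _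
  intro k hk
  obtain ⟨q, hq, rfl⟩ := Finset.mem_image.1 hk
  exact hJ q (Finset.mem_range.1 hq)

theorem cs1d' (g : ℤ → ℝ) {j j' : ℤ} (J : Finset ℤ)
    (hJ : ∀ k, min j j' ≤ k → k ≤ max j j' → k ∈ J) :
    (g j' - g j) ^ 2 ≤ |(j' : ℝ) - j| * ∑ k ∈ J, (g (k + 1) - g k) ^ 2 := by
  rcases le_total j j' with h | h
  · obtain ⟨n, rfl⟩ := Int.le.dest h
    have := cs1d g j n J (fun k hk => hJ _ (by omega) (by omega))
    simpa using this
  · obtain ⟨n, rfl⟩ := Int.le.dest h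
    have := cs1d g j' n J (fun k hk => hJ _ (by omega) (by omega))
    rw [abs_sub_comm, ← neg_sub, neg_sq]
    simpa using this

theorem clean (g : ℕ → ℤ → ℤ → ℝ) {a b c1 c2 c1' c2' τ κ Cc : ℝ} (hab : a < b) (hc1 : c1' < c1)
    (hc2 : c2 < c2') (hκ : 0 < κ) (hC : 0 ≤ Cc)
    (hen : ∀ᶠ N : ℕ in atTop, ∀ I J : Finset ℤ, (∀ i ∈ I, (i : ℝ) / N ∈ Set.Icc a b) →
      (∀ j ∈ J, (j : ℝ) / N ∈ Set.Icc c1' c2') →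
      ∑ i ∈ I, ∑ j ∈ J, (g N i (j + 1) - g N i j) ^ 2 ≤ Cc * (N : ℝ) ^ 2)
    (hnear : ∀ δ > 0, ∀ᶠ N : ℕ in atTop, ∀ i j : ℤ, (i : ℝ) / N ∈ Set.Icc a b →
      (j : ℝ) / N ∈ Set.Icc c1 c2 → ∃ j' : ℤ, |(j' : ℝ) - j| ≤ δ * N ∧ g N i j' ≤ τ * N) :
    ∀ᶠ N : ℕ in atTop, ∃ i : ℤ, (i : ℝ) / N ∈ Set.Icc a b ∧
      ∀ j : ℤ, (j : ℝ) / N ∈ Set.Icc c1 c2 → g N i j ≤ (τ + κ) * N := by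
  have hba : 0 < b - a := by linarith
  set δ := min (min (c1 - c1') (c2' - c2)) (κ ^ 2 * (b - a) / (4 * (Cc + 1))) with hδ
  have hδ0 : 0 < δ := lt_min (lt_min (by linarith) (by linarith)) (by positivity)
  have hδ1 : δ ≤ c1 - c1' := (min_le_left _ _).trans (min_le_left _ _)
  have hδ2 : δ ≤ c2' - c2 := (min_le_left _ _).trans (min_le_right _ _)
  have hδ3 : δ * (4 * (Cc + 1)) ≤ κ ^ 2 * (b - a) := by
    rw [← le_div_iff₀ (by positivity)]; exact min_le_right _ _
  filter_upwards [hen, hnear δ hδ0, eventually_inv_lt (show 0 < (b - a) / 2 by positivity)]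
    with N h1 h2 h3
  have hN : (0 : ℝ) < N := by have := h3.1; positivity
  have hN2 : 1 < (b - a) / 2 * N := by
    have := h3.2; rwa [div_lt_iff₀ hN] at this
  by_contra hcon
  push Not at hcon
  set I := Finset.Icc ⌈(N : ℝ) * a⌉ ⌊(N : ℝ) * b⌋ with hI
  set J := Finset.Icc ⌈(N : ℝ) * c1'⌉ ⌊(N : ℝ) * c2'⌋ with hJ
  have mem : ∀ (x y : ℝ) (i : ℤ), i ∈ Finset.Icc ⌈(N : ℝ) * x⌉ ⌊(N : ℝ) * y⌋ ↔
      (i : ℝ) / N ∈ Set.Icc x y := by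
    intro x y i
    rw [Finset.mem_Icc, Int.ceil_le, Int.le_floor, Set.mem_Icc, le_div_iff₀ hN, div_le_iff₀ hN,
      mul_comm x, mul_comm y]
  have hI' : ∀ i ∈ I, (i : ℝ) / N ∈ Set.Icc a b := fun i hi => (mem a b i).1 hi
  have E := h1 I J hI' (fun j hj => (mem _ _ j).1 hj)
  have low : ∀ i ∈ I, κ ^ 2 * N / δ ≤ ∑ j ∈ J, (g N i (j + 1) - g N i j) ^ 2 := by
    intro i hi
    obtain ⟨j, hj, hgj⟩ := hcon i (hI' i hi)
    obtain ⟨j', hj', hgj'⟩ := h2 i j (hI' i hi) hj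
    have c := cs1d' (g N i) (j := j) (j' := j') J (by
      intro k k1 k2
      rw [mem]
      obtain ⟨d1, d2⟩ := abs_le.1 hj'
      obtain ⟨q1, q2⟩ := hj
      rw [le_div_iff₀ hN] at q1
      rw [div_le_iff₀ hN] at q2
      have k1' : min (j : ℝ) (j' : ℝ) ≤ (k : ℝ) := by exact_mod_cast k1
      have k2' : (k : ℝ) ≤ max (j : ℝ) (j' : ℝ) := by exact_mod_cast k2
      have mm1 : (j : ℝ) - δ * N ≤ min (j : ℝ) j' := le_min (by nlinarith) (by linarith)
      have mm2 : max (j : ℝ) j' ≤ (j : ℝ) + δ * N := max_le (by nlinarith) (by linarith)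
      have p1 := mul_le_mul_of_nonneg_right hδ1 hN.le
      have p2 := mul_le_mul_of_nonneg_right hδ2 hN.le
      constructor
      · rw [le_div_iff₀ hN]; linarith
      · rw [div_le_iff₀ hN]; linarith)
    have sq : (κ * N) ^ 2 ≤ (g N i j' - g N i j) ^ 2 := by
      rw [← neg_sub, neg_sq]
      refine pow_le_pow_left₀ (by positivity) ?_ 2
      linarith
    have S0 : 0 ≤ ∑ j ∈ J, (g N i (j + 1) - g N i j) ^ 2 := Finset.sum_nonneg fun _ _ => sq_nonneg _
    have c' := sq.trans (c.trans (mul_le_mul_of_nonneg_right hj' S0))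
    rw [div_le_iff₀ hδ0]
    refine le_of_mul_le_mul_left ?_ hN
    linarith
  have E2 : (I.card : ℝ) * (κ ^ 2 * N / δ) ≤ Cc * (N : ℝ) ^ 2 := by
    refine le_trans ?_ E
    rw [← nsmul_eq_mul]
    exact Finset.card_nsmul_le_sum _ _ _ low
  have hcard : (b - a) / 2 * N ≤ I.card := by
    rw [hI, Int.card_Icc]
    have t : ((⌊(N : ℝ) * b⌋ + 1 - ⌈(N : ℝ) * a⌉ : ℤ) : ℝ) ≤
        ((⌊(N : ℝ) * b⌋ + 1 - ⌈(N : ℝ) * a⌉).toNat : ℝ) := by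
      exact_mod_cast Int.self_le_toNat _
    push_cast at t
    have f1 := Int.lt_floor_add_one ((N : ℝ) * b)
    have f2 := Int.ceil_lt_add_one ((N : ℝ) * a)
    nlinarith
  have E3 := (mul_le_mul_of_nonneg_right hcard (show 0 ≤ κ ^ 2 * N / δ by positivity)).trans E2
  have E4 : 2 * (Cc + 1) * (N : ℝ) ^ 2 ≤ (b - a) / 2 * N * (κ ^ 2 * N / δ) := by
    rw [mul_div_assoc', le_div_iff₀ hδ0]
    have := mul_le_mul_of_nonneg_right hδ3 (show 0 ≤ (N : ℝ) ^ 2 / 2 by positivity)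
    nlinarith
  have : 0 < (N : ℝ) ^ 2 := by positivity
  nlinarith

theorem near (g : ℕ → ℤ → ℤ → ℝ) {a b c1 c2 τ : ℝ}
    (hpt : ∀ s ∈ Set.Icc a b, ∀ t ∈ Set.Icc c1 c2, ∀ δ > 0, ∃ t' : ℝ, |t' - t| < δ ∧ ∃ δ' > 0,
      ∀ᶠ N : ℕ in atTop, ∀ i j : ℤ, |(i : ℝ) / N - s| < δ' → |(j : ℝ) / N - t'| < δ' →
        g N i j ≤ τ * N) :
    ∀ δ > 0, ∀ᶠ N : ℕ in atTop, ∀ i j : ℤ, (i : ℝ) / N ∈ Set.Icc a b →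
      (j : ℝ) / N ∈ Set.Icc c1 c2 → ∃ j' : ℤ, |(j' : ℝ) - j| ≤ δ * N ∧ g N i j' ≤ τ * N := by
  intro δ hδ
  have hK : IsCompact (Set.Icc a b ×ˢ Set.Icc c1 c2) := isCompact_Icc.prod isCompact_Icc
  have := hK.induction_on (p := fun S => ∀ᶠ N : ℕ in atTop, ∀ i j : ℤ,
    ((i : ℝ) / N, (j : ℝ) / N) ∈ S → ∃ j' : ℤ, |(j' : ℝ) - j| ≤ δ * N ∧ g N i j' ≤ τ * N)
    (by simp)
    (fun S T hST hT => hT.mono fun N h i j hij => h i j (hST hij))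
    (fun S T hS hT => by
      filter_upwards [hS, hT] with N h1 h2 i j hij
      exact hij.elim (h1 i j) (h2 i j))
    (by
      rintro ⟨s, t⟩ ⟨hs, ht⟩
      obtain ⟨t', htt, δ', hδ', H⟩ := hpt s hs t ht (δ / 3) (by positivity)
      refine ⟨Metric.ball (s, t) (min δ' (δ / 3)),
        mem_nhdsWithin_of_mem_nhds (Metric.ball_mem_nhds _ (by positivity)), ?_⟩
      filter_upwards [H, eventually_inv_lt (show 0 < min δ' (δ / 3) by positivity)] with N h1 h2 i j hij
      have hN : (0 : ℝ) < N := by have := h2.1; positivity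
      rw [Metric.mem_ball, dist_prod_lt] at hij
      obtain ⟨d1, d2⟩ := hij
      simp only at d1 d2
      obtain ⟨n1, n2⟩ := lt_min_iff.1 h2.2
      have fl := (flr_abs N (0, t')).2
      simp only [flr] at fl
      have fl' : |(⌊(N : ℝ) * t'⌋ : ℝ) / N - t'| ≤ 1 / N := by
        rw [le_div_iff₀ hN, ← abs_of_pos hN, ← abs_mul, abs_of_pos hN, sub_mul,
          div_mul_cancel₀ _ hN.ne', mul_comm t']
        exact fl
      refine ⟨⌊(N : ℝ) * t'⌋, ?_, h1 i _ (d1.trans_le (min_le_left _ _)) (fl'.trans_lt n1)⟩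
      have tri : |(⌊(N : ℝ) * t'⌋ : ℝ) / N - (j : ℝ) / N| ≤ δ := by
        have d2' := abs_lt.1 (d2.trans_le (min_le_right _ _))
        have fl'' := abs_le.1 (fl'.trans n2.le)
        have htt' := abs_lt.1 htt
        rw [abs_le]; constructor <;> linarith
      rwa [← sub_div, abs_div, abs_of_pos hN, div_le_iff₀ hN] at tri)
  filter_upwards [this] with N h i j hi hj
  exact h i j ⟨hi, hj⟩

theorem slice_abs (g : ℕ → ℤ → ℤ → ℝ) (B : ℝ → ℝ → Prop) {p1 p2 ρ τ κ Cc : ℝ} (hρ : 0 < ρ)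
    (hκ : 0 < κ) (hC : 0 ≤ Cc) {T : Set ℝ} (hT : T.Finite) (hB : ∀ s ∉ T, {t | B s t}.Finite)
    (hu : ∀ s t : ℝ, |s - p1| < 2 * ρ → |t - p2| < 2 * ρ → ¬ B s t → ∃ δ' > 0,
      ∀ᶠ N : ℕ in atTop, ∀ i j : ℤ, |(i : ℝ) / N - s| < δ' → |(j : ℝ) / N - t| < δ' →
        g N i j ≤ τ * N)
    (hen : ∀ᶠ N : ℕ in atTop, ∀ I J : Finset ℤ, (∀ i ∈ I, |(i : ℝ) / N - p1| < 2 * ρ) →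
      (∀ j ∈ J, |(j : ℝ) / N - p2| < 2 * ρ) →
      ∑ i ∈ I, ∑ j ∈ J, (g N i (j + 1) - g N i j) ^ 2 ≤ Cc * (N : ℝ) ^ 2)
    {α β : ℝ} (hαβ : α < β) (hα : p1 - ρ ≤ α) (hβ : β ≤ p1 + ρ) :
    ∀ᶠ N : ℕ in atTop, ∃ i : ℤ, (α < (i : ℝ) / N ∧ (i : ℝ) / N < β) ∧
      ∀ j : ℤ, |(j : ℝ) / N - p2| ≤ ρ → g N i j ≤ (τ + κ) * N := by
  obtain ⟨s0, hs0, hs0T⟩ := ((Set.Ioo_infinite hαβ).sdiff hT).nonempty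
  have hop : IsOpen (Set.Ioo α β ∩ Tᶜ) := isOpen_Ioo.inter hT.isClosed.isOpen_compl
  obtain ⟨ε, hε, hball⟩ := Metric.isOpen_iff.1 hop s0 ⟨hs0, hs0T⟩
  have hab : ∀ s ∈ Set.Icc (s0 - ε / 2) (s0 + ε / 2), s ∈ Set.Ioo α β ∧ s ∉ T := by
    intro s hs
    have : s ∈ Metric.ball s0 ε := by
      rw [Metric.mem_ball, Real.dist_eq, abs_lt]
      constructor <;> linarith [hs.1, hs.2]
    exact hball this
  have hnear := near g (a := s0 - ε / 2) (b := s0 + ε / 2) (c1 := p2 - ρ) (c2 := p2 + ρ) (τ := τ) (by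
    intro s hs t ht δ hδ
    obtain ⟨hs1, hsT⟩ := hab s hs
    have hd : 0 < min δ ρ := lt_min hδ hρ
    obtain ⟨t', ht', hBt⟩ := ((Set.Ioo_infinite (show t - min δ ρ < t + min δ ρ by linarith)).sdiff
      (hB s hsT)).nonempty
    have h1 := min_le_left δ ρ
    have h2 := min_le_right δ ρ
    refine ⟨t', by rw [abs_lt]; constructor <;> linarith [ht'.1, ht'.2], ?_⟩
    refine hu s t' ?_ ?_ hBt
    · rw [abs_lt]; constructor <;> linarith [hs1.1, hs1.2]
    · rw [abs_lt]; constructor <;> linarith [ht'.1, ht'.2, ht.1, ht.2])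
  have := clean g (a := s0 - ε / 2) (b := s0 + ε / 2) (c1 := p2 - ρ) (c2 := p2 + ρ)
    (c1' := p2 - 3 / 2 * ρ) (c2' := p2 + 3 / 2 * ρ) (τ := τ) (κ := κ) (Cc := Cc)
    (by linarith) (by linarith) (by linarith) hκ hC (by
      filter_upwards [hen] with N h I J hI hJ
      refine h I J (fun i hi => ?_) (fun j hj => ?_)
      · have := (hab _ (hI i hi)).1
        rw [abs_lt]; constructor <;> linarith [this.1, this.2]
      · have := hJ j hj
        rw [abs_lt]; constructor <;> linarith [this.1, this.2]) hnear
  filter_upwards [this] with N h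
  obtain ⟨i, hi, hj⟩ := h
  refine ⟨i, (hab _ hi).1, fun j hjj => hj j ?_⟩
  have := abs_le.1 hjj
  constructor <;> linarith [this.1, this.2]

theorem seg_slice1 (e : Seg) {s : ℝ} (hs : e.1.1 ≠ s) : {t : ℝ | (s, t) ∈ seg e}.Finite := by
  apply Set.Subsingleton.finite
  intro t ht t' ht'
  have h1 : (s, t) ∈ segment ℝ e.1 e.2 := ht
  have h2 : (s, t') ∈ segment ℝ e.1 e.2 := ht'
  rw [segment_eq_image'] at h1 h2
  obtain ⟨a, -, ha⟩ := h1
  obtain ⟨b, -, hb⟩ := h2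
  simp only [Prod.ext_iff, Prod.fst_add, Prod.snd_add, Prod.smul_fst, Prod.smul_snd, smul_eq_mul,
    Prod.fst_sub, Prod.snd_sub] at ha hb
  have hd : e.2.1 - e.1.1 ≠ 0 := by
    intro h
    rw [h] at ha
    exact hs (by linarith [ha.1])
  have : a = b := by
    apply mul_right_cancel₀ hd
    linarith [ha.1, hb.1]
  rw [← ha.2, ← hb.2, this]

theorem seg_slice2 (e : Seg) {s : ℝ} (hs : e.1.2 ≠ s) : {t : ℝ | (t, s) ∈ seg e}.Finite := by
  apply Set.Subsingleton.finite
  intro t ht t' ht'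
  have h1 : (t, s) ∈ segment ℝ e.1 e.2 := ht
  have h2 : (t', s) ∈ segment ℝ e.1 e.2 := ht'
  rw [segment_eq_image'] at h1 h2
  obtain ⟨a, -, ha⟩ := h1
  obtain ⟨b, -, hb⟩ := h2
  simp only [Prod.ext_iff, Prod.fst_add, Prod.snd_add, Prod.smul_fst, Prod.smul_snd, smul_eq_mul,
    Prod.fst_sub, Prod.snd_sub] at ha hb
  have hd : e.2.2 - e.1.2 ≠ 0 := by
    intro h
    rw [h] at ha
    exact hs (by linarith [ha.2])
  have : a = b := by
    apply mul_right_cancel₀ hd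
    linarith [ha.2, hb.2]
  rw [← ha.1, ← hb.1, this]

theorem bad_slice1 (E : Finset Seg) (P : Finset (ℝ × ℝ)) {s : ℝ}
    (hs : s ∉ ((fun e : Seg => e.1.1) '' (E : Set Seg))) :
    {t : ℝ | (s, t) ∈ gsupp E ∪ (↑P : Set (ℝ × ℝ))}.Finite := by
  have : {t : ℝ | (s, t) ∈ gsupp E ∪ (↑P : Set (ℝ × ℝ))} ⊆
      (⋃ e ∈ (E : Set Seg), {t : ℝ | (s, t) ∈ seg e}) ∪ Prod.snd '' (↑P : Set (ℝ × ℝ)) := by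
    rintro t (ht | ht)
    · left
      unfold gsupp at ht
      simp only [Set.mem_iUnion] at ht ⊢
      obtain ⟨e, he, hte⟩ := ht
      exact ⟨e, he, hte⟩
    · right; exact ⟨_, ht, rfl⟩
  refine Set.Finite.subset (Set.Finite.union (Set.Finite.biUnion E.finite_toSet fun e he => ?_)
    (P.finite_toSet.image _)) this
  exact seg_slice1 e fun h => hs ⟨e, he, h⟩

theorem bad_slice2 (E : Finset Seg) (P : Finset (ℝ × ℝ)) {s : ℝ}
    (hs : s ∉ ((fun e : Seg => e.1.2) '' (E : Set Seg))) :
    {t : ℝ | (t, s) ∈ gsupp E ∪ (↑P : Set (ℝ × ℝ))}.Finite := by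
  have : {t : ℝ | (t, s) ∈ gsupp E ∪ (↑P : Set (ℝ × ℝ))} ⊆
      (⋃ e ∈ (E : Set Seg), {t : ℝ | (t, s) ∈ seg e}) ∪ Prod.fst '' (↑P : Set (ℝ × ℝ)) := by
    rintro t (ht | ht)
    · left
      unfold gsupp at ht
      simp only [Set.mem_iUnion] at ht ⊢
      obtain ⟨e, he, hte⟩ := ht
      exact ⟨e, he, hte⟩
    · right; exact ⟨_, ht, rfl⟩
  refine Set.Finite.subset (Set.Finite.union (Set.Finite.biUnion E.finite_toSet fun e he => ?_)
    (P.finite_toSet.image _)) this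
  exact seg_slice2 e fun h => hs ⟨e, he, h⟩

/-- comparison step for the spike -/
theorem spike_cmp {Ω : Set (ℝ × ℝ)} {P : Finset (ℝ × ℝ)} {N : ℕ} {f : V → ℤ} (hf : Odo Ω P N f)
    {q : V} {i1 i2 j1 j2 θ R : ℤ} (h1 : i1 < q.1) (h2 : q.1 < i2) (h3 : j1 < q.2) (h4 : q.2 < j2)
    (hR : i2 - q.1 ≤ R)
    (hA : ∀ v : V, i1 ≤ v.1 → v.1 ≤ i2 → j1 ≤ v.2 → v.2 ≤ j2 → v ∈ latGrid Ω N)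
    (hc : ∀ v : V, i1 < v.1 → v.1 < i2 → j1 < v.2 → v.2 < j2 → cnt P N v ≤ if v = q then 1 else 0)
    (hb1 : ∀ j, j1 ≤ j → j ≤ j2 → f (i1, j) ≤ θ) (hb2 : ∀ j, j1 ≤ j → j ≤ j2 → f (i2, j) ≤ θ)
    (hb3 : ∀ i, i1 ≤ i → i ≤ i2 → f (i, j1) ≤ θ) (hb4 : ∀ i, i1 ≤ i → i ≤ i2 → f (i, j2) ≤ θ) :
    f q ≤ θ + R := by
  have hθ : 0 ≤ θ := (hf.nonneg _).trans (hb1 j1 le_rfl (by omega))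
  have := hf.comparison {v | i1 < v.1 ∧ v.1 < i2 ∧ j1 < v.2 ∧ v.2 < j2}
    (fun v hv => by
      have hv' : i1 < v.1 ∧ v.1 < i2 ∧ j1 < v.2 ∧ v.2 < j2 := hv
      exact hA v hv'.1.le hv'.2.1.le hv'.2.2.1.le hv'.2.2.2.le)
    (fun w => (θ + R) - max 0 (w.1 - q.1))
    (fun v hv => by
      have hv' : i1 < v.1 ∧ v.1 < i2 ∧ j1 < v.2 ∧ v.2 < j2 := hv
      show 0 ≤ (θ + R) - max 0 (v.1 - q.1)
      omega)
    (fun v hv => by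
      have hv' : i1 < v.1 ∧ v.1 < i2 ∧ j1 < v.2 ∧ v.2 < j2 := hv
      rw [lap_corner]
      have := hc v hv'.1 hv'.2.1 hv'.2.2.1 hv'.2.2.2
      by_cases hvq : v = q
      · rw [if_pos hvq] at this; rw [if_pos (by rw [hvq])]; omega
      · rw [if_neg hvq] at this; split_ifs <;> omega)
    (fun v hv w hw hwA => by
      have hv' : i1 < v.1 ∧ v.1 < i2 ∧ j1 < v.2 ∧ v.2 < j2 := hv
      have hw' : ¬ (i1 < w.1 ∧ w.1 < i2 ∧ j1 < w.2 ∧ w.2 < j2) := hwA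
      obtain ⟨n1, n2⟩ := nbr_abs hw
      rw [abs_le] at n1 n2
      have key : f w ≤ θ := by
        obtain ⟨w1, w2⟩ := w
        simp only at n1 n2 hw'
        by_cases c1 : w1 = i1
        · rw [c1]; exact hb1 _ (by omega) (by omega)
        by_cases c2 : w1 = i2
        · rw [c2]; exact hb2 _ (by omega) (by omega)
        by_cases c3 : w2 = j1
        · rw [c3]; exact hb3 _ (by omega) (by omega)
        have c4 : w2 = j2 := by omega
        rw [c4]; exact hb4 _ (by omega) (by omega)
      show f w ≤ (θ + R) - max 0 (w.1 - q.1)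
      omega) q ⟨h1, h2, h3, h4⟩
  have e : (θ + R) - max 0 (q.1 - q.1) = θ + R := by simp
  rw [← e]; exact this

namespace Dat
variable {Ω : Set (ℝ × ℝ)} {P : Finset (ℝ × ℝ)} {φ f : ℕ → V → ℤ} {E : Finset Seg}

theorem good_of {y : ℝ × ℝ} (hy : y ∈ interior Ω) (hb : y ∉ gsupp E ∪ (↑P : Set (ℝ × ℝ))) :
    y ∈ Good Ω P E := by
  rw [Set.mem_union, not_or] at hb
  exact ⟨hy, hb.1, by simpa using hb.2⟩

theorem energy (h : Dat Ω P φ f E) {p : ℝ × ℝ} {ρ : ℝ} (hρ : 0 < ρ)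
    (hball : Metric.ball p (3 * ρ) ⊆ interior Ω) :
    ∃ Cc : ℝ, 0 ≤ Cc ∧ ∀ᶠ N : ℕ in atTop,
      ∑ v ∈ bx N p (2 * ρ), gr (fun w => (f N w : ℝ)) v ≤ Cc * (N : ℝ) ^ 2 := by
  obtain ⟨C, hC, N0, hN0, hh⟩ := energy_bound p (show 0 < 2 * ρ by linarith)
    (show 2 * ρ < 3 * ρ by linarith)
  obtain ⟨B, hB, hbd⟩ := h.bound
  refine ⟨C * B ^ 2, by positivity, ?_⟩
  filter_upwards [eventually_ge_atTop N0] with N hN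
  have hN1 : 1 ≤ N := hN0.trans hN
  have := hh N hN (fun w => (f N w : ℝ)) (B * N)
    (fun v => by exact_mod_cast (h.odo N).nonneg v)
    (fun v => (le_abs_self _).trans (hbd N hN1 v))
    (fun v hv => by
      rw [lapR_cast]
      rw [mem_bx hN1] at hv
      have hv' : v ∈ latGrid Ω N := (mem_latGrid hN1 v).2 (interior_subset (hball hv))
      have h1 := (h.odo N).lap_le v hv'
      have h2 := cnt_nonneg P N v
      have : lap (f N) v ≤ 0 := by omega
      exact_mod_cast this)
  calc _ ≤ _ := this
    _ = _ := by ring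

theorem spike (h : Dat Ω P φ f E) {F : ℝ × ℝ → ℝ} (hFc : Continuous F)
    (hg : ∀ y ∈ Good Ω P E, Tendsto (fun N => gN f N y) atTop (𝓝 (F y)))
    {p : ℝ × ℝ} (hp : p ∈ P) {κ : ℝ} (hκ : 0 < κ) :
    ∀ᶠ N : ℕ in atTop, (f N (flr N p) : ℝ) ≤ (F p + κ) * N := by
  classical
  obtain ⟨r1, hr1, hb1⟩ := Metric.isOpen_iff.1 isOpen_interior p (h.hPΩ hp)
  obtain ⟨r2, hr2, hb2⟩ := Metric.continuous_iff.1 hFc p (κ / 8) (by positivity)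
  obtain ⟨r3, hr3, hb3⟩ := Metric.isOpen_iff.1 ((P.erase p).finite_toSet.isClosed.isOpen_compl) p
    (by simp)
  obtain ⟨ρ, hρ, hρ1, hρ2, hρ3, hρ4⟩ : ∃ ρ : ℝ, 0 < ρ ∧ 8 * ρ ≤ r1 ∧ 8 * ρ ≤ r2 ∧ 8 * ρ ≤ r3 ∧
      8 * ρ ≤ κ := by
    refine ⟨min (min r1 r2) (min r3 κ) / 8, by positivity, ?_⟩
    have a1 := min_le_left (min r1 r2) (min r3 κ)
    have a2 := min_le_right (min r1 r2) (min r3 κ)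
    have a3 := min_le_left r1 r2
    have a4 := min_le_right r1 r2
    have a5 := min_le_left r3 κ
    have a6 := min_le_right r3 κ
    refine ⟨?_, ?_, ?_, ?_⟩ <;> linarith
  have hballΩ : Metric.ball p (3 * ρ) ⊆ interior Ω :=
    (Metric.ball_subset_ball (by linarith)).trans hb1
  obtain ⟨Cc, hCc, hen⟩ := h.energy hρ hballΩ
  have hpt : ∀ y : ℝ × ℝ, |y.1 - p.1| < 2 * ρ → |y.2 - p.2| < 2 * ρ →
      y ∉ gsupp E ∪ (↑P : Set (ℝ × ℝ)) → ∃ δ' > 0, ∀ᶠ N : ℕ in atTop, ∀ v : V,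
        |(v.1 : ℝ) / N - y.1| < δ' → |(v.2 : ℝ) / N - y.2| < δ' →
          (f N v : ℝ) ≤ (F p + κ / 4) * N := by
    intro y hy1 hy2 hyb
    have hd : dist y p < 2 * ρ := dist_prod_lt.2 ⟨hy1, hy2⟩
    have hyG : y ∈ Good Ω P E := good_of (hballΩ (Metric.mem_ball.2 (by linarith))) hyb
    obtain ⟨δ, hδ, hev⟩ := h.good_unif hyG (hg y hyG) (show 0 < κ / 8 by positivity)
    refine ⟨δ, hδ, ?_⟩
    filter_upwards [hev, eventually_ge_atTop 1] with N hN hN1 v h1 h2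
    have := (abs_le.1 (hN v (dist_sc.2 ⟨h1, h2⟩))).2
    have hF := hb2 y (by linarith)
    rw [Real.dist_eq] at hF
    have hF' := (abs_lt.1 hF).2
    have hN0 : (0 : ℝ) < N := by exact_mod_cast hN1
    rw [← div_le_iff₀ hN0]
    linarith
  have inbx : ∀ (N : ℕ), 1 ≤ N → ∀ v : V, |(v.1 : ℝ) / N - p.1| < 2 * ρ →
      |(v.2 : ℝ) / N - p.2| < 2 * ρ → v ∈ bx N p (2 * ρ) :=
    fun N hN v h1 h2 => (mem_bx hN).2 (dist_sc.2 ⟨h1, h2⟩)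
  have S1 := fun α β : ℝ => slice_abs (α := α) (β := β) (fun N i j => (f N (i, j) : ℝ))
    (fun s t => (s, t) ∈ gsupp E ∪ (↑P : Set (ℝ × ℝ))) (p1 := p.1) (p2 := p.2) (ρ := ρ)
    (τ := F p + κ / 4) (κ := κ / 4) (Cc := Cc) hρ (by positivity) hCc
    (E.finite_toSet.image (fun e : Seg => e.1.1)) (fun s hs => bad_slice1 E P hs)
    (fun s t hs ht hb => by
      obtain ⟨δ, hδ, hev⟩ := hpt (s, t) hs ht hb
      exact ⟨δ, hδ, hev.mono fun N hN i j hi hj => hN (i, j) hi hj⟩)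
    (by
      filter_upwards [hen, eventually_ge_atTop 1] with N hN hN1 I J hI hJ
      refine le_trans ?_ hN
      rw [← Finset.sum_product' I J (fun i j => ((f N (i, j + 1) : ℝ) - f N (i, j)) ^ 2)]
      refine le_trans (Finset.sum_le_sum (g := fun v => gr (fun w => (f N w : ℝ)) v) ?_)
        (Finset.sum_le_sum_of_subset_of_nonneg ?_ fun v _ _ => gr_nonneg _ v)
      · rintro ⟨i, j⟩ -
        simp only [gr, Prod.mk_add_mk, Prod.mk_sub_mk, add_zero, sub_zero]
        have q1 := sq_nonneg ((f N (i + 1, j) : ℝ) - f N (i, j))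
        have q2 := sq_nonneg ((f N (i - 1, j) : ℝ) - f N (i, j))
        have q3 := sq_nonneg ((f N (i, j - 1) : ℝ) - f N (i, j))
        linarith
      · rintro ⟨i, j⟩ hij
        rw [Finset.mem_product] at hij
        exact inbx N hN1 _ (hI _ hij.1) (hJ _ hij.2))
  have S2 := fun α β : ℝ => slice_abs (α := α) (β := β) (fun N i j => (f N (j, i) : ℝ))
    (fun s t => (t, s) ∈ gsupp E ∪ (↑P : Set (ℝ × ℝ))) (p1 := p.2) (p2 := p.1) (ρ := ρ)
    (τ := F p + κ / 4) (κ := κ / 4) (Cc := Cc) hρ (by positivity) hCc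
    (E.finite_toSet.image (fun e : Seg => e.1.2)) (fun s hs => bad_slice2 E P hs)
    (fun s t hs ht hb => by
      obtain ⟨δ, hδ, hev⟩ := hpt (t, s) ht hs hb
      exact ⟨δ, hδ, hev.mono fun N hN i j hi hj => hN (j, i) hj hi⟩)
    (by
      filter_upwards [hen, eventually_ge_atTop 1] with N hN hN1 I J hI hJ
      refine le_trans ?_ hN
      rw [Finset.sum_comm, ← Finset.sum_product' J I (fun j i => ((f N (j + 1, i) : ℝ) - f N (j, i)) ^ 2)]
      refine le_trans (Finset.sum_le_sum (g := fun v => gr (fun w => (f N w : ℝ)) v) ?_)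
        (Finset.sum_le_sum_of_subset_of_nonneg ?_ fun v _ _ => gr_nonneg _ v)
      · rintro ⟨i, j⟩ -
        simp only [gr, Prod.mk_add_mk, Prod.mk_sub_mk, add_zero, sub_zero]
        have q1 := sq_nonneg ((f N (i, j + 1) : ℝ) - f N (i, j))
        have q2 := sq_nonneg ((f N (i - 1, j) : ℝ) - f N (i, j))
        have q3 := sq_nonneg ((f N (i, j - 1) : ℝ) - f N (i, j))
        linarith
      · rintro ⟨i, j⟩ hij
        rw [Finset.mem_product] at hij
        exact inbx N hN1 _ (hJ _ hij.1) (hI _ hij.2))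
  have A1 := S1 (p.1 - ρ) (p.1 - ρ / 2) (by linarith) le_rfl (by linarith)
  have A2 := S1 (p.1 + ρ / 2) (p.1 + ρ) (by linarith) (by linarith) le_rfl
  have A3 := S2 (p.2 - ρ) (p.2 - ρ / 2) (by linarith) le_rfl (by linarith)
  have A4 := S2 (p.2 + ρ / 2) (p.2 + ρ) (by linarith) (by linarith) le_rfl
  filter_upwards [A1, A2, A3, A4, eventually_inv_lt (show 0 < ρ / 4 by positivity)]
    with N B1 B2 B3 B4 hN
  obtain ⟨i1, ⟨a1, b1⟩, c1⟩ := B1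
  obtain ⟨i2, ⟨a2, b2⟩, c2⟩ := B2
  obtain ⟨j1, ⟨a3, b3⟩, c3⟩ := B3
  obtain ⟨j2, ⟨a4, b4⟩, c4⟩ := B4
  obtain ⟨hN1, hNρ⟩ := hN
  have hN0 : (0 : ℝ) < N := by exact_mod_cast hN1
  have dle : ∀ {i j : ℤ}, i ≤ j → (i : ℝ) / N ≤ (j : ℝ) / N := fun hij =>
    div_le_div_of_nonneg_right (by exact_mod_cast hij) hN0.le
  have dlt : ∀ {i j : ℤ}, (i : ℝ) / N < (j : ℝ) / N → i < j := fun hij => by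
    have := (div_lt_div_iff_of_pos_right hN0).1 hij
    exact_mod_cast this
  have fl := dist_prod_le.1 (dist_sc_flr hN1 p)
  simp only [sc] at fl
  obtain ⟨fl1, fl2⟩ := fl
  rw [abs_le] at fl1 fl2
  set q := flr N p with hq
  have key := spike_cmp (h.odo N) (q := q) (i1 := i1) (i2 := i2) (j1 := j1) (j2 := j2)
    (θ := ⌊(F p + κ / 4 + κ / 4) * N⌋) (R := ⌈ρ * N⌉ + 1)
    (dlt (by linarith)) (dlt (by linarith)) (dlt (by linarith)) (dlt (by linarith))
    (by
      have e1 : (i2 : ℝ) < (p.1 + ρ) * N := by rwa [div_lt_iff₀ hN0] at b2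
      have e2 : p.1 * N - 1 ≤ (q.1 : ℝ) := by
        have := (abs_le.1 (flr_abs N p).1).1
        rw [← hq] at this; linarith
      have e3 := Int.le_ceil (ρ * N)
      have : ((i2 - q.1 : ℤ) : ℝ) ≤ ((⌈ρ * N⌉ + 1 : ℤ) : ℝ) := by push_cast; linarith
      exact_mod_cast this)
    (fun v h1 h2 h3 h4 => by
      rw [mem_latGrid hN1]
      refine interior_subset (hballΩ ?_)
      have := dle h1; have := dle h2; have := dle h3; have := dle h4
      rw [Metric.mem_ball, dist_sc, abs_lt, abs_lt]
      refine ⟨⟨?_, ?_⟩, ?_, ?_⟩ <;> linarith)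
    (fun v h1 h2 h3 h4 => by
      unfold cnt
      rw [Finset.sum_eq_single_of_mem p hp]
      intro p' hp' hne
      rw [if_neg]
      intro hv
      have hd := dist_sc_flr hN1 p'
      rw [← hv] at hd
      have hvp : dist (sc N v) p < 3 * ρ := by
        have := dle h1.le; have := dle h2.le; have := dle h3.le; have := dle h4.le
        rw [dist_sc, abs_lt, abs_lt]
        refine ⟨⟨?_, ?_⟩, ?_, ?_⟩ <;> linarith
      have tri := dist_triangle_left p' p (sc N v)
      have : p' ∈ Metric.ball p r3 := by rw [Metric.mem_ball]; linarith
      exact hb3 this (by simp [hne, hp']))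
    (fun j h1 h2 => Int.le_floor.2 (c1 j (by
      have := dle h1; have := dle h2; rw [abs_le]; constructor <;> linarith)))
    (fun j h1 h2 => Int.le_floor.2 (c2 j (by
      have := dle h1; have := dle h2; rw [abs_le]; constructor <;> linarith)))
    (fun j h1 h2 => Int.le_floor.2 (c3 j (by
      have := dle h1; have := dle h2; rw [abs_le]; constructor <;> linarith)))
    (fun j h1 h2 => Int.le_floor.2 (c4 j (by
      have := dle h1; have := dle h2; rw [abs_le]; constructor <;> linarith)))
  have key' : (f N q : ℝ) ≤ ⌊(F p + κ / 4 + κ / 4) * N⌋ + (⌈ρ * N⌉ + 1) := by exact_mod_cast key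
  have e1 := Int.floor_le ((F p + κ / 4 + κ / 4) * N)
  have e2 := Int.ceil_lt_add_one (ρ * N)
  have e3 : 1 < ρ / 4 * N := by rwa [div_lt_iff₀ hN0] at hNρ
  have e4 := mul_le_mul_of_nonneg_right hρ4 hN0.le
  nlinarith

end Dat

theorem flr_dist_add {N : ℕ} (hN : 1 ≤ N) (z η : ℝ × ℝ) :
    dist (sc N (flr N z + flr N η)) (z + η) ≤ 2 / N := by
  have h1 := dist_prod_le.1 (dist_sc_flr hN z)
  have h2 := dist_prod_le.1 (dist_sc_flr hN η)
  have e2 : (2 : ℝ) / N = 1 / N + 1 / N := by ring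
  rw [e2]
  refine dist_prod_le.2 ?_
  simp only [sc, Prod.fst_add, Prod.snd_add, Int.cast_add, add_div] at h1 h2 ⊢
  simp only [abs_le] at h1 h2 ⊢
  refine ⟨⟨?_, ?_⟩, ?_, ?_⟩ <;> linarith [h1.1.1, h1.1.2, h1.2.1, h1.2.2, h2.1.1, h2.1.2, h2.2.1, h2.2.2]

theorem flr_dist_sub {N : ℕ} (hN : 1 ≤ N) (z η : ℝ × ℝ) :
    dist (sc N (flr N z - flr N η)) (z - η) ≤ 2 / N := by
  have h1 := dist_prod_le.1 (dist_sc_flr hN z)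
  have h2 := dist_prod_le.1 (dist_sc_flr hN η)
  have e2 : (2 : ℝ) / N = 1 / N + 1 / N := by ring
  rw [e2]
  refine dist_prod_le.2 ?_
  simp only [sc, Prod.fst_sub, Prod.snd_sub, Int.cast_sub, sub_div] at h1 h2 ⊢
  simp only [abs_le] at h1 h2 ⊢
  refine ⟨⟨?_, ?_⟩, ?_, ?_⟩ <;> linarith [h1.1.1, h1.1.2, h1.2.1, h1.2.2, h2.1.1, h2.1.2, h2.2.1, h2.2.2]

namespace Dat
variable {Ω : Set (ℝ × ℝ)} {P : Finset (ℝ × ℝ)} {φ f : ℕ → V → ℤ} {E : Finset Seg}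

theorem exists_eta (h : Dat Ω P φ f E) {F : ℝ × ℝ → ℝ} (hFc : Continuous F) {x : ℝ × ℝ}
    (hx : x ∈ interior Ω) {κ δ : ℝ} (hκ : 0 < κ) (hδ : 0 < δ) :
    ∃ η : ℝ × ℝ, dist η 0 < δ ∧ (x + η ∈ Good Ω P E ∧ |F (x + η) - F x| < κ) ∧
      (x - η ∈ Good Ω P E ∧ |F (x - η) - F x| < κ) ∧
      ∀ p ∈ P, p + η ∈ Good Ω P E ∧ |F (p + η) - F p| < κ := by
  have nb : ∀ z ∈ interior Ω, ∀ᶠ η in 𝓝 z, η ∈ interior Ω ∧ |F η - F z| < κ := by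
    intro z hz
    refine Filter.Eventually.and (show ∀ᶠ η in 𝓝 z, η ∈ interior Ω from isOpen_interior.mem_nhds hz) ?_
    have := (Metric.tendsto_nhds.1 hFc.continuousAt κ hκ : ∀ᶠ η in 𝓝 z, dist (F η) (F z) < κ)
    simpa [Real.dist_eq] using this
  have nbp : ∀ z ∈ interior Ω, ∀ᶠ η in 𝓝 (0 : ℝ × ℝ), z + η ∈ interior Ω ∧ |F (z + η) - F z| < κ := by
    intro z hz
    have : Tendsto (fun η : ℝ × ℝ => z + η) (𝓝 0) (𝓝 z) := by
      have : Continuous fun η : ℝ × ℝ => z + η := by fun_prop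
      simpa using this.tendsto 0
    exact this.eventually (nb z hz)
  have nbm : ∀ᶠ η in 𝓝 (0 : ℝ × ℝ), x - η ∈ interior Ω ∧ |F (x - η) - F x| < κ := by
    have : Tendsto (fun η : ℝ × ℝ => x - η) (𝓝 0) (𝓝 x) := by
      have : Continuous fun η : ℝ × ℝ => x - η := by fun_prop
      simpa using this.tendsto 0
    exact this.eventually (nb x hx)
  have nbP : ∀ᶠ η in 𝓝 (0 : ℝ × ℝ), ∀ p ∈ P, p + η ∈ interior Ω ∧ |F (p + η) - F p| < κ :=
    (eventually_all_finset P).2 fun p hp => nbp p (h.hPΩ hp)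
  have nbd : ∀ᶠ η in 𝓝 (0 : ℝ × ℝ), dist η 0 < δ := Metric.ball_mem_nhds 0 hδ
  have all := (nbd.and ((nbp x hx).and (nbm.and nbP)))
  have ae0 : ∀ᵐ y ∂(MeasureTheory.volume : MeasureTheory.Measure (ℝ × ℝ)),
      y ∉ gsupp E ∪ (↑P : Set (ℝ × ℝ)) := MeasureTheory.measure_eq_zero_iff_ae_notMem.1 (bad_null E P)
  have aep : ∀ z : ℝ × ℝ, ∀ᵐ η ∂(MeasureTheory.volume : MeasureTheory.Measure (ℝ × ℝ)),
      z + η ∉ gsupp E ∪ (↑P : Set (ℝ × ℝ)) := fun z =>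
    (MeasureTheory.measurePreserving_add_left MeasureTheory.volume z).quasiMeasurePreserving.ae ae0
  have aem : ∀ᵐ η ∂(MeasureTheory.volume : MeasureTheory.Measure (ℝ × ℝ)),
      x - η ∉ gsupp E ∪ (↑P : Set (ℝ × ℝ)) :=
    (MeasureTheory.Measure.measurePreserving_sub_left MeasureTheory.volume x).quasiMeasurePreserving.ae ae0
  have aeP : ∀ᵐ η ∂(MeasureTheory.volume : MeasureTheory.Measure (ℝ × ℝ)),
      ∀ p ∈ P, p + η ∉ gsupp E ∪ (↑P : Set (ℝ × ℝ)) :=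
    (eventually_all_finset P).2 fun p _ => aep p
  have dn := MeasureTheory.Measure.dense_of_ae ((aep x).and (aem.and aeP))
  obtain ⟨η, h1, h2⟩ := mem_closure_iff_nhds.1 (dn 0) _ all
  obtain ⟨a1, a2, a3, a4⟩ := h1
  obtain ⟨b1, b2, b3⟩ := h2
  exact ⟨η, a1, ⟨good_of a2.1 b1, a2.2⟩, ⟨good_of a3.1 b2, a3.2⟩,
    fun p hp => ⟨good_of (a4 p hp).1 (b3 p hp), (a4 p hp).2⟩⟩

theorem interior_tendsto (h : Dat Ω P φ f E) {F : ℝ × ℝ → ℝ} (hFc : Continuous F)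
    (hg : ∀ y ∈ Good Ω P E, Tendsto (fun N => gN f N y) atTop (𝓝 (F y)))
    {x : ℝ × ℝ} (hx : x ∈ interior Ω) :
    Tendsto (fun N : ℕ => (f N (flr N x) : ℝ) / N) atTop (𝓝 (F x)) := by
  rw [Metric.tendsto_nhds]
  intro ε hε
  obtain ⟨κ, hκ, hκε⟩ : ∃ κ : ℝ, 0 < κ ∧ 8 * κ = ε := ⟨ε / 8, by positivity, by ring⟩
  obtain ⟨δb, hδb, N0, hN0, hbb⟩ := boundary_bound h.hΩ h.hPΩ κ hκ
  obtain ⟨η, hη, ⟨gp, fp⟩, ⟨gm, fm⟩, hP⟩ := h.exists_eta hFc hx hκ (show 0 < δb / 2 by positivity)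
  obtain ⟨δ1, hδ1, ev1⟩ := h.good_unif gp (hg _ gp) hκ
  obtain ⟨δ2, hδ2, ev2⟩ := h.good_unif gm (hg _ gm) hκ
  have ev3 : ∀ᶠ N : ℕ in atTop, ∀ p ∈ P, (f N (flr N p) : ℝ) ≤ f N (flr N p + flr N η) + 3 * κ * N := by
    refine (eventually_all_finset P).2 fun p hp => ?_
    obtain ⟨gq, fq⟩ := hP p hp
    obtain ⟨δ, hδ, ev⟩ := h.good_unif gq (hg _ gq) hκ
    filter_upwards [ev, h.spike hFc hg hp hκ, eventually_inv_lt (show 0 < δ / 2 by positivity)]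
      with N e1 e2 e3
    have hN : (0 : ℝ) < N := by exact_mod_cast e3.1
    have d := flr_dist_add e3.1 p η
    have : (2 : ℝ) / N = 2 * (1 / N) := by ring
    have a1 := (abs_le.1 (e1 _ (show _ < δ by linarith [e3.2]))).1
    have a2 := (abs_lt.1 fq).1
    have a3 : (F p - 2 * κ) * N ≤ f N (flr N p + flr N η) := by
      rw [← le_div_iff₀ hN]; linarith
    linarith
  filter_upwards [ev1, ev2, ev3, eventually_ge_atTop N0,
    eventually_inv_lt (show 0 < min (min (δ1 / 2) (δ2 / 2)) (min (δb / 2) κ) by positivity)]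
    with N e1 e2 e3 e4 e5
  obtain ⟨hN1, e5⟩ := e5
  rw [lt_min_iff, lt_min_iff, lt_min_iff] at e5
  obtain ⟨⟨s1, s2⟩, s3, s4⟩ := e5
  have hN : (0 : ℝ) < N := by exact_mod_cast hN1
  have two : (2 : ℝ) / N = 2 * (1 / N) := by ring
  have hKc := Int.le_ceil (3 * κ * N)
  have hKc2 := Int.ceil_lt_add_one (3 * κ * N)
  have s4' : 1 < κ * N := by rwa [div_lt_iff₀ hN] at s4
  have hκN : 0 < κ * N := by positivity
  have sh := (h.odo N).shift (flr N η) ⌈3 * κ * N⌉ (Int.ceil_nonneg (by positivity))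
    (fun p hp => by
      have := e3 p hp
      have : (f N (flr N p) : ℝ) ≤ ((f N (flr N p + flr N η) + ⌈3 * κ * N⌉ : ℤ) : ℝ) := by
        push_cast; linarith
      exact_mod_cast this)
    (fun v hv hve => by
      rw [mem_latGrid hN1] at hv hve
      obtain ⟨w, hw, hwd⟩ := exists_frontier_near hv hve
      have d1 : dist (sc N v) (sc N (v + flr N η)) = dist (sc N (flr N η)) 0 := by
        rw [dist_comm, dist_eq_norm, dist_eq_norm]
        congr 1
        ext <;> simp [sc, add_div]
      have d2 := dist_triangle (sc N (flr N η)) η 0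
      have d3 := dist_sc_flr hN1 η
      have := hbb N e4 _ (h.odo N) v ((mem_latGrid hN1 v).2 hv) w hw (by linarith)
      have : (f N v : ℝ) ≤ (⌈3 * κ * N⌉ : ℝ) := by linarith
      exact_mod_cast this)
  have U : (f N (flr N x) : ℝ) ≤ f N (flr N x + flr N η) + ⌈3 * κ * N⌉ := by
    exact_mod_cast sh (flr N x)
  have Lw : (f N (flr N x - flr N η) : ℝ) ≤ f N (flr N x) + ⌈3 * κ * N⌉ := by
    have := sh (flr N x - flr N η)
    rw [sub_add_cancel] at this
    exact_mod_cast this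
  have d1 := flr_dist_add hN1 x η
  have d2 := flr_dist_sub hN1 x η
  have a1 := (abs_le.1 (e1 _ (show _ < δ1 by linarith))).2
  have a2 := (abs_le.1 (e2 _ (show _ < δ2 by linarith))).1
  have b1 := (abs_lt.1 fp).2
  have b2 := (abs_lt.1 fm).1
  have c1 : (f N (flr N x + flr N η) : ℝ) ≤ (F x + 2 * κ) * N := by
    rw [← div_le_iff₀ hN]; linarith
  have c2 : (F x - 2 * κ) * N ≤ (f N (flr N x - flr N η) : ℝ) := by
    rw [← le_div_iff₀ hN]; linarith
  rw [Real.dist_eq, abs_lt]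
  constructor
  · have : F x - ε < (f N (flr N x) : ℝ) / N := by
      rw [lt_div_iff₀ hN, ← hκε]; linarith
    linarith
  · have : (f N (flr N x) : ℝ) / N < F x + ε := by
      rw [div_lt_iff₀ hN, ← hκε]; linarith
    linarith

theorem frontier_tendsto (h : Dat Ω P φ f E) {x : ℝ × ℝ} (hx : x ∈ frontier Ω) :
    Tendsto (fun N : ℕ => (f N (flr N x) : ℝ) / N) atTop (𝓝 0) := by
  rw [Metric.tendsto_nhds]
  intro ε hε
  obtain ⟨δb, hδb, N0, hN0, hbb⟩ := boundary_bound h.hΩ h.hPΩ (ε / 2) (by positivity)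
  filter_upwards [eventually_ge_atTop N0, eventually_inv_lt hδb] with N e1 e2
  have hN : (0 : ℝ) < N := by exact_mod_cast e2.1
  have h0 : (0 : ℝ) ≤ f N (flr N x) := by exact_mod_cast (h.odo N).nonneg _
  rw [Real.dist_eq, sub_zero, abs_of_nonneg (by positivity), div_lt_iff₀ hN]
  by_cases hv : flr N x ∈ latGrid Ω N
  · have := hbb N e1 _ (h.odo N) _ hv x hx ((dist_sc_flr e2.1 x).trans_lt e2.2)
    have : 0 < ε * N := by positivity
    linarith
  · rw [(h.odo N).zero _ hv]; simp; positivity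

end Dat

/-- Let `F_N` be the toppling function (odometer) of the state
`3 + ∑_{p ∈ P} δ_{[Np]}` on `Γ_N = (NΩ) ∩ ℤ²`, i.e. the pointwise minimum of the class
`𝓗` of nonnegative functions vanishing outside `Γ_N` with `state + ΔH ≤ 3` on `Γ_N`.
Then the rescaled toppling functions `F̃_N(x) = F_N([Nx])/N` converge pointwise on `Ω`
to the `Ω`-tropical polynomial `F_{Ω,P}` of the curve `C_{Ω,P}`. -/
theorem statement10
    (Ω : Set (ℝ × ℝ)) (hΩ : IsLatticePolygon Ω)
    (P : Finset (ℝ × ℝ)) (hP : P.Nonempty) (hPΩ : ↑P ⊆ interior Ω)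
    (φ : ℕ → V → ℤ) (hφ : ∀ N : ℕ, Relaxes (latGrid Ω N) (stateN Ω P N) (φ N))
    (Ctil : Set (ℝ × ℝ)) (hCcl : IsClosed Ctil)
    (hC : Filter.Tendsto (fun N => EMetric.hausdorffEdist (devSet Ω N (φ N)) Ctil)
      Filter.atTop (nhds 0))
    (E : Finset Seg) (m : Seg → ℕ)
    (hEdge : EdgeSet E) (hPl : Planar E) (hRat : ∀ e ∈ E, RatDir (e.2 - e.1))
    (hSupp : gsupp E = closure (Ctil ∩ interior Ω))
    (hmpos : ∀ e ∈ E, 0 < m e) (hW : WeakLimit Ω φ E m)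
    (FOP : ℝ × ℝ → ℝ) (hFOP : IsOmegaPolyOf Ω E m FOP)
    (FN : ℕ → V → ℤ)
    (hFN : ∀ (N : ℕ) (v : V),
      IsLeast {n : ℤ | ∃ H : V → ℤ, Odometer (latGrid Ω N) (stateN Ω P N) H ∧ H v = n}
        (FN N v)) :
    ∀ x ∈ Ω,
      Filter.Tendsto (fun N : ℕ => (FN N (flr N x) : ℝ) / N)
        Filter.atTop (nhds (FOP x)) := by
  intro x hx
  have h : Dat Ω P φ FN E := dat_of hΩ hPΩ hφ hCcl hC hSupp hFN
  obtain ⟨F, C, hExt, hT, hF0, hRep, hFF⟩ := hFOP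
  rw [hFF x hx]
  have hg := h.good_tendsto hW hEdge hPl hRat hExt hRep hT hF0
  by_cases hi : x ∈ interior Ω
  · exact h.interior_tendsto (trop_cont hT) hg hi
  · have hf : x ∈ frontier Ω := by
      rw [hΩ.isCompact.isClosed.frontier_eq]; exact ⟨hx, hi⟩
    rw [hF0 x hf]
    exact h.frontier_tendsto hf
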